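/- arXiv:2602.23707 — 5 statements merged into one kernel-verified Lean document; each statement's English description precedes it below -/
import Mathlib

section
/- For every prime power ℓ and integer r ≥ 0 there is a constant K = K(ℓ, r) such that for every n ≥ 1 and every n×n alternating matrix C over F_ℓ of rank c, a uniformly random C-symmetric matrix M satisfies |P[dim ker M = r] − p_r(n)| ≤ K · n · ℓ^{−c}, where p_r(n) := (#{A an n×n matrix over F_ℓ : dim ker A = r})/ℓ^{n²} is the probability that a uniformly random n×n matrix over F_ℓ has r-dimensional kernel. Equivalently, |#{M : M − Mᵀ = C, dim ker M = r}/ℓ^{n(n+1)/2} − p_r(n)| ≤ K · n · ℓ^{−c}. -/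
open Matrix

theorem sum_newton_basis {x : ℕ → ℝ} (hx : Function.Injective x) (y : ℝ) {r m : ℕ} (hm : r ≤ m) :
    ∑ k ∈ Finset.Icc r m, (∏ i ∈ (Finset.range (k + 1)).erase r, (x r - x i))⁻¹ *
        ∏ i ∈ Finset.range k, (y - x i) =
      ∏ i ∈ (Finset.range (m + 1)).erase r, (y - x i) / (x r - x i) := by
  induction m, hm using Nat.le_induction with
  | base =>
    have : (Finset.range (r + 1)).erase r = Finset.range r := by
      ext i; simp; omega
    rw [this, Finset.Icc_self, Finset.sum_singleton, this, Finset.prod_div_distrib, div_eq_inv_mul]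
  | succ m hm ih =>
    have hr : r ∈ Finset.range (m + 1) := by simp; omega
    have he : (Finset.range (m + 1 + 1)).erase r
        = insert (m + 1) ((Finset.range (m + 1)).erase r) := by
      ext i; simp; omega
    have hn : m + 1 ∉ (Finset.range (m + 1)).erase r := by simp
    have h0 : x r - x (m + 1) ≠ 0 := sub_ne_zero.2 (hx.ne (by omega))
    rw [Finset.sum_Icc_succ_top (by omega), ih, he,
      Finset.prod_insert hn, Finset.prod_insert hn, ← Finset.mul_prod_erase _ _ hr,
      Finset.prod_div_distrib]
    have h1 : ∏ i ∈ (Finset.range (m + 1)).erase r, (x r - x i) ≠ 0 :=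
      Finset.prod_ne_zero_iff.2 fun i hi =>
        sub_ne_zero.2 (hx.ne (Finset.ne_of_mem_erase hi).symm)
    field_simp
    ring

theorem sum_newton_basis_eq_ite {x : ℕ → ℝ} (hx : Function.Injective x) {d r m : ℕ}
    (hr : r ≤ m) (hd : d ≤ m) :
    ∑ k ∈ Finset.Icc r m, (∏ i ∈ (Finset.range (k + 1)).erase r, (x r - x i))⁻¹ *
        ∏ i ∈ Finset.range k, (x d - x i) = if d = r then 1 else 0 := by
  rw [sum_newton_basis hx _ hr]
  split_ifs with h
  · subst h
    exact Finset.prod_eq_one fun i hi =>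
      div_self (sub_ne_zero.2 (hx.ne (Finset.ne_of_mem_erase hi).symm))
  · exact Finset.prod_eq_zero (i := d) (by simp; omega) (by simp)

theorem bddAbove_of_mul_one_sub_le {B : ℕ → ℝ} (h0 : ∀ j, 0 ≤ B j)
    (h : ∀ j, B (j + 1) * (1 - (1 / 2) ^ (j + 1)) ≤ B j) : ∃ K, ∀ j, B j ≤ K := by
  have key : ∀ j, B (j + 1) * (1 + (1 / 2) ^ j) ≤ 2 * B 1 := by
    intro j
    induction j with
    | zero => simp; linarith
    | succ j ih =>
      have ht : (0 : ℝ) < (1 / 2) ^ j := by positivity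
      have ht1 : ((1 : ℝ) / 2) ^ j ≤ 1 := pow_le_one₀ (by norm_num) (by norm_num)
      have h1 := h (j + 1)
      have h2 := h0 (j + 1 + 1)
      simp only [pow_succ] at h1 ⊢
      generalize ((1 : ℝ) / 2) ^ j = t at *
      refine le_trans ?_ ((mul_le_mul_of_nonneg_right h1 (by linarith)).trans ih)
      rw [mul_assoc]
      refine mul_le_mul_of_nonneg_left ?_ h2
      nlinarith
  refine ⟨B 0 + 2 * B 1, fun j => ?_⟩
  cases j with
  | zero => linarith [h0 1]
  | succ j =>
    have := key j
    have : 0 ≤ B (j + 1) * (1 / 2) ^ j := mul_nonneg (h0 _) (by positivity)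
    linarith [h0 0]

theorem exists_newton_coeff_bound {q : ℝ} (hq : 2 ≤ q) (r : ℕ) :
    ∃ K, ∀ k, r ≤ k →
      |(∏ i ∈ (Finset.range (k + 1)).erase r, (q ^ r - q ^ i))⁻¹| * q ^ ((k + 1).choose 2) ≤ K := by
  obtain ⟨K, hK⟩ := bddAbove_of_mul_one_sub_le
    (B := fun j => |(∏ i ∈ (Finset.range (r + j + 1)).erase r, (q ^ r - q ^ i))⁻¹| *
      q ^ ((r + j + 1).choose 2)) (fun j => by positivity) (fun j => by
      have he : (Finset.range (r + (j + 1) + 1)).erase r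
          = insert (r + j + 1) ((Finset.range (r + j + 1)).erase r) := by
        ext i; simp; omega
      have hc : (r + (j + 1) + 1).choose 2 = (r + j + 1) + (r + j + 1).choose 2 := by
        rw [← add_assoc r j 1, Nat.choose_succ_succ' (r + j + 1) 1, Nat.choose_one_right]
      have hq1 : 1 < q := by linarith
      have hlt : q ^ r < q ^ (r + j + 1) := pow_lt_pow_right₀ hq1 (by omega)
      simp only [he, hc]
      rw [Finset.prod_insert (by simp), mul_inv, abs_mul, abs_inv (q ^ r - _),
        abs_of_neg (by linarith), pow_add q (r + j + 1)]
      have hpos : 0 < q ^ (r + j + 1) - q ^ r := by linarith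
      have hb : q ^ (r + j + 1) * (1 - (1 / 2) ^ (j + 1)) ≤ q ^ (r + j + 1) - q ^ r := by
        have : q ^ r = q ^ (r + j + 1) * (1 / q) ^ (j + 1) := by
          rw [add_assoc, pow_add, one_div, inv_pow, mul_assoc, mul_inv_cancel₀ (by positivity),
            mul_one]
        rw [mul_sub, mul_one, sub_le_sub_iff_left, this]
        gcongr
      set A := |(∏ i ∈ (Finset.range (r + j + 1)).erase r, (q ^ r - q ^ i))⁻¹|
      calc _ = (A * q ^ ((r + j + 1).choose 2)) *
            ((q ^ (r + j + 1) * (1 - (1 / 2) ^ (j + 1))) / (q ^ (r + j + 1) - q ^ r)) := by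
            rw [neg_sub]; ring
        _ ≤ (A * q ^ ((r + j + 1).choose 2)) * 1 := by
            gcongr
            exact (div_le_one hpos).2 hb
        _ = _ := mul_one _)
  refine ⟨K, fun k hk => ?_⟩
  obtain ⟨j, rfl⟩ := Nat.exists_eq_add_of_le hk
  exact hK j

section counting
variable {F : Type*} [Field F] {n k : ℕ}

theorem exists_sub_transpose_eq {C : Matrix (Fin n) (Fin n) F} (hC : Cᵀ = -C)
    (h0 : ∀ i, C i i = 0) : ∃ U : Matrix (Fin n) (Fin n) F, U - Uᵀ = C := by
  refine ⟨of fun i j => if i < j then C i j else 0, ?_⟩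
  ext i j
  have := congrFun₂ hC i j
  simp only [transpose_apply, Matrix.neg_apply] at this
  rcases lt_trichotomy i j with h | rfl | h
  · simp [h, h.not_gt]
  · simp [h0]
  · simp [h, h.not_gt, this]

theorem dotProduct_sub_transpose_mulVec {ι : Type*} [Fintype ι] (U : Matrix ι ι F)
    (v w : ι → F) :
    v ⬝ᵥ (U - Uᵀ) *ᵥ w = v ⬝ᵥ U *ᵥ w - w ⬝ᵥ U *ᵥ v := by
  rw [sub_mulVec, dotProduct_sub, mulVec_transpose, dotProduct_comm v (w ᵥ* U),
    ← dotProduct_mulVec]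

/-- The Gram matrix of the bilinear form attached to a square matrix. -/
noncomputable def gramEquiv {ι : Type*} [Fintype ι] [DecidableEq ι]
    (b : Module.Basis ι F (Fin n → F)) : Matrix (Fin n) (Fin n) F ≃ₗ[F] Matrix ι ι F :=
  Matrix.toBilin'.trans (LinearMap.BilinForm.toMatrix b)

theorem gramEquiv_apply {ι : Type*} [Fintype ι] [DecidableEq ι]
    (b : Module.Basis ι F (Fin n → F)) (M : Matrix (Fin n) (Fin n) F) (i j : ι) :
    gramEquiv b M i j = b i ⬝ᵥ M *ᵥ b j := by
  simp [gramEquiv, LinearMap.BilinForm.toMatrix_apply, Matrix.toBilin'_apply']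

theorem gramEquiv_transpose {ι : Type*} [Fintype ι] [DecidableEq ι]
    (b : Module.Basis ι F (Fin n → F)) (M : Matrix (Fin n) (Fin n) F) :
    gramEquiv b Mᵀ = (gramEquiv b M)ᵀ := by
  ext i j
  rw [transpose_apply, gramEquiv_apply, gramEquiv_apply, mulVec_transpose,
    dotProduct_comm, ← dotProduct_mulVec]

theorem mulVec_eq_zero_iff_gramEquiv {ι : Type*} [Fintype ι] [DecidableEq ι]
    (b : Module.Basis ι F (Fin n → F)) (M : Matrix (Fin n) (Fin n) F) (j : ι) :
    M *ᵥ b j = 0 ↔ ∀ i, gramEquiv b M i j = 0 := by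
  simp only [gramEquiv_apply]
  refine ⟨fun h i => by simp [h], fun h => ?_⟩
  have : (Matrix.toBilin' M).flip (b j) = 0 :=
    b.ext fun i => by simpa [Matrix.toBilin'_apply'] using h i
  refine dotProduct_eq_zero _ fun w => ?_
  rw [dotProduct_comm]
  simpa [Matrix.toBilin'_apply'] using LinearMap.congr_fun this w

theorem exists_basis_extend {v : Fin k → Fin n → F} (hv : LinearIndependent F v) :
    ∃ b : Module.Basis (Fin k ⊕ Fin (n - k)) F (Fin n → F), ∀ i, b (Sum.inl i) = v i := by
  classical
  let b := Module.Basis.sumExtend hv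
  have := Module.Finite.finite_basis b
  have : Finite (Module.Basis.sumExtendIndex hv) :=
    Finite.of_injective (Sum.inr : _ → Fin k ⊕ _) Sum.inr_injective
  have : Fintype (Module.Basis.sumExtendIndex hv) := Fintype.ofFinite _
  have hcard := Module.finrank_eq_card_basis b
  simp only [Module.finrank_fintype_fun_eq_card, Fintype.card_fin, Fintype.card_sum] at hcard
  let e : Module.Basis.sumExtendIndex hv ≃ Fin (n - k) :=
    Fintype.equivFinOfCardEq (by omega)
  refine ⟨b.reindex ((Equiv.refl _).sumCongr e), fun i => ?_⟩
  simp [b, Module.Basis.sumExtend]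
  rfl

theorem dotProduct_eq_zero_of_mulVec_eq_zero {M U : Matrix (Fin n) (Fin n) F}
    (hM : M - Mᵀ = U - Uᵀ) {v w : Fin n → F} (hv : M *ᵥ v = 0) (hw : M *ᵥ w = 0) :
    v ⬝ᵥ (U - Uᵀ) *ᵥ w = 0 := by
  rw [← hM, dotProduct_sub_transpose_mulVec, hv, hw]
  simp

variable [Fintype F]

theorem natCard_sub_transpose_eq {ι : Type*} [Fintype ι] (U : Matrix ι ι F) :
    Nat.card {M : Matrix ι ι F // M - Mᵀ = U - Uᵀ} =
      Fintype.card F ^ (Fintype.card ι + 1).choose 2 := by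
  classical
  let e : {M : Matrix ι ι F // M - Mᵀ = U - Uᵀ} ≃
      {f : ι → ι → F // ∀ a b, f a b = f b a} :=
    { toFun := fun M => ⟨fun a b => M.1 a b - U a b, fun a b => by
        have := congrFun₂ M.2 a b
        simp only [Matrix.sub_apply, transpose_apply] at this
        linear_combination this⟩
      invFun := fun f => ⟨of f.1 + U, by
        ext a b
        simp [f.2 a b]⟩
      left_inv := fun M => by ext; simp
      right_inv := fun f => by ext; simp }
  rw [Nat.card_congr (e.trans Sym2.lift), Nat.card_eq_fintype_card, Fintype.card_fun, Sym2.card]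

theorem natCard_mulVec_eq_zero {v : Fin k → Fin n → F} (hv : LinearIndependent F v) :
    Nat.card {M : Matrix (Fin n) (Fin n) F // ∀ j, M *ᵥ v j = 0} =
      Fintype.card F ^ (n * (n - k)) := by
  classical
  obtain ⟨b, hb⟩ := exists_basis_extend hv
  have hk : k ≤ n := by simpa using hv.fintype_card_le_finrank
  let e : {M : Matrix (Fin n) (Fin n) F // ∀ j, M *ᵥ v j = 0} ≃
      Matrix (Fin k ⊕ Fin (n - k)) (Fin (n - k)) F :=
    { toFun := fun M => (gramEquiv b M.1).submatrix id Sum.inr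
      invFun := fun D => ⟨(gramEquiv b).symm (fromCols 0 D), fun j => by
        rw [← hb, mulVec_eq_zero_iff_gramEquiv]
        simp⟩
      left_inv := fun M => by
        ext1
        apply (gramEquiv b).injective
        ext i (j | j)
        · have := M.2 j
          rw [← hb, mulVec_eq_zero_iff_gramEquiv] at this
          simp [this]
        · simp
      right_inv := fun D => by ext; simp }
  rw [Nat.card_congr (e.trans of.symm), Nat.card_eq_fintype_card, Fintype.card_fun,
    Fintype.card_fun, Fintype.card_sum, Fintype.card_fin, Fintype.card_fin, ← pow_mul,
    Nat.add_sub_cancel' hk, mul_comm]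

theorem natCard_sub_transpose_mulVec_eq_zero {v : Fin k → Fin n → F}
    (hv : LinearIndependent F v) (U : Matrix (Fin n) (Fin n) F)
    (hiso : ∀ i j, v i ⬝ᵥ (U - Uᵀ) *ᵥ v j = 0) :
    Nat.card {M : Matrix (Fin n) (Fin n) F // M - Mᵀ = U - Uᵀ ∧ ∀ j, M *ᵥ v j = 0} =
      Fintype.card F ^ (n - k + 1).choose 2 := by
  classical
  obtain ⟨b, hb⟩ := exists_basis_extend hv
  set V := gramEquiv b U with hV
  have hVV : gramEquiv b (U - Uᵀ) = V - Vᵀ := by rw [map_sub, gramEquiv_transpose]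
  have h11 : ∀ i j, V (Sum.inl i) (Sum.inl j) - V (Sum.inl j) (Sum.inl i) = 0 := by
    intro i j
    have := congrFun₂ hVV (Sum.inl i) (Sum.inl j)
    rw [gramEquiv_apply, hb, hb, hiso] at this
    simpa using this.symm
  have hiff : ∀ M : Matrix (Fin n) (Fin n) F, M - Mᵀ = U - Uᵀ ↔
      gramEquiv b M - (gramEquiv b M)ᵀ = V - Vᵀ := by
    intro M
    rw [← hVV, ← gramEquiv_transpose, ← map_sub, (gramEquiv b).injective.eq_iff]
  rw [← Fintype.card_fin (n - k), ← natCard_sub_transpose_eq V.toBlocks₂₂]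
  refine Nat.card_congr
    { toFun := fun M => ⟨(gramEquiv b M.1).toBlocks₂₂, by
        have := (hiff _).1 M.2.1
        ext i j
        exact congrFun₂ this (Sum.inr i) (Sum.inr j)⟩
      invFun := fun D => ⟨(gramEquiv b).symm
          (fromBlocks 0 (V.toBlocks₁₂ - V.toBlocks₂₁ᵀ) 0 D.1), by
        refine ⟨?_, fun j => ?_⟩
        · rw [hiff, LinearEquiv.apply_symm_apply]
          ext (i | i) (j | j)
          · simp [h11]
          · simp [toBlocks₁₂, toBlocks₂₁]
          · simp [toBlocks₁₂, toBlocks₂₁]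
          · have := congrFun₂ D.2 i j
            simpa [toBlocks₂₂] using this
        · rw [← hb, mulVec_eq_zero_iff_gramEquiv, LinearEquiv.apply_symm_apply]
          rintro (i | i) <;> simp⟩
      left_inv := fun M => by
        ext1
        apply (gramEquiv b).injective
        have h1 := (hiff _).1 M.2.1
        have h2 : ∀ j i, gramEquiv b M.1 i (Sum.inl j) = 0 := by
          intro j
          have := M.2.2 j
          rwa [← hb, mulVec_eq_zero_iff_gramEquiv] at this
        ext (i | i) (j | j)
        · simp [h2]
        · have := congrFun₂ h1 (Sum.inl i) (Sum.inr j)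
          simp [h2] at this
          simp [toBlocks₁₂, toBlocks₂₁, this]
        · simp [h2]
        · simp [toBlocks₂₂]
      right_inv := fun D => by ext; simp }

theorem natCard_mul_pow_rank {V W : Type*} [AddCommGroup V] [Module F V] [AddCommGroup W]
    [Module F W] [FiniteDimensional F V] (f : V →ₗ[F] W) :
    Nat.card {x // f x = 0} * Fintype.card F ^ Module.finrank F (LinearMap.range f) =
      Fintype.card F ^ Module.finrank F V := by
  have h : Nat.card {x // f x = 0} = Fintype.card F ^ Module.finrank F (LinearMap.ker f) := by
    rw [← Nat.card_eq_fintype_card, ← Module.natCard_eq_pow_finrank (K := F)]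
    rfl
  rw [h, ← pow_add, add_comm, LinearMap.finrank_range_add_finrank_ker]

theorem natCard_mulVec_eq_zero_transpose (A : Matrix (Fin k) (Fin n) F) :
    Fintype.card F ^ k * Nat.card {w // A *ᵥ w = 0} =
      Fintype.card F ^ n * Nat.card {a // Aᵀ *ᵥ a = 0} := by
  have h1 := natCard_mul_pow_rank A.mulVecLin
  have h2 := natCard_mul_pow_rank Aᵀ.mulVecLin
  have h3 : Module.finrank F (LinearMap.range Aᵀ.mulVecLin) =
    Module.finrank F (LinearMap.range A.mulVecLin) := rank_transpose A
  rw [h3] at h2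
  simp only [mulVecLin_apply, Module.finrank_fintype_fun_eq_card, Fintype.card_fin] at h1 h2
  have hq : 0 < Fintype.card F ^ Module.finrank F (LinearMap.range A.mulVecLin) :=
    pow_pos Fintype.card_pos _
  refine Nat.eq_of_mul_eq_mul_right hq ?_
  rw [mul_assoc, mul_assoc, h1, h2, mul_comm]

open Classical in
/-- The linearly independent `k`-tuples spanning a totally isotropic subspace for `C`. -/
noncomputable def isotropicFrames (C : Matrix (Fin n) (Fin n) F) (k : ℕ) :
    Finset (Fin k → Fin n → F) :=
  {v | LinearIndependent F v ∧ ∀ i j, v i ⬝ᵥ C *ᵥ v j = 0}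

theorem mem_isotropicFrames {C : Matrix (Fin n) (Fin n) F} {v : Fin k → Fin n → F} :
    v ∈ isotropicFrames C k ↔ LinearIndependent F v ∧ ∀ i j, v i ⬝ᵥ C *ᵥ v j = 0 := by
  simp [isotropicFrames]

theorem card_isotropicFrames_zero (C : Matrix (Fin n) (Fin n) F) :
    (isotropicFrames C 0).card = 1 := by
  rw [Finset.card_eq_one]
  exact ⟨0, by ext v; simp [mem_isotropicFrames, Subsingleton.elim v 0]⟩

open Classical in
theorem card_isotropicFrames_succ (U : Matrix (Fin n) (Fin n) F) (k : ℕ) :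
    (isotropicFrames (U - Uᵀ) (k + 1)).card = ∑ v ∈ isotropicFrames (U - Uᵀ) k,
      Finset.card {w : Fin n → F | w ∉ Submodule.span F (Set.range v) ∧
        ∀ i, v i ⬝ᵥ (U - Uᵀ) *ᵥ w = 0} := by
  rw [Finset.card_eq_sum_card_fiberwise (f := Fin.tail) (t := isotropicFrames (U - Uᵀ) k)]
  · refine Finset.sum_congr rfl fun v hv => ?_
    rw [mem_isotropicFrames] at hv
    refine Finset.card_bij' (fun x _ => x 0) (fun w _ => Fin.cons w v) ?_ ?_ ?_ ?_
    · intro x hx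
      simp only [Finset.mem_filter, mem_isotropicFrames, Finset.mem_univ, true_and] at hx ⊢
      obtain ⟨⟨h1, h2⟩, rfl⟩ := hx
      exact ⟨(linearIndependent_finSucc.1 h1).2, fun i => h2 i.succ 0⟩
    · intro w hw
      simp only [Finset.mem_filter, mem_isotropicFrames, Finset.mem_univ, true_and] at hw ⊢
      refine ⟨⟨linearIndependent_finCons.2 ⟨hv.1, hw.1⟩, fun i j => ?_⟩, Fin.tail_cons _ _⟩
      have hw' := hw.2
      simp only [dotProduct_sub_transpose_mulVec] at hw' ⊢
      have hv' := hv.2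
      simp only [dotProduct_sub_transpose_mulVec] at hv'
      refine Fin.cases (Fin.cases ?_ (fun j => ?_) j) (fun i => Fin.cases ?_ (fun j => ?_) j) i
      · simp
      · simp only [Fin.cons_zero, Fin.cons_succ]
        linear_combination -hw' j
      · simpa using hw' i
      · simpa using hv' i j
    · intro x hx
      simp only [Finset.mem_filter] at hx
      rw [← hx.2, Fin.cons_self_tail]
    · intro w _
      simp
  · intro x hx
    simp only [Finset.mem_coe, mem_isotropicFrames] at hx ⊢
    exact ⟨(linearIndependent_finSucc.1 hx.1).1, fun i j => hx.2 i.succ j.succ⟩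

open Classical in
theorem card_orthogonal_compl {C : Matrix (Fin n) (Fin n) F} {v : Fin k → Fin n → F}
    (hC : Cᵀ = -C) (hv : v ∈ isotropicFrames C k) :
    Fintype.card F ^ k * Finset.card {w : Fin n → F | w ∉ Submodule.span F (Set.range v) ∧
        ∀ i, v i ⬝ᵥ C *ᵥ w = 0} + Fintype.card F ^ (2 * k) =
      Fintype.card F ^ n * Finset.card {a : Fin k → F | C *ᵥ (∑ i, a i • v i) = 0} := by
  rw [mem_isotropicFrames] at hv
  have h1 := natCard_mulVec_eq_zero_transpose (of v * C)
  have hA : ∀ w, (of v * C) *ᵥ w = 0 ↔ ∀ i, v i ⬝ᵥ C *ᵥ w = 0 := by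
    intro w
    rw [← mulVec_mulVec, funext_iff]
    rfl
  have hA' : ∀ a, (of v * C)ᵀ *ᵥ a = 0 ↔ C *ᵥ (∑ i, a i • v i) = 0 := by
    intro a
    have : (of v)ᵀ *ᵥ a = ∑ i, a i • v i := by
      ext j
      simp [mulVec, dotProduct, mul_comm]
    rw [transpose_mul, ← mulVec_mulVec, hC, neg_mulVec, neg_eq_zero, this]
  simp only [hA, hA', Nat.card_eq_fintype_card, Fintype.card_subtype] at h1
  rw [← h1, two_mul, pow_add, ← mul_add]
  congr 1
  have hs : Finset.card {w : Fin n → F | w ∈ Submodule.span F (Set.range v)} =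
      Fintype.card F ^ k := by
    rw [← Fintype.card_subtype, ← Nat.card_eq_fintype_card, ← Nat.card_eq_fintype_card]
    have := Module.natCard_eq_pow_finrank (K := F) (V := Submodule.span F (Set.range v))
    rwa [finrank_span_eq_card hv.1, Fintype.card_fin] at this
  have hsub : ∀ w ∈ Submodule.span F (Set.range v), ∀ i, v i ⬝ᵥ C *ᵥ w = 0 := by
    intro w hw i
    induction hw using Submodule.span_induction with
    | mem x hx => obtain ⟨j, rfl⟩ := hx; exact hv.2 i j
    | zero => simp
    | add x y _ _ hx hy => rw [mulVec_add, dotProduct_add, hx, hy, add_zero]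
    | smul a x _ hx => rw [mulVec_smul, dotProduct_smul, hx, smul_zero]
  rw [← hs, ← Finset.card_union_of_disjoint]
  · congr 1
    ext w
    simp only [Finset.mem_union, Finset.mem_filter, Finset.mem_univ, true_and]
    constructor
    · rintro (h | h)
      · exact h.2
      · exact hsub w h
    · intro h
      by_cases hw : w ∈ Submodule.span F (Set.range v)
      · exact Or.inr hw
      · exact Or.inl ⟨hw, h⟩
  · rw [Finset.disjoint_filter]
    exact fun w _ h => h.1

open Classical in
theorem card_mulVec_sum_smul_eq_zero (C : Matrix (Fin n) (Fin n) F) {a : Fin k → F}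
    (ha : a ≠ 0) :
    Finset.card {v : Fin k → Fin n → F | C *ᵥ (∑ i, a i • v i) = 0} *
      Fintype.card F ^ C.rank = Fintype.card F ^ (n * k) := by
  let f : (Fin k → Fin n → F) →ₗ[F] (Fin n → F) := ∑ i, a i • LinearMap.proj i
  have hf : ∀ v, f v = ∑ i, a i • v i := fun v => by simp [f]
  have hsurj : LinearMap.range f = ⊤ := by
    rw [LinearMap.range_eq_top]
    obtain ⟨i, hi⟩ := Function.ne_iff.1 ha
    intro x
    refine ⟨Pi.single i ((a i)⁻¹ • x), ?_⟩
    rw [hf, Finset.sum_eq_single i]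
    · simp only [Pi.single_eq_same]
      exact smul_inv_smul₀ hi x
    · intro j _ hj
      simp [hj]
    · simp
  have h := natCard_mul_pow_rank (C.mulVecLin ∘ₗ f)
  rw [LinearMap.range_comp_of_range_eq_top _ hsurj] at h
  simp only [LinearMap.comp_apply, mulVecLin_apply, hf, Nat.card_eq_fintype_card,
    Fintype.card_subtype, Module.finrank_pi_fintype, Module.finrank_self] at h
  simpa [Matrix.rank, mul_comm k] using h

open Classical in
theorem sum_card_mulVec_sum_smul_eq_zero_le (C : Matrix (Fin n) (Fin n) F)
    (S : Finset (Fin k → Fin n → F)) :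
    ((∑ v ∈ S, Finset.card {a : Fin k → F | C *ᵥ (∑ i, a i • v i) = 0} : ℕ) : ℝ) ≤
      S.card + Fintype.card F ^ k * (Fintype.card F ^ (n * k) / Fintype.card F ^ C.rank) := by
  have hq : (0 : ℝ) < Fintype.card F := by exact_mod_cast Fintype.card_pos
  have hb : ∀ a ∈ (Finset.univ : Finset (Fin k → F)).erase 0,
      ((Finset.card {v ∈ S | C *ᵥ (∑ i, a i • v i) = 0} : ℕ) : ℝ) ≤
        Fintype.card F ^ (n * k) / Fintype.card F ^ C.rank := by
    intro a ha
    rw [le_div_iff₀ (by positivity)]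
    have h := card_mulVec_sum_smul_eq_zero C (Finset.ne_of_mem_erase ha)
    have h' : Finset.card {v ∈ S | C *ᵥ (∑ i, a i • v i) = 0} * Fintype.card F ^ C.rank ≤
        Fintype.card F ^ (n * k) := by
      rw [← h]
      gcongr
      exact Finset.subset_univ S
    exact_mod_cast h'
  have hswap : ∑ v ∈ S, Finset.card {a : Fin k → F | C *ᵥ (∑ i, a i • v i) = 0} =
      ∑ a : Fin k → F, Finset.card {v ∈ S | C *ᵥ (∑ i, a i • v i) = 0} := by
    simp only [Finset.card_filter]
    exact Finset.sum_comm
  rw [hswap, ← Finset.add_sum_erase _ _ (Finset.mem_univ 0), Nat.cast_add, Nat.cast_sum]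
  refine add_le_add ?_ ?_
  · exact_mod_cast Finset.card_filter_le _ _
  · refine (Finset.sum_le_card_nsmul _ _ _ hb).trans ?_
    rw [nsmul_eq_mul]
    gcongr
    have : ((Finset.univ : Finset (Fin k → F)).erase 0).card ≤ Fintype.card F ^ k := by
      refine (Finset.card_erase_le).trans ?_
      simp
    exact_mod_cast this

open Classical in
theorem card_le_sum_card_mulVec_sum_smul_eq_zero (C : Matrix (Fin n) (Fin n) F)
    (S : Finset (Fin k → Fin n → F)) :
    S.card ≤ ∑ v ∈ S, Finset.card {a : Fin k → F | C *ᵥ (∑ i, a i • v i) = 0} := by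
  rw [Finset.card_eq_sum_ones]
  refine Finset.sum_le_sum fun v _ => Finset.card_pos.2 ⟨0, by simp⟩

theorem abs_card_isotropicFrames_sub_le {C : Matrix (Fin n) (Fin n) F} (hC : Cᵀ = -C)
    {U : Matrix (Fin n) (Fin n) F} (hU : U - Uᵀ = C) {q : ℝ} (hq : (Fintype.card F : ℝ) = q)
    {k : ℕ} (hk : k ≤ n) :
    |((isotropicFrames C k).card : ℝ) - ∏ i ∈ Finset.range k, (q ^ n - q ^ i) / q ^ i| ≤
      2 * q ^ (n * k) * (1 / q ^ C.rank + q ^ k / q ^ n) := by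
  classical
  have hq2 : 2 ≤ q := by
    rw [← hq]
    exact_mod_cast Fintype.one_lt_card
  have hq0 : 0 < q := by linarith
  induction k with
  | zero =>
    rw [card_isotropicFrames_zero]
    simp
    positivity
  | succ k ih =>
    specialize ih (by omega)
    set S : ℕ := ∑ v ∈ isotropicFrames C k,
      Finset.card {a : Fin k → F | C *ᵥ (∑ i, a i • v i) = 0} with hS
    have hS1 : ((isotropicFrames C k).card : ℝ) ≤ S := by
      exact_mod_cast card_le_sum_card_mulVec_sum_smul_eq_zero C (isotropicFrames C k)
    have hS2 := sum_card_mulVec_sum_smul_eq_zero_le C (isotropicFrames C k)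
    rw [← hS, hq] at hS2
    have hrec : Fintype.card F ^ k * (isotropicFrames C (k + 1)).card +
        (isotropicFrames C k).card * Fintype.card F ^ (2 * k) = Fintype.card F ^ n * S := by
      have := card_isotropicFrames_succ U k
      rw [hU] at this
      rw [this, hS, Finset.mul_sum, Finset.mul_sum, ← smul_eq_mul, ← Finset.sum_const,
        ← Finset.sum_add_distrib]
      exact Finset.sum_congr rfl fun v hv => card_orthogonal_compl hC hv
    have hrec' : q ^ k * (isotropicFrames C (k + 1)).card +
        (isotropicFrames C k).card * q ^ (2 * k) = q ^ n * S := by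
      rw [← hq]
      exact_mod_cast hrec
    have hI : ((isotropicFrames C k).card : ℝ) ≤ q ^ (n * k) := by
      rw [← hq]
      have := Finset.card_le_univ (isotropicFrames C k)
      simp only [Fintype.card_fun, Fintype.card_fin, ← pow_mul] at this
      exact_mod_cast this
    have hI0 : (0 : ℝ) ≤ (isotropicFrames C k).card := by positivity
    rw [Finset.prod_range_succ]
    set P := ∏ i ∈ Finset.range k, (q ^ n - q ^ i) / q ^ i with hP
    generalize ((isotropicFrames C (k + 1)).card : ℝ) = J at *
    have hJ : J = (q ^ n * S - (isotropicFrames C k).card * q ^ (2 * k)) / q ^ k := by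
      rw [eq_div_iff (by positivity)]
      linarith
    have hk0 : k = 0 → ((isotropicFrames C k).card : ℝ) - P = 0 := by
      rintro rfl
      rw [card_isotropicFrames_zero, hP]
      simp
    generalize ((isotropicFrames C k).card : ℝ) = I at *
    generalize (S : ℝ) = T at *
    set R := q ^ C.rank with hR
    have hR0 : 0 < R := by positivity
    have hQk : 1 ≤ q ^ k := one_le_pow₀ (by linarith)
    have hQkn : q ^ k ≤ q ^ n := pow_le_pow_right₀ (by linarith) (by omega)
    have hnk : q ^ (n * (k + 1)) = q ^ n * q ^ (n * k) := by ring
    have h2k : q ^ (2 * k) = q ^ k * q ^ k := by ring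
    have hk1 : q ^ (k + 1) = q ^ k * q := by ring
    have hdec : J - P * ((q ^ n - q ^ k) / q ^ k) =
        (I - P) * ((q ^ n - q ^ k) / q ^ k) + (q ^ n * (T - I) / q ^ k - I * (q ^ k - 1)) := by
      rw [hJ, h2k]
      field_simp
      ring
    have hA : |(I - P) * ((q ^ n - q ^ k) / q ^ k)| ≤
        q ^ n * q ^ (n * k) * (1 / R + q ^ k / q ^ n) := by
      rcases Nat.eq_zero_or_pos k with h0 | h0
      · rw [hk0 h0, zero_mul, abs_zero]
        positivity
      · have h2 : 2 ≤ q ^ k := hq2.trans (le_self_pow₀ (by linarith) h0.ne')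
        have : (q ^ n - q ^ k) / q ^ k ≤ q ^ n / 2 := by
          rw [div_le_div_iff₀ (by positivity) (by positivity)]
          nlinarith [pow_pos hq0 n, pow_pos hq0 k]
        have h3 : 0 ≤ (q ^ n - q ^ k) / q ^ k := div_nonneg (by linarith) (by linarith)
        rw [abs_mul, abs_of_nonneg h3]
        calc _ ≤ (2 * q ^ (n * k) * (1 / R + q ^ k / q ^ n)) * (q ^ n / 2) := by gcongr
          _ = _ := by ring
    have hB : |q ^ n * (T - I) / q ^ k - I * (q ^ k - 1)| ≤
        q ^ n * q ^ (n * k) * (1 / R + q ^ k / q ^ n) := by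
      have h1 : q ^ n * (T - I) / q ^ k ≤ q ^ n * q ^ (n * k) * (1 / R) := by
        rw [div_le_iff₀ (by positivity)]
        calc _ ≤ q ^ n * (q ^ k * (q ^ (n * k) / R)) := by gcongr; linarith
          _ = _ := by ring
      have h2 : I * (q ^ k - 1) ≤ q ^ n * q ^ (n * k) * (q ^ k / q ^ n) := by
        calc _ ≤ q ^ (n * k) * q ^ k := by gcongr; linarith
          _ = _ := by field_simp
      have h3 : 0 ≤ q ^ n * (T - I) / q ^ k :=
        div_nonneg (mul_nonneg (by positivity) (by linarith)) (by linarith)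
      have h4 : 0 ≤ I * (q ^ k - 1) := mul_nonneg hI0 (by linarith)
      have h5 : 0 ≤ q ^ n * q ^ (n * k) * (1 / R) := by positivity
      have h6 : 0 ≤ q ^ n * q ^ (n * k) * (q ^ k / q ^ n) := by positivity
      rw [mul_add, abs_le]
      constructor <;> linarith
    rw [hdec, hnk]
    refine (abs_add_le _ _).trans ((add_le_add hA hB).trans ?_)
    have : q ^ k / q ^ n ≤ q ^ (k + 1) / q ^ n := by
      gcongr
      · linarith
      · omega
    calc _ = 2 * (q ^ n * q ^ (n * k)) * (1 / R + q ^ k / q ^ n) := by ring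
      _ ≤ _ := by gcongr

open Classical in
theorem card_linearIndependent_mulVec_eq_zero (M : Matrix (Fin n) (Fin n) F) (k : ℕ) :
    ((Finset.card {v : Fin k → Fin n → F | LinearIndependent F v ∧ ∀ j, M *ᵥ v j = 0} : ℕ) : ℝ) =
      ∏ i ∈ Finset.range k, ((Fintype.card F : ℝ) ^ Module.finrank F (LinearMap.ker M.mulVecLin) -
        (Fintype.card F : ℝ) ^ i) := by
  let e : {v : Fin k → Fin n → F // LinearIndependent F v ∧ ∀ j, M *ᵥ v j = 0} ≃
      {s : Fin k → LinearMap.ker M.mulVecLin // LinearIndependent F s} :=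
    { toFun := fun v => ⟨fun j => ⟨v.1 j, by simpa using v.2.2 j⟩,
        LinearIndependent.of_comp (LinearMap.ker M.mulVecLin).subtype v.2.1⟩
      invFun := fun s => ⟨fun j => s.1 j,
        s.2.map' (LinearMap.ker M.mulVecLin).subtype (Submodule.ker_subtype _),
        fun j => LinearMap.mem_ker.1 (s.1 j).2⟩
      left_inv := fun v => rfl
      right_inv := fun s => rfl }
  rw [← Fintype.card_subtype, ← Nat.card_eq_fintype_card, Nat.card_congr e]
  rcases le_or_gt k (Module.finrank F (LinearMap.ker M.mulVecLin)) with h | h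
  · rw [card_linearIndependent h, Nat.cast_prod, ← Fin.prod_univ_eq_prod_range
      (fun i => (Fintype.card F : ℝ) ^ Module.finrank F (LinearMap.ker M.mulVecLin) -
        (Fintype.card F : ℝ) ^ i)]
    refine Finset.prod_congr rfl fun i _ => ?_
    rw [Nat.cast_sub (Nat.pow_le_pow_right Fintype.card_pos (i.2.le.trans h))]
    push_cast
    rfl
  · rw [Finset.prod_eq_zero (Finset.mem_range.2 h) (sub_self _)]
    have : IsEmpty {s : Fin k → LinearMap.ker M.mulVecLin // LinearIndependent F s} :=
      ⟨fun s => h.not_ge (by simpa using s.2.fintype_card_le_finrank)⟩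
    simp

open Classical in
theorem card_finrank_ker_eq_sum (S : Finset (Matrix (Fin n) (Fin n) F)) {r : ℕ} (hr : r ≤ n)
    {q : ℝ} (hq : (Fintype.card F : ℝ) = q) :
    ((Finset.card {M ∈ S | Module.finrank F (LinearMap.ker M.mulVecLin) = r} : ℕ) : ℝ) =
      ∑ k ∈ Finset.Icc r n, (∏ i ∈ (Finset.range (k + 1)).erase r, (q ^ r - q ^ i))⁻¹ *
        ∑ v : Fin k → Fin n → F with LinearIndependent F v,
          ((Finset.card {M ∈ S | ∀ j, M *ᵥ v j = 0} : ℕ) : ℝ) := by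
  have hx : Function.Injective (fun i : ℕ => q ^ i) := by
    refine pow_right_injective₀ ?_ ?_ <;> rw [← hq]
    · exact_mod_cast Fintype.card_pos
    · exact_mod_cast Fintype.one_lt_card.ne'
  have hswap : ∀ k, ∑ v : Fin k → Fin n → F with LinearIndependent F v,
        ((Finset.card {M ∈ S | ∀ j, M *ᵥ v j = 0} : ℕ) : ℝ) =
      ∑ M ∈ S, ∏ i ∈ Finset.range k,
        (q ^ Module.finrank F (LinearMap.ker M.mulVecLin) - q ^ i) := by
    intro k
    rw [← hq]
    simp_rw [← card_linearIndependent_mulVec_eq_zero]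
    have := Finset.sum_card_bipartiteAbove_eq_sum_card_bipartiteBelow
      (s := {v : Fin k → Fin n → F | LinearIndependent F v}) (t := S)
      (fun v M => ∀ j, M *ᵥ v j = 0)
    simp only [Finset.bipartiteAbove, Finset.bipartiteBelow, Finset.filter_filter] at this
    exact_mod_cast this
  simp_rw [hswap, Finset.mul_sum]
  rw [Finset.sum_comm, Finset.card_filter]
  push_cast
  refine Finset.sum_congr rfl fun M _ => ?_
  have hd : Module.finrank F (LinearMap.ker M.mulVecLin) ≤ n := by
    simpa using (LinearMap.ker M.mulVecLin).finrank_le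
  rw [← sum_newton_basis_eq_ite hx hr hd]

theorem choose_two_add_mul {n k : ℕ} (hk : k ≤ n) :
    (n - k + 1).choose 2 + n * k = n * (n + 1) / 2 + k.choose 2 := by
  obtain ⟨m, rfl⟩ := Nat.exists_eq_add_of_le hk
  have h : (k + m) * (k + m + 1) / 2 = (k + m + 1).choose 2 := by
    rw [Nat.choose_two_right, Nat.add_sub_cancel, mul_comm]
  rw [Nat.add_sub_cancel_left, h]
  have : (((m + 1).choose 2 + (k + m) * k : ℕ) : ℚ) =
      ((k + m + 1).choose 2 + k.choose 2 : ℕ) := by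
    push_cast [Nat.cast_choose_two]
    ring
  exact_mod_cast this

open Classical in
theorem sum_card_sub_transpose_eq (U : Matrix (Fin n) (Fin n) F) (k : ℕ) :
    ∑ v : Fin k → Fin n → F with LinearIndependent F v,
        Finset.card {M ∈ ({M | M - Mᵀ = U - Uᵀ} : Finset (Matrix (Fin n) (Fin n) F)) |
          ∀ j, M *ᵥ v j = 0} =
      (isotropicFrames (U - Uᵀ) k).card * Fintype.card F ^ (n - k + 1).choose 2 := by
  have hsub : isotropicFrames (U - Uᵀ) k ⊆
      ({v | LinearIndependent F v} : Finset (Fin k → Fin n → F)) := fun v hv => by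
    simpa using (mem_isotropicFrames.1 hv).1
  rw [← Finset.sum_subset hsub, ← smul_eq_mul, ← Finset.sum_const]
  · refine Finset.sum_congr rfl fun v hv => ?_
    rw [mem_isotropicFrames] at hv
    rw [← natCard_sub_transpose_mulVec_eq_zero hv.1 U hv.2, Finset.filter_filter,
      Nat.card_eq_fintype_card, Fintype.card_subtype]
  · intro v hv hv'
    simp only [Finset.mem_filter, Finset.mem_univ, true_and] at hv
    rw [Finset.card_eq_zero, Finset.filter_filter, Finset.filter_eq_empty_iff]
    rintro M - ⟨hM, h0⟩
    exact hv' (mem_isotropicFrames.2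
      ⟨hv, fun i j => dotProduct_eq_zero_of_mulVec_eq_zero hM (h0 i) (h0 j)⟩)

open Classical in
theorem sum_card_mulVec_eq_zero {q : ℝ} (hq : (Fintype.card F : ℝ) = q) (k : ℕ) :
    ∑ v : Fin k → Fin n → F with LinearIndependent F v,
        ((Finset.card {M : Matrix (Fin n) (Fin n) F | ∀ j, M *ᵥ v j = 0} : ℕ) : ℝ) =
      (∏ i ∈ Finset.range k, (q ^ n - q ^ i)) * q ^ (n * (n - k)) := by
  have h0 : Finset.card {v : Fin k → Fin n → F | LinearIndependent F v} =
      ∏ i ∈ Finset.range k, (q ^ n - q ^ i) := by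
    have := card_linearIndependent_mulVec_eq_zero (0 : Matrix (Fin n) (Fin n) F) k
    have hker : Module.finrank F
        (LinearMap.ker (0 : Matrix (Fin n) (Fin n) F).mulVecLin) = n := by
      rw [Matrix.mulVecLin_zero, LinearMap.ker_zero, finrank_top, Module.finrank_fin_fun]
    rw [hker] at this
    simpa [hq] using this
  rw [← h0, ← nsmul_eq_mul, ← Finset.sum_const]
  refine Finset.sum_congr rfl fun v hv => ?_
  simp only [Finset.mem_filter, Finset.mem_univ, true_and] at hv
  rw [← Fintype.card_subtype, ← Nat.card_eq_fintype_card, natCard_mulVec_eq_zero hv, ← hq]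
  push_cast
  rfl

open Classical in
theorem abs_moment_sub_le {C : Matrix (Fin n) (Fin n) F} (hC : Cᵀ = -C)
    {U : Matrix (Fin n) (Fin n) F} (hU : U - Uᵀ = C) {q : ℝ} (hq : (Fintype.card F : ℝ) = q)
    {k : ℕ} (hk : k ≤ n) :
    |(∑ v : Fin k → Fin n → F with LinearIndependent F v,
        ((Finset.card {M ∈ ({M | M - Mᵀ = C} : Finset (Matrix (Fin n) (Fin n) F)) |
          ∀ j, M *ᵥ v j = 0} : ℕ) : ℝ)) / q ^ (n * (n + 1) / 2) -
      (∑ v : Fin k → Fin n → F with LinearIndependent F v,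
        ((Finset.card {M : Matrix (Fin n) (Fin n) F | ∀ j, M *ᵥ v j = 0} : ℕ) : ℝ)) /
          q ^ (n ^ 2)| ≤
      q ^ k.choose 2 * (2 * (1 / q ^ C.rank + q ^ k / q ^ n)) := by
  have hq0 : 0 < q := by
    rw [← hq]
    exact_mod_cast Fintype.card_pos
  have h1 := sum_card_sub_transpose_eq U k
  rw [hU] at h1
  rw [sum_card_mulVec_eq_zero hq k, ← Nat.cast_sum, h1]
  have hb := abs_card_isotropicFrames_sub_le hC hU hq hk
  push_cast
  rw [hq]
  have hprod : ∏ i ∈ Finset.range k, (q ^ n - q ^ i) =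
      (∏ i ∈ Finset.range k, (q ^ n - q ^ i) / q ^ i) * q ^ k.choose 2 := by
    rw [Finset.prod_div_distrib, Finset.prod_pow_eq_pow_sum, Finset.sum_range_id,
      ← Nat.choose_two_right, div_mul_cancel₀ _ (by positivity)]
  rw [hprod]
  set P := ∏ i ∈ Finset.range k, (q ^ n - q ^ i) / q ^ i
  have h2 : q ^ (n - k + 1).choose 2 / q ^ (n * (n + 1) / 2) = q ^ k.choose 2 / q ^ (n * k) := by
    rw [div_eq_div_iff (by positivity) (by positivity), ← pow_add, ← pow_add,
      choose_two_add_mul hk, add_comm]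
  have h3 : q ^ (n * (n - k)) / q ^ (n ^ 2) = 1 / q ^ (n * k) := by
    rw [div_eq_div_iff (by positivity) (by positivity), ← pow_add, one_mul, ← mul_add,
      Nat.sub_add_cancel hk, sq]
  rw [mul_div_assoc, mul_div_assoc, h2, h3]
  calc _ = |((isotropicFrames C k).card - P) * (q ^ k.choose 2 / q ^ (n * k))| := by
        congr 1; ring
    _ = |(isotropicFrames C k).card - P| * (q ^ k.choose 2 / q ^ (n * k)) := by
        rw [abs_mul, abs_of_nonneg (a := q ^ k.choose 2 / q ^ (n * k)) (by positivity)]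
    _ ≤ (2 * q ^ (n * k) * (1 / q ^ C.rank + q ^ k / q ^ n)) *
          (q ^ k.choose 2 / q ^ (n * k)) := by gcongr
    _ = _ := by field_simp

open Classical in
theorem abs_card_finrank_ker_div_sub_le {C : Matrix (Fin n) (Fin n) F} (hC : Cᵀ = -C)
    {U : Matrix (Fin n) (Fin n) F} (hU : U - Uᵀ = C) {q : ℝ} (hq : (Fintype.card F : ℝ) = q)
    {r : ℕ} (hr : r ≤ n) {K : ℝ} (hK : ∀ k, r ≤ k →
      |(∏ i ∈ (Finset.range (k + 1)).erase r, (q ^ r - q ^ i))⁻¹| * q ^ ((k + 1).choose 2) ≤ K) :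
    |((Finset.card {M ∈ ({M | M - Mᵀ = C} : Finset (Matrix (Fin n) (Fin n) F)) |
        Module.finrank F (LinearMap.ker M.mulVecLin) = r} : ℕ) : ℝ) / q ^ (n * (n + 1) / 2) -
      ((Finset.card {M : Matrix (Fin n) (Fin n) F |
        Module.finrank F (LinearMap.ker M.mulVecLin) = r} : ℕ) : ℝ) / q ^ (n ^ 2)| ≤
      (n + 1) * (4 * K / q ^ C.rank) := by
  have hq1 : 1 ≤ q := by
    rw [← hq]
    exact_mod_cast Fintype.card_pos
  have hq0 : 0 < q := by linarith
  have hK0 : 0 ≤ K := le_trans (by positivity) (hK r le_rfl)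
  rw [card_finrank_ker_eq_sum _ hr hq, card_finrank_ker_eq_sum _ hr hq, Finset.sum_div,
    Finset.sum_div, ← Finset.sum_sub_distrib]
  refine (Finset.abs_sum_le_sum_abs _ _).trans ?_
  have hcard : ((Finset.Icc r n).card : ℝ) ≤ n + 1 := by
    have : (Finset.Icc r n).card ≤ n + 1 := by simp
    exact_mod_cast this
  refine (Finset.sum_le_card_nsmul _ _ (4 * K / q ^ C.rank) fun k hk => ?_).trans ?_
  · obtain ⟨hrk, hkn⟩ := Finset.mem_Icc.1 hk
    have hm := abs_moment_sub_le hC hU hq hkn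
    rw [mul_div_assoc, mul_div_assoc, ← mul_sub, abs_mul]
    have hck : (k + 1).choose 2 = k + k.choose 2 := by
      rw [Nat.choose_succ_succ' k 1, Nat.choose_one_right]
    have hR : C.rank ≤ n := C.rank_le_height
    have hrn : q ^ C.rank ≤ q ^ n := pow_le_pow_right₀ hq1 hR
    have h1k : 1 ≤ q ^ k := one_le_pow₀ hq1
    refine (mul_le_mul_of_nonneg_left hm (abs_nonneg _)).trans ?_
    have hKk := hK k hrk
    rw [hck, pow_add] at hKk
    set A := |(∏ i ∈ (Finset.range (k + 1)).erase r, (q ^ r - q ^ i))⁻¹|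
    have hs : 1 / q ^ C.rank + q ^ k / q ^ n ≤ q ^ k * (2 / q ^ C.rank) := by
      have e1 : 1 / q ^ C.rank ≤ q ^ k / q ^ C.rank := by gcongr
      have e2 : q ^ k / q ^ n ≤ q ^ k / q ^ C.rank := by gcongr
      calc _ ≤ q ^ k / q ^ C.rank + q ^ k / q ^ C.rank := add_le_add e1 e2
        _ = _ := by ring
    calc _ ≤ A * (q ^ k.choose 2 * (2 * (q ^ k * (2 / q ^ C.rank)))) := by gcongr
      _ = (A * (q ^ k * q ^ k.choose 2)) * (4 / q ^ C.rank) := by ring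
      _ ≤ K * (4 / q ^ C.rank) := by gcongr
      _ = _ := by ring
  · rw [nsmul_eq_mul]
    gcongr

end counting

/-- **Corank distribution of random `C`-symmetric matrices vs. uniform matrices.**
For every finite field `F_ℓ` and integer `r ≥ 0` there is a constant `K` such that for every
`n ≥ 1` and every `n×n` alternating matrix `C` of rank `c`, the probability that a uniformly
random `C`-symmetric matrix has `r`-dimensional kernel differs from
`p_r(n) = #{A : dim ker A = r}/ℓ^{n²}` by at most `K·n·ℓ^{-c}`. -/
theorem cSymmetric_corank_vs_uniform (F : Type) [Field F] [Fintype F]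
    (ℓ r : ℕ) (hℓ : Fintype.card F = ℓ) :
    ∃ K : ℝ, ∀ n : ℕ, 1 ≤ n → ∀ c : ℕ, ∀ C : Matrix (Fin n) (Fin n) F,
      Cᵀ = -C → (∀ i, C i i = 0) → C.rank = c →
      |(Nat.card {M : Matrix (Fin n) (Fin n) F //
            M - Mᵀ = C ∧ Module.finrank F (LinearMap.ker M.mulVecLin) = r} : ℝ) /
          (ℓ : ℝ) ^ (n * (n + 1) / 2) -
        (Nat.card {A : Matrix (Fin n) (Fin n) F //
            Module.finrank F (LinearMap.ker A.mulVecLin) = r} : ℝ) / (ℓ : ℝ) ^ (n ^ 2)|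
      ≤ K * n * (ℓ : ℝ) ^ (-(c : ℤ)) := by
  classical
  have hℓ2 : (2 : ℝ) ≤ ℓ := by
    rw [← hℓ]
    exact_mod_cast Fintype.one_lt_card
  obtain ⟨K, hK⟩ := exists_newton_coeff_bound hℓ2 r
  have hK0 : 0 ≤ K := le_trans (by positivity) (hK r le_rfl)
  refine ⟨8 * K, ?_⟩
  rintro n hn c C hC hC0 rfl
  simp only [Nat.card_eq_fintype_card, Fintype.card_subtype]
  rcases le_or_gt r n with hr | hr
  · obtain ⟨U, hU⟩ := exists_sub_transpose_eq hC hC0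
    have h := abs_card_finrank_ker_div_sub_le hC hU (q := ℓ) (by rw [hℓ]) hr hK
    rw [Finset.filter_filter] at h
    refine h.trans ?_
    have hn' : (1 : ℝ) ≤ n := by exact_mod_cast hn
    calc ((n : ℝ) + 1) * (4 * K / (ℓ : ℝ) ^ C.rank)
        ≤ (n + n) * (4 * K / (ℓ : ℝ) ^ C.rank) := by gcongr
      _ = _ := by rw [_root_.zpow_neg, _root_.zpow_natCast]; ring
  · have hne : ∀ M : Matrix (Fin n) (Fin n) F,
        Module.finrank F (LinearMap.ker M.mulVecLin) ≠ r := fun M =>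
      (lt_of_le_of_lt (by simpa using (LinearMap.ker M.mulVecLin).finrank_le) hr).ne
    simp only [hne, and_false, Finset.filter_false, Finset.card_empty, Nat.cast_zero, zero_div,
      sub_zero, abs_zero]
    positivity
end

section
/- For every prime power ℓ and integer r ≥ 0 there is a constant K = K(ℓ, r) such that for every n ≥ 1 and every n×n alternating matrix C over F_ℓ of rank c, a uniformly random C-symmetric matrix M satisfies |P[dim ker M = r] − μ_{CL,ℓ}(r)| ≤ K · n · ℓ^{−c}, where μ_{CL,ℓ}(r) := (1/#GL_r(F_ℓ)) · ∏_{i=r+1}^∞ (1 − ℓ^{−i}). -/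
open Matrix

/-- The Cohen–Lenstra corank measure
`μ_{CL,ℓ}(r) = (1/#GL_r(F_ℓ)) · ∏_{i=r+1}^∞ (1 - ℓ^{-i})`, the limiting corank distribution
of large uniformly random square matrices over a field with `ℓ` elements. -/
noncomputable def muCL (F : Type) [Field F] [Fintype F] (r : ℕ) : ℝ :=
  (Nat.card (GL (Fin r) F) : ℝ)⁻¹ *
    ∏' i : ℕ, (1 - ((Fintype.card F : ℝ) ^ (r + 1 + i))⁻¹)

namespace CSymmetric

variable {F : Type} [Field F]

/-- Any matrix with `Cᵀ = -C` and zero diagonal has the form `A - Aᵀ`. -/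
theorem exists_eq_sub_transpose {n : ℕ} {C : Matrix (Fin n) (Fin n) F}
    (hC : Cᵀ = -C) (hd : ∀ i, C i i = 0) : ∃ A : Matrix (Fin n) (Fin n) F, C = A - Aᵀ := by
  refine ⟨Matrix.of fun i j => if i < j then C i j else 0, ?_⟩
  ext i j
  have h : C j i = -C i j := congrFun (congrFun hC i) j
  rcases lt_trichotomy i j with hij | rfl | hij
  · simp [hij, hij.not_gt]
  · simp [hd]
  · simp [hij, hij.not_gt, h]

/-- The symmetric matrices are in bijection with functions on unordered pairs. -/
theorem card_cSymmetric [Fintype F] {κ : Type*} [Fintype κ] (A : Matrix κ κ F) :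
    Nat.card {D : Matrix κ κ F // D - Dᵀ = A - Aᵀ} =
      Fintype.card F ^ (Fintype.card κ + 1).choose 2 := by
  classical
  have e : {D : Matrix κ κ F // D - Dᵀ = A - Aᵀ} ≃
      {f : κ → κ → F // ∀ a₁ a₂, f a₁ a₂ = f a₂ a₁} :=
    { toFun := fun D => ⟨fun i j => D.1 i j - A i j, fun i j => by
        have h := congrFun (congrFun D.2 i) j
        simp only [Matrix.sub_apply, Matrix.transpose_apply] at h
        linear_combination h⟩
      invFun := fun f => ⟨A + Matrix.of f.1, by
        ext i j
        simp [f.2 i j]⟩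
      left_inv := fun D => by ext i j; simp
      right_inv := fun f => by ext i j; simp }
  rw [Nat.card_congr (e.trans Sym2.lift), Nat.card_eq_fintype_card, Fintype.card_fun, Sym2.card]

/-- A matrix `M` with `M - Mᵀ = A - Aᵀ` in block form whose first block of columns vanishes is
determined by its lower right block. -/
theorem card_cSymmetric_blocks [Fintype F] {ι κ : Type*} [Fintype κ]
    (A : Matrix (ι ⊕ κ) (ι ⊕ κ) F) (hA : (A - Aᵀ).toBlocks₁₁ = 0) :
    Nat.card {M : Matrix (ι ⊕ κ) (ι ⊕ κ) F // M - Mᵀ = A - Aᵀ ∧ ∀ a i, M a (Sum.inl i) = 0} =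
      Fintype.card F ^ (Fintype.card κ + 1).choose 2 := by
  rw [← card_cSymmetric A.toBlocks₂₂]
  refine Nat.card_congr
    { toFun := fun M => ⟨M.1.toBlocks₂₂, ?_⟩
      invFun := fun D => ⟨Matrix.fromBlocks 0 (A - Aᵀ).toBlocks₁₂ 0 D.1, ?_, ?_⟩
      left_inv := ?_
      right_inv := ?_ }
  · ext i j
    exact congrFun (congrFun M.2.1 (Sum.inr i)) (Sum.inr j)
  · ext (i | i) (j | j)
    · simpa [Matrix.toBlocks₁₁] using (congrFun (congrFun hA i) j).symm
    · simp [Matrix.toBlocks₁₂]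
    · simp [Matrix.toBlocks₁₂]
    · exact congrFun (congrFun D.2 i) j
  · rintro (a | a) i <;> simp
  · rintro ⟨M, h1, h2⟩
    ext (i | i) (j | j)
    · simp [h2]
    · have h := congrFun (congrFun h1 (Sum.inl i)) (Sum.inr j)
      simp only [Matrix.sub_apply, Matrix.transpose_apply, h2, sub_zero] at h
      simp [h, Matrix.toBlocks₁₂]
    · simp [h2]
    · simp [Matrix.toBlocks₂₂]
  · intro D
    simp

/-- A linearly independent family of vectors is part of a basis, which is recorded here as an
invertible matrix. -/
theorem exists_invertible_extension {n D : ℕ} {X : Fin D → Fin n → F}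
    (hX : LinearIndependent F X) :
    ∃ (κ : Type) (_ : Fintype κ) (_ : DecidableEq κ)
      (P : Matrix (Fin n) (Fin D ⊕ κ) F) (Q : Matrix (Fin D ⊕ κ) (Fin n) F),
      P * Q = 1 ∧ Q * P = 1 ∧ (∀ a i, P a (Sum.inl i) = X i a) ∧
        D + Fintype.card κ = n := by
  classical
  let b := Module.Basis.sumExtend hX
  have hfin : Finite (Fin D ⊕ ↥(Module.Basis.sumExtendIndex hX)) :=
    Module.Finite.finite_basis b
  have : Finite ↥(Module.Basis.sumExtendIndex hX) :=
    Finite.of_injective (Sum.inr (α := Fin D)) Sum.inr_injective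
  let _ : Fintype ↥(Module.Basis.sumExtendIndex hX) := Fintype.ofFinite _
  refine ⟨↥(Module.Basis.sumExtendIndex hX), inferInstance, inferInstance,
    (Pi.basisFun F (Fin n)).toMatrix b, b.toMatrix (Pi.basisFun F (Fin n)),
    Module.Basis.toMatrix_mul_toMatrix_flip _ _, Module.Basis.toMatrix_mul_toMatrix_flip _ _,
    ?_, ?_⟩
  · intro a i
    have hb : b (Sum.inl i) = X i := by
      simp only [b, Module.Basis.sumExtend, Module.Basis.reindex_apply,
        Module.Basis.extend_apply_self]
      rfl
    simp [Module.Basis.toMatrix_apply, hb]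
  · have := Module.finrank_eq_card_basis b
    simpa using this.symm

theorem two_mul_choose_succ_two (m : ℕ) : 2 * ((m + 1).choose 2 : ℤ) = (m + 1) * m := by
  induction m with
  | zero => simp
  | succ m ih =>
    rw [Nat.choose_succ_succ' (m + 1) 1, Nat.choose_one_right]
    push_cast
    linarith

/-- The number of `C`-symmetric matrices that kill a given independent isotropic family. -/
theorem card_cSymmetric_vanishing [Fintype F] {n D : ℕ} (A : Matrix (Fin n) (Fin n) F)
    {X : Fin D → Fin n → F} (hX : LinearIndependent F X)
    (hiso : ∀ i j, X i ⬝ᵥ (A - Aᵀ) *ᵥ X j = 0) :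
    Nat.card {M : Matrix (Fin n) (Fin n) F // M - Mᵀ = A - Aᵀ ∧ ∀ i, M *ᵥ X i = 0} *
        Fintype.card F ^ (n * D) =
      Fintype.card F ^ ((n + 1).choose 2 + D.choose 2) := by
  obtain ⟨κ, _, _, P, Q, hPQ, hQP, hP, hcard⟩ := exists_invertible_extension hX
  have hPt : Qᵀ * Pᵀ = 1 := by rw [← Matrix.transpose_mul, hPQ, Matrix.transpose_one]
  have hQt : Pᵀ * Qᵀ = 1 := by rw [← Matrix.transpose_mul, hQP, Matrix.transpose_one]
  have hcol (M : Matrix (Fin n) (Fin n) F) (a : Fin D ⊕ κ) (i : Fin D) :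
      (Pᵀ * M * P) a (Sum.inl i) = (Pᵀ *ᵥ (M *ᵥ X i)) a := by
    have : (fun k => P k (Sum.inl i)) = X i := funext fun k => hP k i
    rw [Matrix.mulVec_mulVec, ← this]
    rfl
  have hsub (M : Matrix (Fin n) (Fin n) F) :
      Pᵀ * M * P - (Pᵀ * M * P)ᵀ = Pᵀ * (M - Mᵀ) * P := by
    simp [Matrix.transpose_mul, Matrix.mul_sub, Matrix.sub_mul, Matrix.mul_assoc]
  have hPM (M : Matrix (Fin n) (Fin n) F) : Qᵀ * (Pᵀ * M * P) * Q = M := by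
    calc _ = (Qᵀ * Pᵀ) * M * (P * Q) := by simp only [Matrix.mul_assoc]
      _ = M := by rw [hPt, hPQ, Matrix.one_mul, Matrix.mul_one]
  have hQM (M : Matrix (Fin D ⊕ κ) (Fin D ⊕ κ) F) : Pᵀ * (Qᵀ * M * Q) * P = M := by
    calc _ = (Pᵀ * Qᵀ) * M * (Q * P) := by simp only [Matrix.mul_assoc]
      _ = M := by rw [hQt, hQP, Matrix.one_mul, Matrix.mul_one]
  let A' := Pᵀ * A * P
  have hA' : (A' - A'ᵀ).toBlocks₁₁ = 0 := by
    ext i j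
    rw [Matrix.toBlocks₁₁, Matrix.of_apply, hsub, hcol, Matrix.zero_apply, ← hiso i j]
    simp only [Matrix.mulVec, dotProduct, Matrix.transpose_apply, hP]
  have key := card_cSymmetric_blocks A' hA'
  have e : {M : Matrix (Fin n) (Fin n) F // M - Mᵀ = A - Aᵀ ∧ ∀ i, M *ᵥ X i = 0} ≃
      {M : Matrix (Fin D ⊕ κ) (Fin D ⊕ κ) F //
        M - Mᵀ = A' - A'ᵀ ∧ ∀ a i, M a (Sum.inl i) = 0} := by
    refine Equiv.subtypeEquiv ⟨fun M => Pᵀ * M * P, fun M => Qᵀ * M * Q, hPM, hQM⟩ fun M => ?_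
    refine and_congr ?_ ?_
    · change _ ↔ Pᵀ * M * P - (Pᵀ * M * P)ᵀ = A' - A'ᵀ
      rw [hsub, hsub]
      refine ⟨fun h => by rw [h], fun h => ?_⟩
      rw [← hPM (M - Mᵀ), h, hPM]
    · change _ ↔ ∀ a i, (Pᵀ * M * P) a (Sum.inl i) = 0
      simp only [hcol]
      refine ⟨fun h a i => by simp [h i], fun h i => ?_⟩
      have h0 : Pᵀ *ᵥ (M *ᵥ X i) = 0 := funext fun a => h a i
      rw [← Matrix.one_mulVec (M *ᵥ X i), ← hPt, ← Matrix.mulVec_mulVec, h0, Matrix.mulVec_zero]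
  rw [Nat.card_congr e, key, ← pow_add]
  congr 1
  subst hcard
  generalize Fintype.card κ = k
  have hD : 2 * (D.choose 2 : ℤ) = D * (D - 1) := by
    cases D with
    | zero => simp
    | succ D => rw [two_mul_choose_succ_two]; push_cast; ring
  have h1 := two_mul_choose_succ_two (D + k)
  have h2 := two_mul_choose_succ_two k
  zify
  push_cast at h1 ⊢
  linarith

/-- A linearly independent family spanning an isotropic subspace for the form `xᵀ C y`. -/
def IsIsotropicFrame {n D : ℕ} (C : Matrix (Fin n) (Fin n) F) (X : Fin D → Fin n → F) : Prop :=
  LinearIndependent F X ∧ ∀ i j, X i ⬝ᵥ C *ᵥ X j = 0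

/-- The number of isotropic frames of length `D`. -/
noncomputable def numFrames {n : ℕ} (C : Matrix (Fin n) (Fin n) F) (D : ℕ) : ℕ :=
  Nat.card {X : Fin D → Fin n → F // IsIsotropicFrame C X}

theorem numFrames_zero {n : ℕ} (C : Matrix (Fin n) (Fin n) F) : numFrames C 0 = 1 := by
  have : Unique {X : Fin 0 → Fin n → F // IsIsotropicFrame C X} :=
    { default := ⟨Fin.elim0, linearIndependent_empty_type, fun i => i.elim0⟩
      uniq := fun X => Subsingleton.elim _ _ }
  exact Nat.card_unique

theorem dotProduct_sub_transpose_swap {n : ℕ} (A : Matrix (Fin n) (Fin n) F) (x y : Fin n → F) :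
    y ⬝ᵥ (A - Aᵀ) *ᵥ x = -(x ⬝ᵥ (A - Aᵀ) *ᵥ y) := by
  have h (a b : Fin n → F) : a ⬝ᵥ Aᵀ *ᵥ b = b ⬝ᵥ A *ᵥ a := by
    rw [Matrix.mulVec_transpose, dotProduct_comm, Matrix.dotProduct_mulVec]
  rw [Matrix.sub_mulVec, Matrix.sub_mulVec, dotProduct_sub, dotProduct_sub, h, h]
  ring

theorem dotProduct_sub_transpose_self {n : ℕ} (A : Matrix (Fin n) (Fin n) F) (x : Fin n → F) :
    x ⬝ᵥ (A - Aᵀ) *ᵥ x = 0 := by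
  rw [Matrix.sub_mulVec, dotProduct_sub, Matrix.mulVec_transpose, dotProduct_comm x (x ᵥ* A),
    Matrix.dotProduct_mulVec, sub_self]

theorem isIsotropicFrame_cons {n D : ℕ} (A : Matrix (Fin n) (Fin n) F) (y : Fin n → F)
    (X : Fin D → Fin n → F) :
    IsIsotropicFrame (A - Aᵀ) (Fin.cons y X : Fin (D + 1) → Fin n → F) ↔
      IsIsotropicFrame (A - Aᵀ) X ∧
        (∀ i, X i ⬝ᵥ (A - Aᵀ) *ᵥ y = 0) ∧ y ∉ Submodule.span F (Set.range X) := by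
  simp only [IsIsotropicFrame, linearIndependent_finCons, Fin.forall_fin_succ, Fin.cons_zero,
    Fin.cons_succ, dotProduct_sub_transpose_self, true_and]
  constructor
  · rintro ⟨⟨h1, h2⟩, h3, h4⟩
    exact ⟨⟨h1, fun i => (h4 i).2⟩, fun i => (h4 i).1, h2⟩
  · rintro ⟨⟨h1, h2⟩, h3, h4⟩
    exact ⟨⟨h1, h4⟩, fun i => by rw [dotProduct_sub_transpose_swap, h3, neg_zero],
      fun i => ⟨h3 i, h2 i⟩⟩

section Finite

variable [Fintype F]

theorem card_ker_mul_pow {m n : Type} [Fintype m] [Fintype n] (B : Matrix m n F) :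
    Nat.card {y : n → F // B *ᵥ y = 0} * Fintype.card F ^ Fintype.card m =
      Nat.card {v : m → F // Bᵀ *ᵥ v = 0} * Fintype.card F ^ Fintype.card n := by
  have h (k l : Type) [Fintype k] [Fintype l] (B : Matrix k l F) :
      Nat.card {y : l → F // B *ᵥ y = 0} * Fintype.card F ^ B.rank =
        Fintype.card F ^ Fintype.card l := by
    have h1 : Nat.card {y : l → F // B *ᵥ y = 0} = Nat.card (LinearMap.ker B.mulVecLin) :=
      Nat.card_congr (Equiv.subtypeEquivRight fun y => by simp)
    have h2 := LinearMap.finrank_range_add_finrank_ker B.mulVecLin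
    rw [Module.finrank_fintype_fun_eq_card] at h2
    rw [h1, Module.natCard_eq_pow_finrank (K := F), Nat.card_eq_fintype_card, ← pow_add, add_comm,
      ← h2, Matrix.rank]
  have h1 := h _ _ B
  have h2 := h _ _ Bᵀ
  rw [Matrix.rank_transpose] at h2
  rw [← h1, ← h2]
  ring

theorem card_mulVec_sum_eq_zero {n D : ℕ} (C : Matrix (Fin n) (Fin n) F) {v : Fin D → F}
    (hv : v ≠ 0) :
    Nat.card {X : Fin D → Fin n → F // C *ᵥ (∑ i, v i • X i) = 0} * Fintype.card F ^ C.rank =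
      Fintype.card F ^ (n * D) := by
  let s : (Fin D → Fin n → F) →ₗ[F] (Fin n → F) := ∑ i, v i • LinearMap.proj i
  have hs (X : Fin D → Fin n → F) : s X = ∑ i, v i • X i := by simp [s]
  have hsurj : LinearMap.range s = ⊤ := by
    obtain ⟨i, hi⟩ : ∃ i, v i ≠ 0 := Function.ne_iff.mp hv
    refine LinearMap.range_eq_top.mpr fun y => ⟨Pi.single i ((v i)⁻¹ • y), ?_⟩
    rw [hs, Finset.sum_eq_single i]
    · simp [smul_smul, hi]
    · intro j _ hj
      simp [hj]
    · simp
  have h1 : Nat.card {X : Fin D → Fin n → F // C *ᵥ (∑ i, v i • X i) = 0} =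
      Nat.card (LinearMap.ker (C.mulVecLin ∘ₗ s)) :=
    Nat.card_congr (Equiv.subtypeEquivRight fun y => by
      simp only [LinearMap.mem_ker, LinearMap.comp_apply, hs, Matrix.mulVecLin_apply])
  have h2 := LinearMap.finrank_range_add_finrank_ker (C.mulVecLin ∘ₗ s)
  rw [LinearMap.range_comp_of_range_eq_top _ hsurj] at h2
  rw [h1, Module.natCard_eq_pow_finrank (K := F), Nat.card_eq_fintype_card, ← pow_add, Matrix.rank,
    add_comm, h2]
  simp [Module.finrank_pi_fintype, mul_comm]

/-- The number of ways to extend an isotropic frame by one vector. -/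
theorem card_extensions {n D : ℕ} (A : Matrix (Fin n) (Fin n) F) {X : Fin D → Fin n → F}
    (hX : IsIsotropicFrame (A - Aᵀ) X) :
    (Nat.card {y : Fin n → F // (∀ i, X i ⬝ᵥ (A - Aᵀ) *ᵥ y = 0) ∧
        y ∉ Submodule.span F (Set.range X)} + Fintype.card F ^ D) * Fintype.card F ^ D =
      Nat.card {v : Fin D → F // (A - Aᵀ) *ᵥ (∑ i, v i • X i) = 0} * Fintype.card F ^ n := by
  classical
  have hspan : Nat.card {y : Fin n → F // (∀ i, X i ⬝ᵥ (A - Aᵀ) *ᵥ y = 0) ∧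
      y ∈ Submodule.span F (Set.range X)} = Fintype.card F ^ D := by
    have : Nat.card (Submodule.span F (Set.range X)) = Fintype.card F ^ D := by
      rw [Module.natCard_eq_pow_finrank (K := F), Nat.card_eq_fintype_card,
        finrank_span_eq_card hX.1, Fintype.card_fin]
    rw [← this]
    refine Nat.card_congr (Equiv.subtypeEquivRight fun y => and_iff_right_of_imp fun hy i => ?_)
    induction hy using Submodule.span_induction with
    | mem x hx =>
      obtain ⟨j, rfl⟩ := hx
      exact hX.2 i j
    | zero => simp
    | add x y _ _ h1 h2 => rw [Matrix.mulVec_add, dotProduct_add, h1, h2, add_zero]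
    | smul a x _ h => rw [Matrix.mulVec_smul, dotProduct_smul, h, smul_zero]
  have hsplit : Nat.card {y : Fin n → F // (∀ i, X i ⬝ᵥ (A - Aᵀ) *ᵥ y = 0) ∧
        y ∉ Submodule.span F (Set.range X)} + Fintype.card F ^ D =
      Nat.card {y : Fin n → F // ∀ i, X i ⬝ᵥ (A - Aᵀ) *ᵥ y = 0} := by
    rw [← hspan]
    simp only [Nat.card_eq_fintype_card, Fintype.card_subtype]
    rw [← Finset.filter_filter, ← Finset.filter_filter, add_comm,
      Finset.card_filter_add_card_filter_not]
  have hker := card_ker_mul_pow (Matrix.of X * (A - Aᵀ))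
  simp only [Fintype.card_fin] at hker
  rw [hsplit]
  convert hker using 2
  · refine Nat.card_congr (Equiv.subtypeEquivRight fun y => ?_)
    rw [← Matrix.mulVec_mulVec, funext_iff]
    rfl
  · refine Nat.card_congr (Equiv.subtypeEquivRight fun v => ?_)
    have hv : (Matrix.of X)ᵀ *ᵥ v = ∑ i, v i • X i := by
      ext a
      simp [Matrix.mulVec, dotProduct, mul_comm]
    rw [Matrix.transpose_mul, ← Matrix.mulVec_mulVec, hv, Matrix.transpose_sub,
      Matrix.transpose_transpose, ← neg_sub A, Matrix.neg_mulVec, neg_eq_zero]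

theorem numFrames_succ {n : ℕ} (A : Matrix (Fin n) (Fin n) F) (D : ℕ) :
    (numFrames (A - Aᵀ) (D + 1) + Fintype.card F ^ D * numFrames (A - Aᵀ) D) *
        Fintype.card F ^ D =
      Nat.card {p : {X : Fin D → Fin n → F // IsIsotropicFrame (A - Aᵀ) X} × (Fin D → F) //
        (A - Aᵀ) *ᵥ (∑ i, p.2 i • p.1.1 i) = 0} * Fintype.card F ^ n := by
  classical
  have e1 : {Y : Fin (D + 1) → Fin n → F // IsIsotropicFrame (A - Aᵀ) Y} ≃
      Σ X : {X : Fin D → Fin n → F // IsIsotropicFrame (A - Aᵀ) X},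
        {y : Fin n → F // (∀ i, X.1 i ⬝ᵥ (A - Aᵀ) *ᵥ y = 0) ∧
          y ∉ Submodule.span F (Set.range X.1)} :=
    { toFun := fun Y => by
        have h := (isIsotropicFrame_cons A (Y.1 0) (Fin.tail Y.1)).1
          (by rw [Fin.cons_self_tail]; exact Y.2)
        exact ⟨⟨Fin.tail Y.1, h.1⟩, ⟨Y.1 0, h.2⟩⟩
      invFun := fun p => ⟨Fin.cons p.2.1 p.1.1, (isIsotropicFrame_cons A _ _).2 ⟨p.1.2, p.2.2⟩⟩
      left_inv := fun Y => Subtype.ext (Fin.cons_self_tail Y.1)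
      right_inv := fun p => rfl }
  have e2 : {p : {X : Fin D → Fin n → F // IsIsotropicFrame (A - Aᵀ) X} × (Fin D → F) //
        (A - Aᵀ) *ᵥ (∑ i, p.2 i • p.1.1 i) = 0} ≃
      Σ X : {X : Fin D → Fin n → F // IsIsotropicFrame (A - Aᵀ) X},
        {v : Fin D → F // (A - Aᵀ) *ᵥ (∑ i, v i • X.1 i) = 0} :=
    { toFun := fun p => ⟨p.1.1, ⟨p.1.2, p.2⟩⟩
      invFun := fun p => ⟨(p.1, p.2.1), p.2.2⟩
      left_inv := fun p => rfl
      right_inv := fun p => rfl }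
  rw [Nat.card_congr e2, numFrames, Nat.card_congr e1, Nat.card_sigma, Nat.card_sigma, numFrames,
    Finset.sum_mul, ← Finset.sum_congr rfl fun X _ => card_extensions A X.2, ← Finset.sum_mul,
    Finset.sum_add_distrib, Finset.sum_const, Finset.card_univ, Nat.card_eq_fintype_card,
    smul_eq_mul, mul_comm (Fintype.card F ^ D)]

theorem numFrames_le_card_pairs {n : ℕ} (C : Matrix (Fin n) (Fin n) F) (D : ℕ) :
    numFrames C D ≤
      Nat.card {p : {X : Fin D → Fin n → F // IsIsotropicFrame C X} × (Fin D → F) //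
        C *ᵥ (∑ i, p.2 i • p.1.1 i) = 0} :=
  Nat.card_le_card_of_injective (fun X => ⟨(X, 0), by simp⟩) fun X Y h => by simpa using h

theorem card_pairs_le {n : ℕ} (C : Matrix (Fin n) (Fin n) F) (D : ℕ) :
    Nat.card {p : {X : Fin D → Fin n → F // IsIsotropicFrame C X} × (Fin D → F) //
        C *ᵥ (∑ i, p.2 i • p.1.1 i) = 0} * Fintype.card F ^ C.rank ≤
      numFrames C D * Fintype.card F ^ C.rank + Fintype.card F ^ (n * D + D) := by
  classical
  have e : {p : {X : Fin D → Fin n → F // IsIsotropicFrame C X} × (Fin D → F) //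
        C *ᵥ (∑ i, p.2 i • p.1.1 i) = 0} ≃
      Σ v : Fin D → F, {X : {X : Fin D → Fin n → F // IsIsotropicFrame C X} //
        C *ᵥ (∑ i, v i • X.1 i) = 0} :=
    { toFun := fun p => ⟨p.1.2, ⟨p.1.1, p.2⟩⟩
      invFun := fun p => ⟨(p.2.1, p.1), p.2.2⟩
      left_inv := fun p => rfl
      right_inv := fun p => rfl }
  rw [Nat.card_congr e, Nat.card_sigma, ← Finset.add_sum_erase _ _ (Finset.mem_univ 0), add_mul,
    Finset.sum_mul]
  refine add_le_add (Nat.mul_le_mul_right _ (Nat.card_le_card_of_injective _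
    Subtype.val_injective)) ?_
  calc _ ≤ ∑ v ∈ Finset.univ.erase (0 : Fin D → F), Fintype.card F ^ (n * D) := by
        refine Finset.sum_le_sum fun v hv => ?_
        rw [← card_mulVec_sum_eq_zero C (Finset.ne_of_mem_erase hv)]
        refine Nat.mul_le_mul_right _ (Nat.card_le_card_of_injective
          (fun X => ⟨X.1.1, X.2⟩) fun X Y h => ?_)
        exact Subtype.ext (Subtype.ext (Subtype.mk.inj h))
    _ ≤ ∑ v : Fin D → F, Fintype.card F ^ (n * D) :=
        Finset.sum_le_sum_of_subset (Finset.erase_subset _ _)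
    _ = Fintype.card F ^ (n * D + D) := by simp [pow_add, mul_comm]

theorem numFrames_le {n : ℕ} (C : Matrix (Fin n) (Fin n) F) (D : ℕ) :
    numFrames C D ≤ Fintype.card F ^ (n * D) := by
  refine (Nat.card_le_card_of_injective _ Subtype.val_injective).trans ?_
  simp [pow_mul]

theorem card_linearIndependent_ker {n D : ℕ} (M : Matrix (Fin n) (Fin n) F) :
    (Nat.card {X : Fin D → Fin n → F // LinearIndependent F X ∧ ∀ i, M *ᵥ X i = 0} : ℝ) =
      ∏ i ∈ Finset.range D, ((Fintype.card F : ℝ) ^ Module.finrank F (LinearMap.ker M.mulVecLin) -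
        (Fintype.card F : ℝ) ^ i) := by
  have e : {X : Fin D → Fin n → F // LinearIndependent F X ∧ ∀ i, M *ᵥ X i = 0} ≃
      {s : Fin D → LinearMap.ker M.mulVecLin // LinearIndependent F s} :=
    { toFun := fun X => ⟨fun i => ⟨X.1 i, X.2.2 i⟩,
        LinearIndependent.of_comp (LinearMap.ker M.mulVecLin).subtype X.2.1⟩
      invFun := fun s => ⟨fun i => (s.1 i : Fin n → F),
        s.2.map' (LinearMap.ker M.mulVecLin).subtype (Submodule.ker_subtype _),
        fun i => (s.1 i).2⟩
      left_inv := fun X => rfl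
      right_inv := fun s => rfl }
  rw [Nat.card_congr e]
  rcases le_or_gt D (Module.finrank F (LinearMap.ker M.mulVecLin)) with h | h
  · rw [card_linearIndependent h, ← Fin.prod_univ_eq_prod_range, Nat.cast_prod]
    refine Finset.prod_congr rfl fun i _ => ?_
    rw [Nat.cast_sub (Nat.pow_le_pow_right Fintype.card_pos (i.2.le.trans h))]
    push_cast
    rfl
  · rw [Finset.prod_eq_zero (Finset.mem_range.mpr h) (sub_self _)]
    have : IsEmpty {s : Fin D → LinearMap.ker M.mulVecLin // LinearIndependent F s} := by
      refine ⟨fun s => ?_⟩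
      have := s.2.fintype_card_le_finrank
      rw [Fintype.card_fin] at this
      omega
    simp

/-- The `D`-th moment of the kernel of a random `C`-symmetric matrix, counted by isotropic
frames. -/
theorem sum_prod_eq_numFrames {n : ℕ} (A : Matrix (Fin n) (Fin n) F) (D : ℕ)
    [Fintype {M : Matrix (Fin n) (Fin n) F // M - Mᵀ = A - Aᵀ}] :
    (∑ M : {M : Matrix (Fin n) (Fin n) F // M - Mᵀ = A - Aᵀ}, ∏ i ∈ Finset.range D,
        ((Fintype.card F : ℝ) ^ Module.finrank F (LinearMap.ker M.1.mulVecLin) -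
          (Fintype.card F : ℝ) ^ i)) * (Fintype.card F : ℝ) ^ (n * D) =
      numFrames (A - Aᵀ) D * (Fintype.card F : ℝ) ^ ((n + 1).choose 2 + D.choose 2) := by
  classical
  have hiso (M : Matrix (Fin n) (Fin n) F) (hM : M - Mᵀ = A - Aᵀ) (X : Fin D → Fin n → F)
      (hX : ∀ i, M *ᵥ X i = 0) (i j : Fin D) : X i ⬝ᵥ (A - Aᵀ) *ᵥ X j = 0 := by
    rw [← hM, Matrix.sub_mulVec, hX, Matrix.mulVec_transpose, zero_sub, dotProduct_neg,
      dotProduct_comm, ← Matrix.dotProduct_mulVec, hX, dotProduct_zero, neg_zero]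
  have e : (Σ M : {M : Matrix (Fin n) (Fin n) F // M - Mᵀ = A - Aᵀ},
        {X : Fin D → Fin n → F // LinearIndependent F X ∧ ∀ i, M.1 *ᵥ X i = 0}) ≃
      Σ X : {X : Fin D → Fin n → F // IsIsotropicFrame (A - Aᵀ) X},
        {M : Matrix (Fin n) (Fin n) F // M - Mᵀ = A - Aᵀ ∧ ∀ i, M *ᵥ X.1 i = 0} :=
    { toFun := fun p => ⟨⟨p.2.1, p.2.2.1, hiso p.1.1 p.1.2 p.2.1 p.2.2.2⟩,
        ⟨p.1.1, p.1.2, p.2.2.2⟩⟩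
      invFun := fun p => ⟨⟨p.2.1, p.2.2.1⟩, ⟨p.1.1, p.1.2.1, p.2.2.2⟩⟩
      left_inv := fun p => rfl
      right_inv := fun p => rfl }
  have h := Nat.card_congr e
  rw [Nat.card_sigma, Nat.card_sigma] at h
  simp only [← card_linearIndependent_ker]
  norm_cast
  rw [h, Finset.sum_mul, Finset.sum_congr rfl fun X _ => card_cSymmetric_vanishing A X.2.1 X.2.2,
    Finset.sum_const, Finset.card_univ, smul_eq_mul, numFrames, Nat.card_eq_fintype_card]

/-- The normalized number of isotropic frames of length `D`. -/
noncomputable def frameDensity {n : ℕ} (C : Matrix (Fin n) (Fin n) F) (D : ℕ) : ℝ :=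
  numFrames C D * (Fintype.card F : ℝ) ^ D.choose 2 / (Fintype.card F : ℝ) ^ (n * D)

theorem abs_frameDensity_succ_sub_le {n : ℕ} (A : Matrix (Fin n) (Fin n) F) (D : ℕ) :
    |frameDensity (A - Aᵀ) (D + 1) - frameDensity (A - Aᵀ) D| ≤
      (Fintype.card F : ℝ) ^ (2 * D + D.choose 2) / (Fintype.card F : ℝ) ^ (A - Aᵀ).rank := by
  have h1 := numFrames_succ A D
  have h2 := numFrames_le_card_pairs (A - Aᵀ) D
  have h3 := card_pairs_le (A - Aᵀ) D
  have h4 := numFrames_le (A - Aᵀ) D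
  have hc : (A - Aᵀ).rank ≤ n := by simpa using (A - Aᵀ).rank_le_card_width
  generalize Nat.card {p : {X : Fin D → Fin n → F // IsIsotropicFrame (A - Aᵀ) X} ×
    (Fin D → F) // (A - Aᵀ) *ᵥ (∑ i, p.2 i • p.1.1 i) = 0} = p at h1 h2 h3
  unfold frameDensity
  generalize (A - Aᵀ).rank = c at *
  generalize numFrames (A - Aᵀ) (D + 1) = N' at *
  generalize numFrames (A - Aᵀ) D = N at *
  have hq : (1 : ℝ) < Fintype.card F := by exact_mod_cast Fintype.one_lt_card
  have hq0 : (0 : ℝ) < Fintype.card F := by linarith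
  have hcn := pow_le_pow_right₀ hq.le hc
  have hch : (D + 1).choose 2 = D.choose 2 + D := by
    rw [Nat.choose_succ_succ' D 1, Nat.choose_one_right, add_comm]
  have ha := one_le_pow₀ hq.le (n := D)
  have h1' : ((N' : ℝ) + (Fintype.card F : ℝ) ^ D * N) * (Fintype.card F : ℝ) ^ D =
      p * (Fintype.card F : ℝ) ^ n := by exact_mod_cast h1
  have h2' : (N : ℝ) ≤ p := by exact_mod_cast h2
  have h3' : (p : ℝ) * (Fintype.card F : ℝ) ^ c ≤ N * (Fintype.card F : ℝ) ^ c +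
      (Fintype.card F : ℝ) ^ (n * D) * (Fintype.card F : ℝ) ^ D := by
    rw [← pow_add]
    exact_mod_cast h3
  have h4' : (N : ℝ) ≤ (Fintype.card F : ℝ) ^ (n * D) := by exact_mod_cast h4
  rw [hch, Nat.mul_succ, pow_add, pow_add, pow_add, pow_mul' _ 2 D]
  have hB : 0 < (Fintype.card F : ℝ) ^ (n * D) := by positivity
  have hQ : 0 < (Fintype.card F : ℝ) ^ n := by positivity
  have hh : 0 < (Fintype.card F : ℝ) ^ D.choose 2 := by positivity
  have hs : 0 < (Fintype.card F : ℝ) ^ c := by positivity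
  generalize (Fintype.card F : ℝ) ^ (n * D) = B at *
  generalize (Fintype.card F : ℝ) ^ n = Q at *
  generalize (Fintype.card F : ℝ) ^ D.choose 2 = h at *
  generalize (Fintype.card F : ℝ) ^ c = s at *
  generalize (Fintype.card F : ℝ) ^ D = a at *
  have hN : (0 : ℝ) ≤ N := N.cast_nonneg
  have hdecomp : N' * (h * a) / (B * Q) - N * h / B =
      (p - N) * h / B - a ^ 2 * h * N / (B * Q) := by
    field_simp
    linear_combination h1'
  have hu1 : 0 ≤ (p - N) * h / B := div_nonneg (mul_nonneg (sub_nonneg.mpr h2') hh.le) hB.le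
  have hl1 : 0 ≤ a ^ 2 * h * N / (B * Q) := by positivity
  have hu2 : (p - N) * h / B ≤ a ^ 2 * h / s := by
    rw [div_le_div_iff₀ hB hs]
    calc (p - N) * h * s = ((p * s) - N * s) * h := by ring
      _ ≤ (B * a) * h := by gcongr; linarith
      _ ≤ (B * a ^ 2) * h := by gcongr; exact le_self_pow₀ ha two_ne_zero
      _ = a ^ 2 * h * B := by ring
  have hl2 : a ^ 2 * h * N / (B * Q) ≤ a ^ 2 * h / s := by
    rw [div_le_div_iff₀ (mul_pos hB hQ) hs, mul_assoc (a ^ 2 * h)]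
    gcongr
  rw [hdecomp, abs_le]
  constructor <;> linarith

/-- Isotropic frames are almost as numerous as if the isotropy conditions were independent. -/
theorem abs_frameDensity_sub_one_le {n : ℕ} (A : Matrix (Fin n) (Fin n) F) (D : ℕ) :
    |frameDensity (A - Aᵀ) D - 1| ≤
      (Fintype.card F : ℝ) ^ (D + 1).choose 2 / (Fintype.card F : ℝ) ^ (A - Aᵀ).rank := by
  have hq : (2 : ℝ) ≤ Fintype.card F := by exact_mod_cast Fintype.one_lt_card
  induction D with
  | zero => simp [frameDensity, numFrames_zero]
  | succ D ih =>
    calc _ = |(frameDensity (A - Aᵀ) (D + 1) - frameDensity (A - Aᵀ) D) +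
          (frameDensity (A - Aᵀ) D - 1)| := by congr 1; ring
      _ ≤ (Fintype.card F : ℝ) ^ (2 * D + D.choose 2) / (Fintype.card F : ℝ) ^ (A - Aᵀ).rank +
          (Fintype.card F : ℝ) ^ (D + 1).choose 2 / (Fintype.card F : ℝ) ^ (A - Aᵀ).rank :=
        (abs_add_le _ _).trans (add_le_add (abs_frameDensity_succ_sub_le A D) ih)
      _ ≤ _ := by
        rw [← add_div]
        gcongr
        have h1 : (D + 1).choose 2 = D.choose 2 + D := by
          rw [Nat.choose_succ_succ' D 1, Nat.choose_one_right, add_comm]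
        have h2 : (D + 1 + 1).choose 2 = 2 * D + D.choose 2 + 1 := by
          rw [Nat.choose_succ_succ' (D + 1) 1, Nat.choose_one_right, h1]
          ring
        have h3 : (Fintype.card F : ℝ) ^ (D + 1).choose 2 ≤
            (Fintype.card F : ℝ) ^ (2 * D + D.choose 2) :=
          pow_le_pow_right₀ (by linarith) (by omega)
        rw [h2, pow_succ]
        have : 0 ≤ (Fintype.card F : ℝ) ^ (2 * D + D.choose 2) := by positivity
        nlinarith

end Finite

/-- The coefficients `(-1)^j / ∏_{i=1}^j (q^i - 1)` of Euler's expansion of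
`∏_{i ≥ 1} (1 - x q^{-i})`. -/
noncomputable def eulerCoeff (q : ℝ) (j : ℕ) : ℝ :=
  (-1) ^ j / ∏ i ∈ Finset.range j, (q ^ (i + 1) - 1)

theorem pow_succ_sub_one_pos {q : ℝ} (hq : 1 < q) (i : ℕ) : 0 < q ^ (i + 1) - 1 :=
  sub_pos.mpr (one_lt_pow₀ hq i.succ_ne_zero)

theorem eulerCoeff_succ_mul {q : ℝ} (hq : 1 < q) (j : ℕ) :
    eulerCoeff q (j + 1) * (q ^ (j + 1) - 1) = -eulerCoeff q j := by
  have h := (pow_succ_sub_one_pos hq j).ne'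
  rw [eulerCoeff, eulerCoeff, Finset.prod_range_succ, pow_succ (-1 : ℝ), ← div_div,
    div_mul_cancel₀ _ h]
  ring

theorem sum_eulerCoeff_mul_prod {q : ℝ} (hq : 1 < q) (y : ℝ) (N : ℕ) :
    ∑ j ∈ Finset.range (N + 1), eulerCoeff q j * ∏ i ∈ Finset.range j, (y - q ^ i) =
      ∏ i ∈ Finset.range N, (q ^ (i + 1) - y) / (q ^ (i + 1) - 1) := by
  induction N with
  | zero => simp [eulerCoeff]
  | succ N ih =>
    rw [Finset.sum_range_succ, ih, Finset.prod_range_succ' (fun i => y - q ^ i),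
      Finset.prod_range_succ, eulerCoeff, Finset.prod_div_distrib, Finset.prod_range_succ _ N]
    have h1 : ∏ i ∈ Finset.range N, (q ^ (i + 1) - 1) ≠ 0 :=
      Finset.prod_ne_zero_iff.mpr fun i _ => (pow_succ_sub_one_pos hq i).ne'
    have h2 := (pow_succ_sub_one_pos hq N).ne'
    have h3 : ∏ i ∈ Finset.range N, (y - q ^ (i + 1)) =
        (-1) ^ N * ∏ i ∈ Finset.range N, (q ^ (i + 1) - y) := by
      simpa using (Finset.prod_neg (s := Finset.range N) (fun i => q ^ (i + 1) - y))
    have h4 : ((-1 : ℝ) ^ N) * (-1) ^ N = 1 := by rw [← mul_pow]; norm_num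
    rw [h3, pow_succ (-1 : ℝ)]
    field_simp
    linear_combination (1 - y) * (∏ i ∈ Finset.range N, (q ^ (i + 1) - y)) * h4

/-- Inversion of the `q`-moments `∏_{i < D} (q^k - q^i)`. -/
theorem sum_eulerCoeff_moments {q : ℝ} (hq : 1 < q) {k r N : ℕ} (hk : k ≤ N) :
    ∑ j ∈ Finset.range (N + 1),
        eulerCoeff q j / q ^ (r * j) * ∏ i ∈ Finset.range (r + j), (q ^ k - q ^ i) =
      if k = r then ∏ i ∈ Finset.range r, (q ^ r - q ^ i) else 0 := by
  have hq0 : q ≠ 0 := by positivity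
  have hterm (j : ℕ) :
      eulerCoeff q j / q ^ (r * j) * ∏ i ∈ Finset.range (r + j), (q ^ k - q ^ i) =
        (∏ i ∈ Finset.range r, (q ^ k - q ^ i)) *
          (eulerCoeff q j * ∏ i ∈ Finset.range j, (q ^ k / q ^ r - q ^ i)) := by
    have : ∏ i ∈ Finset.range j, (q ^ k - q ^ (r + i)) =
        q ^ (r * j) * ∏ i ∈ Finset.range j, (q ^ k / q ^ r - q ^ i) := by
      rw [pow_mul, ← Finset.card_range j, ← Finset.prod_const, Finset.card_range,
        ← Finset.prod_mul_distrib]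
      refine Finset.prod_congr rfl fun i _ => ?_
      rw [mul_sub, mul_div_cancel₀ _ (pow_ne_zero r hq0), pow_add]
    rw [Finset.prod_range_add, this]
    field_simp
  rw [Finset.sum_congr rfl fun j _ => hterm j, ← Finset.mul_sum, sum_eulerCoeff_mul_prod hq]
  rcases lt_trichotomy k r with h | rfl | h
  · rw [Finset.prod_eq_zero (Finset.mem_range.mpr h) (sub_self _), zero_mul, if_neg h.ne]
  · rw [if_pos rfl, div_self (pow_ne_zero k hq0), Finset.prod_congr rfl fun i _ =>
      div_self (pow_succ_sub_one_pos hq i).ne', Finset.prod_const_one, mul_one]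
  · obtain ⟨m, rfl⟩ := Nat.exists_eq_add_of_lt h
    have h0 : (q ^ (m + 1) - q ^ (r + m + 1) / q ^ r) / (q ^ (m + 1) - 1) = 0 := by
      rw [add_assoc, pow_add q r, mul_div_cancel_left₀ _ (pow_ne_zero r hq0), sub_self, zero_div]
    rw [if_neg h.ne', Finset.prod_eq_zero (f := fun i =>
      (q ^ (i + 1) - q ^ (r + m + 1) / q ^ r) / (q ^ (i + 1) - 1)) (i := m)
      (Finset.mem_range.mpr (by omega)) h0, mul_zero]

theorem quarter_le_prod {q : ℝ} (hq : 2 ≤ q) (j : ℕ) :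
    1 / 4 ≤ ∏ i ∈ Finset.range j, (1 - (q ^ (i + 1))⁻¹) := by
  have key (m : ℕ) : 1 / 4 + (1 / 2) ^ (m + 2) ≤
      ∏ i ∈ Finset.range (m + 1), (1 - (q ^ (i + 1))⁻¹) := by
    have hinv (i : ℕ) : (q ^ (i + 1))⁻¹ ≤ (1 / 2 : ℝ) ^ (i + 1) := by
      rw [← inv_pow]
      exact pow_le_pow_left₀ (by positivity) (by rw [one_div]; gcongr) _
    induction m with
    | zero =>
      have := hinv 0
      norm_num at this ⊢
      linarith
    | succ m ih =>
      rw [Finset.prod_range_succ]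
      have h1 : (1 / 2 : ℝ) ^ (m + 2) ≤ 1 / 4 := by
        rw [pow_add]
        have : (1 / 2 : ℝ) ^ m ≤ 1 := pow_le_one₀ (by norm_num) (by norm_num)
        linarith
      have h2 := hinv (m + 1)
      have h0 : (0 : ℝ) < (1 / 2) ^ (m + 2) := by positivity
      rw [show m + 1 + 2 = m + 2 + 1 from rfl, pow_succ (1 / 2 : ℝ)]
      calc _ ≤ (1 / 4 + (1 / 2 : ℝ) ^ (m + 2)) * (1 - (1 / 2) ^ (m + 2)) := by nlinarith
        _ ≤ _ := by
          refine mul_le_mul ih ?_ (by linarith) (by linarith)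
          linarith
  cases j with
  | zero => norm_num
  | succ m => exact (le_add_of_nonneg_right (by positivity)).trans (key m)

theorem abs_eulerCoeff_le {q : ℝ} (hq : 2 ≤ q) (j : ℕ) :
    |eulerCoeff q j| ≤ 4 / q ^ (j + 1).choose 2 := by
  have hq1 : 1 < q := by linarith
  have hq0 : 0 < q := by linarith
  have hprod : ∏ i ∈ Finset.range j, (q ^ (i + 1) - 1) =
      q ^ (j + 1).choose 2 * ∏ i ∈ Finset.range j, (1 - (q ^ (i + 1))⁻¹) := by
    induction j with
    | zero => simp
    | succ j ih =>
      have hch : (j + 1 + 1).choose 2 = j + 1 + (j + 1).choose 2 := by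
        rw [Nat.choose_succ_succ' (j + 1) 1, Nat.choose_one_right]
      rw [Finset.prod_range_succ, ih, Finset.prod_range_succ, hch, pow_add q (j + 1)]
      have := (pow_pos hq0 (j + 1)).ne'
      generalize ∏ i ∈ Finset.range j, (1 - (q ^ (i + 1))⁻¹) = p
      field_simp
  have hpos : 0 < ∏ i ∈ Finset.range j, (q ^ (i + 1) - 1) :=
    Finset.prod_pos fun i _ => pow_succ_sub_one_pos hq1 i
  rw [eulerCoeff, abs_div, abs_pow, abs_neg, abs_one, one_pow, abs_of_pos hpos,
    div_le_div_iff₀ hpos (by positivity), hprod]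
  have := quarter_le_prod hq j
  have hp : 0 < q ^ (j + 1).choose 2 := by positivity
  nlinarith

theorem abs_eulerCoeff_div_le {q : ℝ} (hq : 2 ≤ q) (r j : ℕ) :
    |eulerCoeff q j / q ^ (r * j)| ≤ 4 * (1 / q) ^ j := by
  have hq1 : 1 ≤ q := by linarith
  have hj : j ≤ (j + 1).choose 2 := by
    rw [Nat.choose_succ_succ' j 1, Nat.choose_one_right]
    omega
  rw [abs_div, abs_of_pos (show 0 < q ^ (r * j) by positivity), one_div, inv_pow, ← div_eq_mul_inv]
  refine (div_le_self (abs_nonneg _) (one_le_pow₀ hq1)).trans ((abs_eulerCoeff_le hq j).trans ?_)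
  gcongr

theorem summable_bound {q : ℝ} (hq : 2 ≤ q) : Summable fun j : ℕ => 4 * (1 / q) ^ j :=
  (summable_geometric_of_lt_one (by positivity)
    (by rw [div_lt_one (by linarith)]; linarith)).mul_left 4

theorem summable_eulerCoeff {q : ℝ} (hq : 2 ≤ q) (r : ℕ) :
    Summable fun j => eulerCoeff q j / q ^ (r * j) :=
  .of_norm_bounded (summable_bound hq) (abs_eulerCoeff_div_le hq r)

theorem tsum_eulerCoeff_succ {q : ℝ} (hq : 2 ≤ q) (r : ℕ) :
    ∑' j, eulerCoeff q j / q ^ (r * j) =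
      (1 - (q ^ (r + 1))⁻¹) * ∑' j, eulerCoeff q j / q ^ ((r + 1) * j) := by
  have hq0 : q ≠ 0 := by linarith
  have hs := summable_eulerCoeff hq r
  have hs' := summable_eulerCoeff hq (r + 1)
  have hdiff : ∑' j, eulerCoeff q j / q ^ (r * j) - ∑' j, eulerCoeff q j / q ^ ((r + 1) * j) =
      -(q ^ (r + 1))⁻¹ * ∑' j, eulerCoeff q j / q ^ ((r + 1) * j) := by
    rw [← hs.tsum_sub hs', (hs.sub hs').tsum_eq_zero_add, ← tsum_mul_left]
    simp only [mul_zero, sub_self, zero_add]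
    refine tsum_congr fun j => ?_
    have h := eulerCoeff_succ_mul (by linarith : 1 < q) j
    rw [← neg_eq_iff_eq_neg.mpr h]
    have e1 : q ^ ((r + 1) * (j + 1)) = q ^ (r * (j + 1)) * q ^ (j + 1) := by ring
    have e2 : q ^ ((r + 1) * (j + 1)) = q ^ (r + 1) * q ^ ((r + 1) * j) := by ring
    rw [inv_eq_one_div, neg_mul, div_mul_div_comm, ← e2, e1]
    field_simp
  linear_combination hdiff

/-- Euler's identity `∑ (-1)^j q^{-rj} / ∏_{i=1}^j (q^i - 1) = ∏_{i > r} (1 - q^{-i})`. -/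
theorem tsum_eulerCoeff {q : ℝ} (hq : 2 ≤ q) (r : ℕ) :
    ∑' j, eulerCoeff q j / q ^ (r * j) = ∏' i : ℕ, (1 - (q ^ (r + 1 + i))⁻¹) := by
  have hq0 : 0 < q := by linarith
  have hqinv : 1 / q < 1 := by rw [div_lt_one hq0]; linarith
  have hpart (m : ℕ) : (∏ i ∈ Finset.range m, (1 - (q ^ (r + 1 + i))⁻¹)) *
      ∑' j, eulerCoeff q j / q ^ ((r + m) * j) = ∑' j, eulerCoeff q j / q ^ (r * j) := by
    induction m with
    | zero => simp
    | succ m ih =>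
      rw [← ih, tsum_eulerCoeff_succ hq (r + m), Finset.prod_range_succ, add_right_comm r 1 m,
        mul_assoc, add_assoc r m 1]
  have hlim : Filter.Tendsto (fun m => ∑' j, eulerCoeff q j / q ^ ((r + m) * j)) Filter.atTop
      (nhds 1) := by
    have h1 : ∑' j : ℕ, (if j = 0 then (1 : ℝ) else 0) = 1 := by simp
    rw [← h1]
    refine tendsto_tsum_of_dominated_convergence (summable_bound hq) (fun j => ?_)
      (.of_forall fun m j => abs_eulerCoeff_div_le hq (r + m) j)
    rcases eq_or_ne j 0 with rfl | hj
    · simp [eulerCoeff]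
    · rw [if_neg hj]
      refine squeeze_zero_norm (a := fun m => |eulerCoeff q j| * (1 / q) ^ m) (fun m => ?_) ?_
      · rw [Real.norm_eq_abs, abs_div, abs_of_pos (show 0 < q ^ ((r + m) * j) by positivity),
          one_div, inv_pow, ← div_eq_mul_inv]
        gcongr
        · linarith
        · exact (Nat.le_add_left m r).trans (Nat.le_mul_of_pos_right _ (Nat.pos_of_ne_zero hj))
      · simpa using (tendsto_pow_atTop_nhds_zero_of_lt_one (by positivity) hqinv).const_mul
          |eulerCoeff q j|
  have hmul : Multipliable fun i : ℕ => 1 - (q ^ (r + 1 + i))⁻¹ := by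
    have hs : Summable fun i : ℕ => -(q ^ (r + 1 + i))⁻¹ := by
      refine (((summable_geometric_of_lt_one (by positivity) hqinv).mul_left
        (q ^ (r + 1))⁻¹).neg).congr fun i => ?_
      rw [pow_add q (r + 1), mul_inv, one_div, inv_pow]
    simpa [sub_eq_add_neg] using Real.multipliable_one_add_of_summable hs
  have h := hmul.hasProd.tendsto_prod_nat.mul hlim
  simp only [hpart, mul_one] at h
  exact tendsto_nhds_unique tendsto_const_nhds h

theorem abs_sum_sub_tsum_eulerCoeff_le {q : ℝ} (hq : 2 ≤ q) (r n : ℕ) :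
    |∑ j ∈ Finset.range (n + 1), eulerCoeff q j / q ^ (r * j) -
        ∑' j, eulerCoeff q j / q ^ (r * j)| ≤ 4 * (1 / q) ^ n := by
  have hq0 : 0 < q := by linarith
  have hqinv : 1 / q ≤ 1 / 2 := by gcongr
  rw [abs_sub_comm, ← (summable_eulerCoeff hq r).sum_add_tsum_nat_add (n + 1), add_sub_cancel_left]
  have hgeo := (hasSum_geometric_of_lt_one (by positivity : 0 ≤ 1 / q) (by linarith)).mul_left
    (4 * (1 / q) ^ (n + 1))
  refine (tsum_of_norm_bounded (f := fun j => eulerCoeff q (j + (n + 1)) /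
    q ^ (r * (j + (n + 1)))) hgeo fun j => ?_).trans ?_
  · refine (abs_eulerCoeff_div_le hq r (j + (n + 1))).trans_eq ?_
    ring
  · rw [pow_succ]
    have h1 : 1 / q * (1 - 1 / q)⁻¹ ≤ 1 := by
      rw [← div_eq_mul_inv, div_le_one (by linarith)]
      linarith
    calc _ = 4 * (1 / q) ^ n * (1 / q * (1 - 1 / q)⁻¹) := by ring
      _ ≤ _ := mul_le_of_le_one_right (by positivity) h1

/-- The number of `C`-symmetric matrices of corank `r`, by inversion of moments. -/
theorem card_corank_mul [Fintype F] {n : ℕ} (A : Matrix (Fin n) (Fin n) F) (r : ℕ) :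
    (Nat.card {M : Matrix (Fin n) (Fin n) F //
        M - Mᵀ = A - Aᵀ ∧ Module.finrank F (LinearMap.ker M.mulVecLin) = r} : ℝ) *
        ∏ i ∈ Finset.range r, ((Fintype.card F : ℝ) ^ r - (Fintype.card F : ℝ) ^ i) =
      (∑ j ∈ Finset.range (n + 1), eulerCoeff (Fintype.card F) j / (Fintype.card F : ℝ) ^ (r * j) *
        frameDensity (A - Aᵀ) (r + j)) * (Fintype.card F : ℝ) ^ (n + 1).choose 2 := by
  classical
  have hq : (1 : ℝ) < Fintype.card F := by exact_mod_cast Fintype.one_lt_card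
  have hcount : (Nat.card {M : Matrix (Fin n) (Fin n) F //
        M - Mᵀ = A - Aᵀ ∧ Module.finrank F (LinearMap.ker M.mulVecLin) = r} : ℝ) =
      ∑ M : {M : Matrix (Fin n) (Fin n) F // M - Mᵀ = A - Aᵀ},
        if Module.finrank F (LinearMap.ker M.1.mulVecLin) = r then 1 else 0 := by
    rw [Finset.sum_boole, ← Fintype.card_subtype, ← Nat.card_eq_fintype_card]
    exact congrArg _ (Nat.card_congr (Equiv.subtypeSubtypeEquivSubtypeInter _ _).symm)
  have hmoment (D : ℕ) : ∑ M : {M : Matrix (Fin n) (Fin n) F // M - Mᵀ = A - Aᵀ},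
      ∏ i ∈ Finset.range D,
        ((Fintype.card F : ℝ) ^ Module.finrank F (LinearMap.ker M.1.mulVecLin) -
          (Fintype.card F : ℝ) ^ i) =
      frameDensity (A - Aᵀ) D * (Fintype.card F : ℝ) ^ (n + 1).choose 2 := by
    have h := sum_prod_eq_numFrames A D
    rw [frameDensity, div_mul_eq_mul_div, eq_div_iff (by positivity), h, pow_add]
    ring
  rw [hcount, Finset.sum_mul, Finset.sum_mul]
  simp only [mul_assoc, ← hmoment, Finset.mul_sum]
  rw [Finset.sum_comm]
  refine Finset.sum_congr rfl fun M _ => ?_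
  have hk : Module.finrank F (LinearMap.ker M.1.mulVecLin) ≤ n := by
    simpa using Submodule.finrank_le (LinearMap.ker M.1.mulVecLin)
  rw [sum_eulerCoeff_moments hq hk, ite_mul, one_mul, zero_mul]

theorem abs_sum_frameDensity_sub_le [Fintype F] {n : ℕ} (A : Matrix (Fin n) (Fin n) F) (r : ℕ) :
    |∑ j ∈ Finset.range (n + 1), eulerCoeff (Fintype.card F) j / (Fintype.card F : ℝ) ^ (r * j) *
        frameDensity (A - Aᵀ) (r + j) -
      ∑ j ∈ Finset.range (n + 1),
        eulerCoeff (Fintype.card F) j / (Fintype.card F : ℝ) ^ (r * j)| ≤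
      (n + 1) * (4 * (Fintype.card F : ℝ) ^ (r + 1).choose 2 /
        (Fintype.card F : ℝ) ^ (A - Aᵀ).rank) := by
  have hq : (2 : ℝ) ≤ Fintype.card F := by exact_mod_cast Fintype.one_lt_card
  have hchoose (j : ℕ) : (r + j + 1).choose 2 = (r + 1).choose 2 + (j + 1).choose 2 + r * j := by
    have h1 := two_mul_choose_succ_two (r + j)
    have h2 := two_mul_choose_succ_two r
    have h3 := two_mul_choose_succ_two j
    zify
    push_cast at h1 ⊢
    linarith
  rw [← Finset.sum_sub_distrib]
  refine (Finset.abs_sum_le_sum_abs _ _).trans ((Finset.sum_le_card_nsmul _ _ (4 *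
    (Fintype.card F : ℝ) ^ (r + 1).choose 2 / (Fintype.card F : ℝ) ^ (A - Aᵀ).rank)
    fun j _ => ?_).trans_eq ?_)
  · rw [← mul_sub_one, abs_mul, abs_div,
      abs_of_pos (show 0 < (Fintype.card F : ℝ) ^ (r * j) by positivity)]
    calc _ ≤ 4 / (Fintype.card F : ℝ) ^ (j + 1).choose 2 / (Fintype.card F : ℝ) ^ (r * j) *
          ((Fintype.card F : ℝ) ^ (r + j + 1).choose 2 /
            (Fintype.card F : ℝ) ^ (A - Aᵀ).rank) := by
          gcongr
          · exact abs_eulerCoeff_le hq j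
          · exact abs_frameDensity_sub_one_le A (r + j)
      _ = _ := by
          rw [hchoose, pow_add, pow_add]
          field_simp
  · rw [Finset.card_range, nsmul_eq_mul]
    push_cast
    ring

theorem card_GL_eq_prod [Fintype F] (r : ℕ) : (Nat.card (GL (Fin r) F) : ℝ) =
    ∏ i ∈ Finset.range r, ((Fintype.card F : ℝ) ^ r - (Fintype.card F : ℝ) ^ i) := by
  rw [Matrix.card_GL_field, ← Fin.prod_univ_eq_prod_range, Nat.cast_prod]
  refine Finset.prod_congr rfl fun i _ => ?_
  rw [Nat.cast_sub (Nat.pow_le_pow_right Fintype.card_pos i.2.le)]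
  push_cast
  rfl

end CSymmetric

/-- **Corank distribution of random `C`-symmetric matrices.**  For every finite field `F_ℓ`
and integer `r ≥ 0` there is a constant `K` such that for every `n ≥ 1` and every `n×n`
alternating matrix `C` of rank `c`, the probability that a uniformly random `C`-symmetric
matrix has `r`-dimensional kernel differs from `μ_{CL,ℓ}(r)` by at most `K·n·ℓ^{-c}`. -/
theorem cSymmetric_corank_distribution (F : Type) [Field F] [Fintype F]
    (ℓ r : ℕ) (hℓ : Fintype.card F = ℓ) :
    ∃ K : ℝ, ∀ n : ℕ, 1 ≤ n → ∀ c : ℕ, ∀ C : Matrix (Fin n) (Fin n) F,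
      Cᵀ = -C → (∀ i, C i i = 0) → C.rank = c →
      |(Nat.card {M : Matrix (Fin n) (Fin n) F //
            M - Mᵀ = C ∧ Module.finrank F (LinearMap.ker M.mulVecLin) = r} : ℝ) /
          (ℓ : ℝ) ^ (n * (n + 1) / 2) -
        muCL F r|
      ≤ K * n * (ℓ : ℝ) ^ (-(c : ℤ)) := by
  subst hℓ
  have hq : (2 : ℝ) ≤ Fintype.card F := by exact_mod_cast Fintype.one_lt_card
  refine ⟨8 * (Fintype.card F : ℝ) ^ (r + 1).choose 2 + 4, ?_⟩
  rintro n hn c C hC hd rfl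
  obtain ⟨A, rfl⟩ := CSymmetric.exists_eq_sub_transpose hC hd
  have hG : 1 ≤ (Nat.card (GL (Fin r) F) : ℝ) := by exact_mod_cast Nat.card_pos
  have hcard := CSymmetric.card_corank_mul A r
  rw [← CSymmetric.card_GL_eq_prod] at hcard
  have htri : n * (n + 1) / 2 = (n + 1).choose 2 := by
    rw [Nat.choose_two_right, Nat.add_sub_cancel, mul_comm]
  have hmain := CSymmetric.abs_sum_frameDensity_sub_le A r
  have htail := CSymmetric.abs_sum_sub_tsum_eulerCoeff_le hq r n
  rw [htri, muCL, ← CSymmetric.tsum_eulerCoeff hq, eq_div_iff (by positivity) |>.mpr hcard]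
  have hrank : 4 * (1 / (Fintype.card F : ℝ)) ^ n ≤ 4 / (Fintype.card F : ℝ) ^ (A - Aᵀ).rank := by
    rw [one_div, inv_pow, ← div_eq_mul_inv]
    gcongr
    · linarith
    · simpa using (A - Aᵀ).rank_le_card_width
  set G : ℝ := (Nat.card (GL (Fin r) F) : ℝ)
  set S := ∑ j ∈ Finset.range (n + 1), CSymmetric.eulerCoeff (Fintype.card F) j /
    (Fintype.card F : ℝ) ^ (r * j) * CSymmetric.frameDensity (A - Aᵀ) (r + j)
  set T := ∑' j, CSymmetric.eulerCoeff (Fintype.card F) j / (Fintype.card F : ℝ) ^ (r * j)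
  have hn' : (1 : ℝ) ≤ n := by exact_mod_cast hn
  have hdiff : |S - T| ≤ (n + 1) * (4 * (Fintype.card F : ℝ) ^ (r + 1).choose 2 /
      (Fintype.card F : ℝ) ^ (A - Aᵀ).rank) + 4 / (Fintype.card F : ℝ) ^ (A - Aᵀ).rank :=
    (abs_sub_le _ _ _).trans (add_le_add hmain (htail.trans hrank))
  have hdiv : S * (Fintype.card F : ℝ) ^ (n + 1).choose 2 / G /
      (Fintype.card F : ℝ) ^ (n + 1).choose 2 - G⁻¹ * T = (S - T) / G := by
    field_simp
  rw [hdiv, abs_div, abs_of_pos (by linarith : 0 < G), _root_.zpow_neg, zpow_natCast]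
  refine (div_le_self (abs_nonneg _) hG).trans (hdiff.trans ?_)
  calc _ = ((n + 1) * (4 * (Fintype.card F : ℝ) ^ (r + 1).choose 2) + 1 * 4) *
        ((Fintype.card F : ℝ) ^ (A - Aᵀ).rank)⁻¹ := by ring
    _ ≤ ((n + n) * (4 * (Fintype.card F : ℝ) ^ (r + 1).choose 2) + n * 4) *
        ((Fintype.card F : ℝ) ^ (A - Aᵀ).rank)⁻¹ := by gcongr
    _ = _ := by ring
end

section
/- For every prime power ℓ and integer r ≥ 0 there is a constant K = K(ℓ, r) such that for every n > r, a uniformly random symmetric n×n matrix M over F_ℓ satisfies |P[dim ker M = r] − μ_{S,ℓ}(r)| ≤ K · ℓ^{−n}, where μ_{S,ℓ}(r) := (ℓ^{r(r−1)/2}/#GL_r(F_ℓ)) · ∏_{k=0}^∞ (1 − ℓ^{−2k−1}). Equivalently, |#{M symmetric n×n over F_ℓ : dim ker M = r}/ℓ^{n(n+1)/2} − μ_{S,ℓ}(r)| ≤ K · ℓ^{−n}. -/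
open Matrix

/-- The symmetric-matrix corank measure
`μ_{S,ℓ}(r) = (ℓ^{r(r-1)/2}/#GL_r(F_ℓ)) · ∏_{k=0}^∞ (1 - ℓ^{-2k-1})`, the limiting corank
distribution of large uniformly random symmetric matrices over a field with `ℓ` elements. -/
noncomputable def muS (F : Type) [Field F] [Fintype F] (r : ℕ) : ℝ :=
  ((Fintype.card F : ℝ) ^ (r * (r - 1) / 2) / (Nat.card (GL (Fin r) F) : ℝ)) *
    ∏' k : ℕ, (1 - ((Fintype.card F : ℝ) ^ (2 * k + 1))⁻¹)

/-- The square matrix obtained from `M` by adding a zeroth row `(a, v)` and column `(a, v)`. -/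
def border {R : Type*} {n : ℕ} (M : Matrix (Fin n) (Fin n) R) (v : Fin n → R) (a : R) :
    Matrix (Fin (n + 1)) (Fin (n + 1)) R :=
  Matrix.of (Fin.cons (Fin.cons a v) fun i => Fin.cons (v i) (M i))

/-- The dimension of the kernel of a square matrix. -/
noncomputable def corank {F : Type*} [Field F] {n : ℕ} (M : Matrix (Fin n) (Fin n) F) : ℕ :=
  Module.finrank F (LinearMap.ker M.mulVecLin)

section Border

variable {F : Type*} [Field F] {n : ℕ} {M : Matrix (Fin n) (Fin n) F} {v : Fin n → F} {a : F}

lemma border_mulVec_cons (M : Matrix (Fin n) (Fin n) F) (v : Fin n → F) (a c : F)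
    (y : Fin n → F) :
    border M v a *ᵥ (Fin.cons c y : Fin (n + 1) → F) =
      Fin.cons (a * c + v ⬝ᵥ y) (c • v + M *ᵥ y) := by
  ext i
  refine Fin.cases ?_ (fun i => ?_) i
  · simp [border, mulVec, dotProduct, Fin.sum_univ_succ]
  · simp [border, mulVec, dotProduct, Fin.sum_univ_succ, mul_comm]

lemma border_mulVec_cons_eq_zero {c : F} {y : Fin n → F} :
    border M v a *ᵥ (Fin.cons c y : Fin (n + 1) → F) = 0 ↔
      a * c + v ⬝ᵥ y = 0 ∧ c • v + M *ᵥ y = 0 := by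
  rw [border_mulVec_cons, funext_iff, Fin.forall_fin_succ, funext_iff]
  rfl

/-- If every kernel vector of the bordered matrix has zeroth coordinate zero, its kernel consists
of the kernel vectors of `M` orthogonal to `v`. -/
lemma corank_border_eq_finrank_inf
    (h : ∀ c y, a * c + v ⬝ᵥ y = 0 → c • v + M *ᵥ y = 0 → c = 0) :
    corank (border M v a) =
      Module.finrank F
        ↥(LinearMap.ker M.mulVecLin ⊓ LinearMap.ker (dotProductEquiv F (Fin n) v)) := by
  let j : (Fin n → F) →ₗ[F] (Fin (n + 1) → F) :=
    (Fin.consLinearEquiv F fun _ : Fin (n + 1) => F).toLinearMap ∘ₗ LinearMap.inr F F (Fin n → F)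
  have hj : Function.Injective j :=
    (Fin.consLinearEquiv F fun _ : Fin (n + 1) => F).injective.comp LinearMap.inr_injective
  have hjy (y : Fin n → F) : j y = Fin.cons 0 y := rfl
  rw [corank, (Submodule.equivMapOfInjective j hj _).finrank_eq]
  suffices h : LinearMap.ker (border M v a).mulVecLin = Submodule.map j
      (LinearMap.ker M.mulVecLin ⊓ LinearMap.ker (dotProductEquiv F (Fin n) v)) by rw [h]
  ext x
  refine Fin.consCases (fun c y => ?_) x
  simp only [LinearMap.mem_ker, mulVecLin_apply, border_mulVec_cons_eq_zero, Submodule.mem_map,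
    Submodule.mem_inf, hjy, dotProductEquiv_apply_apply]
  constructor
  · rintro ⟨h1, h2⟩
    obtain rfl := h c y h1 h2
    exact ⟨y, by simpa [and_comm] using And.intro h1 h2, rfl⟩
  · rintro ⟨z, hz, hzy⟩
    obtain ⟨rfl, rfl⟩ := Fin.cons_inj.1 hzy
    simpa [and_comm] using hz

/-- The kernel and range of a symmetric matrix are orthogonal. -/
lemma mulVec_dotProduct_eq_zero (hM : M = Mᵀ) (w : Fin n → F) {y : Fin n → F}
    (hy : M *ᵥ y = 0) : (M *ᵥ w) ⬝ᵥ y = 0 := by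
  rw [hM, mulVec_transpose, ← dotProduct_mulVec, hy, dotProduct_zero]

lemma corank_border_mulVec_of_ne (hM : M = Mᵀ) (w : Fin n → F) (ha : a ≠ (M *ᵥ w) ⬝ᵥ w) :
    corank (border M (M *ᵥ w) a) = corank M := by
  rw [corank_border_eq_finrank_inf, corank]
  · rw [inf_eq_left.2]
    intro y hy
    simpa using mulVec_dotProduct_eq_zero hM w hy
  · intro c y h1 h2
    rw [← mulVec_smul, ← mulVec_add] at h2
    have h3 := mulVec_dotProduct_eq_zero hM w h2
    rw [dotProduct_add, dotProduct_smul, smul_eq_mul] at h3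
    have : (a - (M *ᵥ w) ⬝ᵥ w) * c = 0 := by linear_combination h1 - h3
    exact (mul_eq_zero.1 this).resolve_left (sub_ne_zero.2 ha)

lemma corank_border_mulVec_of_eq (hM : M = Mᵀ) (w : Fin n → F) :
    corank (border M (M *ᵥ w) ((M *ᵥ w) ⬝ᵥ w)) = corank M + 1 := by
  let j : F × LinearMap.ker M.mulVecLin →ₗ[F] (Fin (n + 1) → F) :=
    (Fin.consLinearEquiv F fun _ : Fin (n + 1) => F).toLinearMap ∘ₗ
      (LinearMap.fst F _ _).prod
        ((LinearMap.ker M.mulVecLin).subtype ∘ₗ LinearMap.snd F _ _ -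
          LinearMap.toSpanSingleton F _ w ∘ₗ LinearMap.fst F _ _)
  have hjy (p) : j p = Fin.cons p.1 ((p.2 : Fin n → F) - p.1 • w) := rfl
  have hj : Function.Injective j := by
    rintro ⟨c, y⟩ ⟨d, z⟩ h
    simp only [hjy] at h
    obtain ⟨rfl, h⟩ := Fin.cons_inj.1 h
    exact Prod.ext rfl (Subtype.ext (sub_left_injective h))
  have hk : LinearMap.ker (border M (M *ᵥ w) ((M *ᵥ w) ⬝ᵥ w)).mulVecLin = LinearMap.range j := by
    ext x
    refine Fin.consCases (fun c y => ?_) x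
    simp only [LinearMap.mem_ker, mulVecLin_apply, border_mulVec_cons_eq_zero, LinearMap.mem_range,
      hjy]
    constructor
    · rintro ⟨-, h2⟩
      rw [← mulVec_smul, ← mulVec_add] at h2
      exact ⟨(c, ⟨c • w + y, h2⟩), by simp⟩
    · rintro ⟨⟨d, z, hz⟩, hzy⟩
      obtain ⟨rfl, rfl⟩ := Fin.cons_inj.1 hzy
      have hz : M *ᵥ z = 0 := hz
      simp [mulVec_sub, mulVec_smul, hz, dotProduct_sub, mulVec_dotProduct_eq_zero hM w hz, mul_comm]
  rw [corank, hk, LinearMap.finrank_range_of_inj hj, Module.finrank_prod, Module.finrank_self,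
    corank, add_comm]

lemma corank_border_of_notMem_range (hM : M = Mᵀ) (hv : v ∉ LinearMap.range M.mulVecLin) :
    corank (border M v a) + 1 = corank M := by
  rw [corank_border_eq_finrank_inf, corank]
  · let f : Module.Dual F (LinearMap.ker M.mulVecLin) :=
      (dotProductEquiv F (Fin n) v).domRestrict _
    have hf : f ≠ 0 := by
      intro hf
      obtain ⟨g, hgv, hg⟩ := Submodule.exists_le_ker_of_notMem hv
      obtain ⟨y, rfl⟩ := (dotProductEquiv F (Fin n)).surjective g
      have hy : M *ᵥ y = 0 := by
        refine dotProduct_eq_zero _ fun z => ?_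
        have := hg (LinearMap.mem_range_self M.mulVecLin z)
        rw [LinearMap.mem_ker, dotProductEquiv_apply_apply, mulVecLin_apply, dotProduct_mulVec] at this
        rwa [hM, mulVec_transpose]
      have := LinearMap.congr_fun hf ⟨y, hy⟩
      exact hgv (by simpa [f, dotProduct_comm] using this)
    rw [← Module.Dual.finrank_ker_add_one_of_ne_zero hf, LinearMap.ker_domRestrict,
      ((LinearMap.ker M.mulVecLin).equivSubtypeMap _).finrank_eq, Submodule.map_comap_subtype]
  · intro c y _ h2
    by_contra hc
    refine hv ⟨-(c⁻¹ • y), ?_⟩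
    have : M *ᵥ y = -(c • v) := by rw [eq_neg_iff_add_eq_zero, add_comm, h2]
    simp [mulVec_neg, mulVec_smul, this, hc]

end Border

section Counting

variable {F : Type*} [Field F] [Fintype F] {n : ℕ}

lemma card_range_mulVecLin (M : Matrix (Fin n) (Fin n) F)
    [DecidablePred (· ∈ LinearMap.range M.mulVecLin)] :
    ((Finset.univ.filter (· ∈ LinearMap.range M.mulVecLin)).card : ℝ) =
      (Fintype.card F : ℝ) ^ n * (Fintype.card F : ℝ)⁻¹ ^ corank M := by
  have hq : (Fintype.card F : ℝ) ≠ 0 := by simp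
  rw [← Fintype.card_subtype, ← Nat.card_eq_fintype_card]
  change ((Nat.card (LinearMap.range M.mulVecLin) : ℕ) : ℝ) = _
  rw [Module.natCard_eq_pow_finrank (K := F), Nat.card_eq_fintype_card, Nat.cast_pow, corank]
  have h := LinearMap.finrank_range_add_finrank_ker M.mulVecLin
  rw [Module.finrank_fin_fun] at h
  rw [show (Fintype.card F : ℝ) ^ n = (Fintype.card F : ℝ) ^ (_ + _) from congrArg _ h.symm,
    pow_add, mul_assoc, ← mul_pow, mul_inv_cancel₀ hq, one_pow, mul_one]

/-- Borders of a symmetric matrix of corank `k` have corank `k`, `k + 1`, `k - 1` in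
proportions `x ^ k * (1 - x)`, `x ^ k * x`, `1 - x ^ k`, where `x = 1 / #F`. -/
lemma sum_corank_border {M : Matrix (Fin n) (Fin n) F} (hM : M = Mᵀ) (f : ℕ → ℝ) :
    ∑ v, ∑ a, f (corank (border M v a)) =
      (Fintype.card F : ℝ) ^ (n + 1) *
        ((Fintype.card F : ℝ)⁻¹ ^ corank M * ((1 - (Fintype.card F : ℝ)⁻¹) * f (corank M) +
          (Fintype.card F : ℝ)⁻¹ * f (corank M + 1)) +
        (1 - (Fintype.card F : ℝ)⁻¹ ^ corank M) * f (corank M - 1)) := by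
  classical
  have hq : (Fintype.card F : ℝ) ≠ 0 := by simp
  have key (v : Fin n → F) : ∑ a, f (corank (border M v a)) =
      if v ∈ LinearMap.range M.mulVecLin then
        ((Fintype.card F : ℝ) - 1) * f (corank M) + f (corank M + 1)
      else (Fintype.card F : ℝ) * f (corank M - 1) := by
    split_ifs with hv
    · obtain ⟨w, rfl⟩ := hv
      rw [mulVecLin_apply, ← Finset.add_sum_erase _ _ (Finset.mem_univ ((M *ᵥ w) ⬝ᵥ w)),
        corank_border_mulVec_of_eq hM, Finset.sum_congr rfl fun a ha => by
          rw [corank_border_mulVec_of_ne hM w (Finset.ne_of_mem_erase ha)],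
        Finset.sum_const, Finset.card_erase_of_mem (Finset.mem_univ _), Finset.card_univ,
        nsmul_eq_mul, Nat.cast_sub Fintype.card_pos, Nat.cast_one, add_comm]
    · have h (a : F) : corank (border M v a) = corank M - 1 := by
        have := corank_border_of_notMem_range (a := a) hM hv
        omega
      simp [h]
  have hc := Finset.card_filter_add_card_filter_not (s := (Finset.univ : Finset (Fin n → F)))
    (· ∈ LinearMap.range M.mulVecLin)
  replace hc := congrArg (Nat.cast : ℕ → ℝ) hc
  rw [Nat.cast_add, card_range_mulVecLin, Finset.card_univ, Fintype.card_fun, Fintype.card_fin,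
    Nat.cast_pow, ← eq_sub_iff_add_eq'] at hc
  rw [Finset.sum_congr rfl fun v _ => key v, Finset.sum_ite, Finset.sum_const, Finset.sum_const,
    nsmul_eq_mul, nsmul_eq_mul, card_range_mulVecLin, hc]
  field_simp
  ring

lemma border_eq_transpose_iff {R : Type*} {M : Matrix (Fin n) (Fin n) R} {v : Fin n → R} {a : R} :
    border M v a = (border M v a)ᵀ ↔ M = Mᵀ := by
  simp only [← Matrix.ext_iff, Fin.forall_fin_succ, border, transpose_apply, of_apply,
    Fin.cons_zero, Fin.cons_succ]
  simp

lemma border_submatrix {R : Type*} {M : Matrix (Fin (n + 1)) (Fin (n + 1)) R} (hM : M = Mᵀ) :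
    border (M.submatrix Fin.succ Fin.succ) (fun i => M 0 i.succ) (M 0 0) = M := by
  ext i j
  refine Fin.cases ?_ (fun i => ?_) i <;> refine Fin.cases ?_ (fun j => ?_) j
  · rfl
  · rfl
  · conv_rhs => rw [hM]
    rfl
  · rfl

open Classical in
lemma sum_symmetric_succ {F : Type*} [Fintype F] (g : Matrix (Fin (n + 1)) (Fin (n + 1)) F → ℝ) :
    ∑ M with M = Mᵀ, g M =
      ∑ M : Matrix (Fin n) (Fin n) F with M = Mᵀ, ∑ v, ∑ a, g (border M v a) := by
  simp_rw [← Finset.sum_product']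
  refine Finset.sum_nbij'
    (fun M => (M.submatrix Fin.succ Fin.succ, fun i => M 0 i.succ, M 0 0))
    (fun p => border p.1 p.2.1 p.2.2) ?_ ?_ ?_ ?_ ?_
  · intro M hM
    have hM : M = Mᵀ := by simpa using hM
    rw [← border_submatrix hM, border_eq_transpose_iff] at hM
    simpa using hM
  · rintro ⟨M, v, a⟩ hM
    simpa [border_eq_transpose_iff] using hM
  · intro M hM
    exact border_submatrix (by simpa using hM)
  · rintro ⟨M, v, a⟩ -
    rfl
  · intro M hM
    rw [border_submatrix (by simpa using hM)]

variable (F n) in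
/-- The probability that a uniformly random symmetric matrix has corank `r`, where `r` is allowed
to be negative. -/
noncomputable def corankProb (r : ℤ) : ℝ :=
  (Nat.card {M : Matrix (Fin n) (Fin n) F // M = Mᵀ ∧ (corank M : ℤ) = r} : ℝ) /
    (Fintype.card F : ℝ) ^ (n * (n + 1) / 2)

open Classical in
lemma corankProb_eq_sum (r : ℤ) :
    corankProb F n r = (∑ M : Matrix (Fin n) (Fin n) F with M = Mᵀ,
      if (corank M : ℤ) = r then (1 : ℝ) else 0) / (Fintype.card F : ℝ) ^ (n * (n + 1) / 2) := by
  rw [corankProb, Nat.card_eq_fintype_card, Fintype.card_subtype, Finset.sum_boole,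
    Finset.filter_filter]

lemma corankProb_zero (r : ℤ) : corankProb F 0 r = if r = 0 then 1 else 0 := by
  classical
  have h (M : Matrix (Fin 0) (Fin 0) F) : corank M = 0 := Module.finrank_zero_of_subsingleton
  have h' (M : Matrix (Fin 0) (Fin 0) F) : M = Mᵀ := Subsingleton.elim _ _
  have hc : Fintype.card (Matrix (Fin 0) (Fin 0) F) = 1 :=
    Fintype.card_eq_one_iff.2 ⟨0, fun M => Subsingleton.elim _ _⟩
  simp [corankProb_eq_sum, h, ← h', eq_comm, hc]

lemma corankProb_succ (r : ℤ) :
    corankProb F (n + 1) r =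
      (Fintype.card F : ℝ)⁻¹ ^ r * (1 - (Fintype.card F : ℝ)⁻¹) * corankProb F n r +
      (Fintype.card F : ℝ)⁻¹ ^ r * corankProb F n (r - 1) +
      (1 - (Fintype.card F : ℝ)⁻¹ ^ (r + 1)) * corankProb F n (r + 1) := by
  classical
  have hq : (Fintype.card F : ℝ) ≠ 0 := by simp
  have he : (n + 1) * (n + 1 + 1) / 2 = n * (n + 1) / 2 + (n + 1) := by
    rw [← Nat.add_mul_div_right _ _ two_pos]
    ring_nf
  simp only [corankProb_eq_sum, sum_symmetric_succ, ← mul_div_assoc, ← add_div, Finset.mul_sum,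
    ← Finset.sum_add_distrib]
  rw [he, pow_add, ← div_div, div_right_comm, Finset.sum_div]
  congr 1
  refine Finset.sum_congr rfl fun M hM => ?_
  rw [sum_corank_border (by simpa using hM) fun k => if (k : ℤ) = r then (1 : ℝ) else 0,
    mul_div_cancel_left₀ _ (pow_ne_zero _ hq)]
  generalize corank M = k
  have hx : (Fintype.card F : ℝ)⁻¹ ≠ 0 := inv_ne_zero hq
  generalize (Fintype.card F : ℝ)⁻¹ = x at hx
  have h_same : x ^ k * (if (k : ℤ) = r then 1 else 0) = x ^ r * (if (k : ℤ) = r then 1 else 0) := by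
    split_ifs with h
    · rw [← h, zpow_natCast]
    · simp
  have h_succ : x ^ k * x * (if ((k + 1 : ℕ) : ℤ) = r then 1 else 0) =
      x ^ r * (if (k : ℤ) = r - 1 then 1 else 0) := by
    simp only [Nat.cast_add_one, eq_sub_iff_add_eq]
    split_ifs with h
    · rw [← h, zpow_add_one₀ hx, zpow_natCast]
    · simp
  have h_pred : (1 - x ^ k) * (if ((k - 1 : ℕ) : ℤ) = r then 1 else 0) =
      (1 - x ^ (r + 1)) * (if (k : ℤ) = r + 1 then 1 else 0) := by
    rcases k with _ | k
    · rw [pow_zero, sub_self, zero_mul]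
      split_ifs with h
      · rw [← h, Nat.cast_zero, zpow_zero, sub_self, zero_mul]
      · rw [mul_zero]
    · simp only [add_tsub_cancel_right, Nat.cast_add_one, add_left_inj]
      split_ifs with h
      · rw [← h, zpow_add_one₀ hx, zpow_natCast, pow_succ]
      · simp
  linear_combination (1 - x) * h_same + h_succ + h_pred

end Counting

section ClosedForm

/-- `∏_{i=1}^n (1 - x ^ i)`. -/
def prodOneSub (x : ℝ) (n : ℕ) : ℝ := ∏ i ∈ Finset.range n, (1 - x ^ (i + 1))

/-- `∏_{k < n} (1 - x ^ (2k + 1))`. -/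
def prodOneSubOdd (x : ℝ) (n : ℕ) : ℝ := ∏ k ∈ Finset.range n, (1 - x ^ (2 * k + 1))

/-- `∏_{k=1}^{⌊m/2⌋} (1 - x ^ (2k))⁻¹`, extended by zero to negative `m`. -/
noncomputable def invProdEven (x : ℝ) (m : ℤ) : ℝ :=
  if m < 0 then 0 else ∏ k ∈ Finset.range (m.toNat / 2), (1 - x ^ (2 * (k + 1)))⁻¹

/-- `x ^ (r (r + 1) / 2) / ∏_{i=1}^r (1 - x ^ i)`, extended by zero to negative `r`. -/
noncomputable def corankCoeff (x : ℝ) (r : ℤ) : ℝ :=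
  if r < 0 then 0 else x ^ (r.toNat * (r.toNat + 1) / 2) / prodOneSub x r.toNat

variable {x : ℝ}

lemma invProdEven_of_neg {m : ℤ} (hm : m < 0) : invProdEven x m = 0 := if_pos hm

lemma invProdEven_natCast (m : ℕ) :
    invProdEven x m = ∏ k ∈ Finset.range (m / 2), (1 - x ^ (2 * (k + 1)))⁻¹ := by
  simp [invProdEven]

lemma corankCoeff_of_neg {r : ℤ} (hr : r < 0) : corankCoeff x r = 0 := if_pos hr

lemma corankCoeff_natCast (r : ℕ) :
    corankCoeff x r = x ^ (r * (r + 1) / 2) / prodOneSub x r := by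
  simp [corankCoeff]

lemma one_sub_pow_pos (h0 : 0 < x) (h1 : x < 1) {k : ℕ} (hk : k ≠ 0) : 0 < 1 - x ^ k :=
  sub_pos.2 (pow_lt_one₀ h0.le h1 hk)

lemma prodOneSub_succ (x : ℝ) (n : ℕ) :
    prodOneSub x (n + 1) = prodOneSub x n * (1 - x ^ (n + 1)) :=
  Finset.prod_range_succ _ _

lemma prodOneSub_pos (h0 : 0 < x) (h1 : x < 1) (n : ℕ) : 0 < prodOneSub x n :=
  Finset.prod_pos fun i _ => one_sub_pow_pos h0 h1 i.succ_ne_zero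

lemma corankCoeff_add_one (h0 : 0 < x) (h1 : x < 1) (r : ℤ) :
    corankCoeff x (r + 1) * (1 - x ^ (r + 1)) = corankCoeff x r * x ^ (r + 1) := by
  rcases lt_or_ge r 0 with hr | hr
  · rw [corankCoeff_of_neg hr, zero_mul]
    rcases (show r + 1 ≤ 0 by omega).lt_or_eq with h | h
    · rw [corankCoeff_of_neg h, zero_mul]
    · simp [h]
  · lift r to ℕ using hr
    have hp := (prodOneSub_pos h0 h1 r).ne'
    have hk := (one_sub_pow_pos h0 h1 r.succ_ne_zero).ne'
    have he : (r + 1) * (r + 1 + 1) / 2 = r * (r + 1) / 2 + (r + 1) := by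
      rw [← Nat.add_mul_div_right _ _ two_pos]
      ring_nf
    rw [← Nat.cast_add_one, corankCoeff_natCast, corankCoeff_natCast, zpow_natCast, prodOneSub_succ,
      he, pow_add]
    field_simp

lemma invProdEven_add_one (h0 : 0 < x) (h1 : x < 1) (m : ℤ) :
    (1 - x ^ (m + 1)) * invProdEven x (m + 1) =
      (1 - x) * invProdEven x m + x * invProdEven x (m - 1) := by
  rcases lt_or_ge m 0 with hm | hm
  · rw [invProdEven_of_neg hm, invProdEven_of_neg (show m - 1 < 0 by omega)]
    rcases (show m + 1 ≤ 0 by omega).lt_or_eq with h | h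
    · simp [invProdEven_of_neg h]
    · simp [h]
  · lift m to ℕ using hm
    obtain ⟨k, rfl | rfl⟩ := m.even_or_odd'
    · have h_succ : invProdEven x ((2 * k : ℕ) + 1) = invProdEven x (2 * k : ℕ) := by
        rw [← Nat.cast_add_one, invProdEven_natCast, invProdEven_natCast]
        congr 2
        omega
      have h_pred : invProdEven x ((2 * k : ℕ) - 1) =
          (1 - x ^ (2 * k)) * invProdEven x (2 * k : ℕ) := by
        rcases k with _ | k
        · simp [invProdEven_of_neg]
        · have hk := (one_sub_pow_pos h0 h1 (show 2 * (k + 1) ≠ 0 by omega)).ne'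
          rw [show ((2 * (k + 1) : ℕ) : ℤ) - 1 = (2 * k + 1 : ℕ) by push_cast; ring,
            invProdEven_natCast, invProdEven_natCast, show 2 * (k + 1) / 2 = k + 1 by omega,
            show (2 * k + 1) / 2 = k by omega, Finset.prod_range_succ]
          field_simp
      rw [h_succ, h_pred, ← Nat.cast_add_one, zpow_natCast]
      ring
    · have hk := (one_sub_pow_pos h0 h1 (show 2 * (k + 1) ≠ 0 by omega)).ne'
      rw [show ((2 * k + 1 : ℕ) : ℤ) + 1 = (2 * (k + 1) : ℕ) by push_cast; ring,
        show ((2 * k + 1 : ℕ) : ℤ) - 1 = (2 * k : ℕ) by push_cast; ring,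
        invProdEven_natCast, invProdEven_natCast, invProdEven_natCast,
        show 2 * (k + 1) / 2 = k + 1 by omega, show (2 * k + 1) / 2 = k by omega,
        show 2 * k / 2 = k by omega, Finset.prod_range_succ, zpow_natCast]
      field_simp
      ring

lemma prodOneSub_mul_invProdEven (h0 : 0 < x) (h1 : x < 1) (m : ℕ) :
    prodOneSub x m * invProdEven x m = prodOneSubOdd x ((m + 1) / 2) := by
  induction m with
  | zero => simp [prodOneSub, invProdEven, prodOneSubOdd]
  | succ m ih =>
    rw [invProdEven_natCast] at ih ⊢
    rw [prodOneSub_succ]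
    obtain ⟨k, rfl | rfl⟩ := m.even_or_odd'
    · rw [show (2 * k + 1) / 2 = k by omega, show 2 * k / 2 = k by omega] at ih
      rw [show (2 * k + 1) / 2 = k by omega, show (2 * k + 1 + 1) / 2 = k + 1 by omega,
        prodOneSubOdd, Finset.prod_range_succ, ← prodOneSubOdd, ← ih]
      ring
    · have hk := (one_sub_pow_pos h0 h1 (show 2 * (k + 1) ≠ 0 by omega)).ne'
      rw [show (2 * k + 1 + 1) / 2 = k + 1 by omega, show (2 * k + 1) / 2 = k by omega] at ih
      rw [show (2 * k + 1 + 1 + 1) / 2 = k + 1 by omega, show (2 * k + 1 + 1) / 2 = k + 1 by omega,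
        Finset.prod_range_succ, ← ih, show 2 * k + 1 + 1 = 2 * (k + 1) by ring]
      field_simp

variable (F : Type*) [Field F] [Fintype F]

lemma inv_card_pos : 0 < (Fintype.card F : ℝ)⁻¹ := by
  simpa using Fintype.card_pos

lemma inv_card_lt_one : (Fintype.card F : ℝ)⁻¹ < 1 :=
  inv_lt_one_of_one_lt₀ (by exact_mod_cast Fintype.one_lt_card)

/-- The exact corank distribution of a uniformly random symmetric matrix. -/
lemma corankProb_eq (n : ℕ) (r : ℤ) :
    corankProb F n r = corankCoeff (Fintype.card F : ℝ)⁻¹ r * prodOneSub (Fintype.card F : ℝ)⁻¹ n *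
      invProdEven (Fintype.card F : ℝ)⁻¹ (n - r) := by
  have h0 := inv_card_pos F
  have h1 := inv_card_lt_one F
  induction n generalizing r with
  | zero =>
    rw [corankProb_zero]
    rcases lt_trichotomy r 0 with hr | rfl | hr
    · simp [corankCoeff_of_neg hr, hr.ne]
    · simp [corankCoeff, prodOneSub, invProdEven]
    · rw [invProdEven_of_neg (by simpa using hr), mul_zero, if_neg hr.ne']
  | succ n ih =>
    rw [corankProb_succ, ih, ih, ih, prodOneSub_succ]
    generalize (Fintype.card F : ℝ)⁻¹ = x at *
    have h_pred := corankCoeff_add_one h0 h1 (r - 1)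
    have h_succ := corankCoeff_add_one h0 h1 r
    have h_inv := invProdEven_add_one h0 h1 (n - r)
    have hn : x ^ (n + 1) = x ^ r * x ^ ((n : ℤ) - r + 1) := by
      rw [← zpow_add₀ h0.ne', ← zpow_natCast]
      congr 1
      push_cast
      ring
    rw [sub_add_cancel] at h_pred
    rw [zpow_add_one₀ h0.ne'] at h_succ
    rw [zpow_add_one₀ h0.ne' r, hn, show (n : ℤ) - (r - 1) = n - r + 1 by ring,
      show (n : ℤ) - (r + 1) = n - r - 1 by ring,
      show ((n + 1 : ℕ) : ℤ) - r = n - r + 1 by push_cast; ring]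
    linear_combination prodOneSub x n * (invProdEven x (n - r - 1) * h_succ -
      invProdEven x (n - r + 1) * h_pred - x ^ r * corankCoeff x r * h_inv)

end ClosedForm

section Limit

variable {x : ℝ}

lemma prodOneSub_sub_le (h0 : 0 < x) (h1 : x < 1) (m r : ℕ) :
    |prodOneSub x (m + r) - prodOneSub x m| ≤ prodOneSub x m * (r * x ^ m) := by
  have key : prodOneSub x (m + r) ≤ prodOneSub x m ∧
      prodOneSub x m * (1 - r * x ^ m) ≤ prodOneSub x (m + r) := by
    have hm := prodOneSub_pos h0 h1 m
    induction r with
    | zero => simp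
    | succ r ih =>
      have hp := prodOneSub_pos h0 h1 (m + r)
      have hx : x ^ (m + r + 1) ≤ x ^ m := pow_le_pow_of_le_one h0.le h1.le (by omega)
      have hx0 : 0 < x ^ (m + r + 1) := pow_pos h0 _
      rw [← add_assoc, prodOneSub_succ]
      push_cast
      have h := mul_le_mul ih.1 hx hx0.le hm.le
      exact ⟨(mul_le_of_le_one_right hp.le (by linarith)).trans ih.1, by linarith [ih.2]⟩
  rw [abs_le]
  constructor <;> nlinarith [mul_nonneg (prodOneSub_pos h0 h1 m).le
    (mul_nonneg r.cast_nonneg (pow_pos h0 m).le : (0 : ℝ) ≤ r * x ^ m)]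

lemma prodOneSubOdd_mem (h0 : 0 < x) (h1 : x < 1) (k : ℕ) :
    0 ≤ prodOneSubOdd x k ∧ prodOneSubOdd x k ≤ 1 := by
  have h (i : ℕ) := one_sub_pow_pos h0 h1 (2 * i).succ_ne_zero
  exact ⟨Finset.prod_nonneg fun i _ => (h i).le, Finset.prod_le_one (fun i _ => (h i).le)
    fun i _ => sub_le_self _ (pow_pos h0 _).le⟩

lemma tendsto_prodOneSubOdd (h0 : 0 < x) (h1 : x < 1) :
    Filter.Tendsto (prodOneSubOdd x) Filter.atTop (nhds (∏' k : ℕ, (1 - x ^ (2 * k + 1)))) := by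
  have hs : Summable fun k : ℕ => ‖-x ^ (2 * k + 1)‖ := by
    simp_rw [norm_neg, norm_pow, Real.norm_of_nonneg h0.le, pow_succ, pow_mul]
    exact (summable_geometric_of_lt_one (by positivity)
      (pow_lt_one₀ h0.le h1 two_ne_zero)).mul_right x
  have hm := multipliable_one_add_of_summable hs
  simp_rw [← sub_eq_add_neg] at hm
  exact hm.hasProd.tendsto_prod_nat

lemma abs_prodOneSubOdd_sub_tprod_le (h0 : 0 < x) (h1 : x < 1) (k : ℕ) :
    |prodOneSubOdd x k - ∏' k : ℕ, (1 - x ^ (2 * k + 1))| ≤ (x ^ 2) ^ k / (1 - x ^ 2) := by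
  have h := dist_le_of_le_geometric_of_tendsto (x ^ 2) 1 (pow_lt_one₀ h0.le h1 two_ne_zero)
    (fun k => ?_) (tendsto_prodOneSubOdd h0 h1) k
  · simpa [Real.dist_eq] using h
  · obtain ⟨hp0, hp1⟩ := prodOneSubOdd_mem h0 h1 k
    have hx : 0 < x ^ (2 * k + 1) := pow_pos h0 _
    have hx' : x ^ (2 * k + 1) ≤ x ^ (2 * k) := pow_le_pow_of_le_one h0.le h1.le (by omega)
    rw [Real.dist_eq, prodOneSubOdd, prodOneSubOdd, Finset.prod_range_succ, ← prodOneSubOdd,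
      ← pow_mul, one_mul, mul_one_sub, sub_sub_cancel, abs_of_nonneg (by positivity)]
    exact (mul_le_of_le_one_left hx.le hp1).trans hx'

lemma abs_prodOneSub_mul_invProdEven_sub_tprod_le (h0 : 0 < x) (h1 : x < 1) (m r : ℕ) :
    |prodOneSub x (m + r) * invProdEven x m - ∏' k : ℕ, (1 - x ^ (2 * k + 1))| ≤
      (r + (1 - x ^ 2)⁻¹) * x ^ m := by
  have hx2 := one_sub_pow_pos h0 h1 two_ne_zero
  have hinv : 0 ≤ invProdEven x m := by
    rw [invProdEven_natCast]
    exact Finset.prod_nonneg fun i _ =>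
      inv_nonneg.2 (one_sub_pow_pos h0 h1 (by omega : 2 * (i + 1) ≠ 0)).le
  have h_fin : |prodOneSub x (m + r) * invProdEven x m - prodOneSubOdd x ((m + 1) / 2)| ≤
      r * x ^ m := by
    rw [← prodOneSub_mul_invProdEven h0 h1, ← sub_mul, abs_mul, abs_of_nonneg hinv]
    calc _ ≤ prodOneSub x m * (r * x ^ m) * invProdEven x m := by
          gcongr
          exact prodOneSub_sub_le h0 h1 m r
      _ = prodOneSubOdd x ((m + 1) / 2) * (r * x ^ m) := by
          rw [← prodOneSub_mul_invProdEven h0 h1]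
          ring
      _ ≤ r * x ^ m := mul_le_of_le_one_left (by positivity) (prodOneSubOdd_mem h0 h1 _).2
  have h_lim : |prodOneSubOdd x ((m + 1) / 2) - ∏' k : ℕ, (1 - x ^ (2 * k + 1))| ≤
      (1 - x ^ 2)⁻¹ * x ^ m := by
    refine (abs_prodOneSubOdd_sub_tprod_le h0 h1 _).trans ?_
    rw [div_eq_inv_mul, ← pow_mul]
    gcongr ?_ * ?_
    exact pow_le_pow_of_le_one h0.le h1.le (by omega)
  rw [add_mul]
  exact (abs_sub_le _ _ _).trans (add_le_add h_fin h_lim)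

lemma card_GL_mul_inv_pow (F : Type*) [Field F] [Fintype F] (r : ℕ) :
    (Nat.card (GL (Fin r) F) : ℝ) * (Fintype.card F : ℝ)⁻¹ ^ (r * r) =
      prodOneSub (Fintype.card F : ℝ)⁻¹ r := by
  have hq : (Fintype.card F : ℝ) ≠ 0 := by simp
  rw [card_GL_field, Nat.cast_prod, pow_mul]
  rw [← Fin.prod_const r (_ ^ r : ℝ), ← Finset.prod_mul_distrib,
    Fin.prod_univ_eq_prod_range (fun i => ((Fintype.card F ^ r - Fintype.card F ^ i : ℕ) : ℝ) *
      (Fintype.card F : ℝ)⁻¹ ^ r), prodOneSub, ← Finset.prod_range_reflect]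
  refine Finset.prod_congr rfl fun i hi => ?_
  have hi : i < r := Finset.mem_range.1 hi
  rw [Nat.cast_sub (Nat.pow_le_pow_right Fintype.card_pos (by omega)), Nat.cast_pow, Nat.cast_pow,
    sub_mul, ← mul_pow, mul_inv_cancel₀ hq, one_pow]
  congr 1
  rw [inv_pow, inv_pow, ← div_eq_mul_inv, div_eq_iff (by simp),
    ← div_eq_inv_mul, eq_div_iff (by simp), ← pow_add,
    show r - 1 - i + (i + 1) = r by omega]

lemma muS_eq (F : Type) [Field F] [Fintype F] (r : ℕ) :
    muS F r = corankCoeff (Fintype.card F : ℝ)⁻¹ r *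
      ∏' k : ℕ, (1 - (Fintype.card F : ℝ)⁻¹ ^ (2 * k + 1)) := by
  have hq : (Fintype.card F : ℝ) ≠ 0 := by simp
  have hG : (Nat.card (GL (Fin r) F) : ℝ) ≠ 0 := by exact_mod_cast Nat.card_pos.ne'
  have he : r * r = r * (r - 1) / 2 + r * (r + 1) / 2 := by
    rcases r with _ | r
    · rfl
    · rw [add_tsub_cancel_right, mul_comm,
        show (r + 1) * (r + 1 + 1) = (r + 1) * r + (r + 1) * 2 by ring,
        Nat.add_mul_div_right _ _ two_pos]
      have := Nat.div_mul_cancel (Nat.even_mul_succ_self r).two_dvd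
      rw [mul_comm r] at this
      nlinarith
  simp_rw [muS, ← inv_pow]
  congr 1
  rw [corankCoeff_natCast, ← card_GL_mul_inv_pow, he, pow_add, inv_pow, inv_pow]
  field_simp

end Limit

/-- **Effective corank distribution of random symmetric matrices.**  For every finite field
`F_ℓ` and integer `r ≥ 0` there is a constant `K` such that for every `n > r`, the proportion
of symmetric `n×n` matrices over `F_ℓ` with `r`-dimensional kernel (among all `ℓ^{n(n+1)/2}`
symmetric matrices) differs from `μ_{S,ℓ}(r)` by at most `K·ℓ^{-n}`. -/
theorem symmetric_corank_distribution (F : Type) [Field F] [Fintype F]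
    (ℓ r : ℕ) (hℓ : Fintype.card F = ℓ) :
    ∃ K : ℝ, ∀ n : ℕ, r < n →
      |(Nat.card {M : Matrix (Fin n) (Fin n) F //
            M = Mᵀ ∧ Module.finrank F (LinearMap.ker M.mulVecLin) = r} : ℝ) /
          (ℓ : ℝ) ^ (n * (n + 1) / 2) -
        muS F r|
      ≤ K * (ℓ : ℝ) ^ (-(n : ℤ)) := by
  subst hℓ
  have h0 := inv_card_pos F
  have h1 := inv_card_lt_one F
  have hP (n : ℕ) : (Nat.card {M : Matrix (Fin n) (Fin n) F //
      M = Mᵀ ∧ Module.finrank F (LinearMap.ker M.mulVecLin) = r} : ℝ) /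
        (Fintype.card F : ℝ) ^ (n * (n + 1) / 2) = corankProb F n r := by
    simp only [corankProb, corank, Nat.cast_inj]
  simp_rw [hP, corankProb_eq, muS_eq, _root_.zpow_neg, zpow_natCast, ← inv_pow]
  generalize (Fintype.card F : ℝ)⁻¹ = x at *
  refine ⟨|corankCoeff x r| * ((r + (1 - x ^ 2)⁻¹) * (x ^ r)⁻¹), fun n hn => ?_⟩
  obtain ⟨m, rfl⟩ := Nat.exists_eq_add_of_le' hn.le
  rw [show ((m + r : ℕ) : ℤ) - r = m by push_cast; ring, mul_assoc, ← mul_sub, abs_mul, mul_assoc]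
  gcongr
  refine (abs_prodOneSub_mul_invProdEven_sub_tprod_le h0 h1 m r).trans_eq ?_
  rw [pow_add]
  field_simp
end

section
/- Let ℓ be a prime power, F_ℓ a finite field with ℓ elements, n ≥ 1, and let C and C' be n×n alternating matrices over F_ℓ with rank C = rank C'. Then for every integer s, #{M an n×n matrix over F_ℓ : M − Mᵀ = C and rank M = s} = #{M an n×n matrix over F_ℓ : M − Mᵀ = C' and rank M = s}. In other words, the rank distribution of a uniformly random C-symmetric matrix depends only on the rank of C. -/
open Matrix

/-- A nonzero alternating form splits off a hyperbolic plane, with a complement whose restricted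
form has a radical of the same dimension. -/
theorem LinearMap.BilinForm.IsAlt.exists_hyperbolic_splitting {K V : Type*} [Field K]
    [AddCommGroup V] [Module K V] {B : LinearMap.BilinForm K V} (hB : B.IsAlt) (hne : B ≠ 0) :
    ∃ (W : Submodule K V) (e : ((K × K) × W) ≃ₗ[K] V),
      (∀ p q, B (e p) (e q) = p.1.1 * q.1.2 - p.1.2 * q.1.1 + B.restrict W p.2 q.2) ∧
      Module.finrank K (LinearMap.ker (B.restrict W)) = Module.finrank K (LinearMap.ker B) := by
  obtain ⟨x, y, hxy⟩ : ∃ x y, B x y = 1 := by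
    by_contra! h
    refine hne (LinearMap.ext₂ fun x y => ?_)
    by_contra hxy
    exact h x ((B x y)⁻¹ • y) (by simpa using inv_mul_cancel₀ hxy)
  have hyx : B y x = -1 := by rw [← hB.neg_eq, hxy]
  have hxx : B x x = 0 := hB x
  have hyy : B y y = 0 := hB y
  set W : Submodule K V := LinearMap.ker ((B x).prod (B y)) with hW
  have hmem : ∀ {w}, w ∈ W ↔ B x w = 0 ∧ B y w = 0 := by
    intro w
    simp [hW]
  have hmem' : ∀ {w}, w ∈ W → B w x = 0 ∧ B w y = 0 := by
    intro w hw
    rw [← hB.neg_eq x w, ← hB.neg_eq y w, (hmem.1 hw).1, (hmem.1 hw).2]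
    simp
  let f : ((K × K) × W) →ₗ[K] V :=
    ((LinearMap.toSpanSingleton K V x).coprod (LinearMap.toSpanSingleton K V y)).coprod W.subtype
  have hf : ∀ p, f p = p.1.1 • x + p.1.2 • y + (p.2 : V) := fun p => by simp [f]
  have hbij : Function.Bijective f := by
    constructor
    · rw [← LinearMap.ker_eq_bot, LinearMap.ker_eq_bot']
      rintro ⟨⟨a, b⟩, w, hw⟩ h
      rw [hf] at h
      have h1 := congrArg (B x) h
      have h2 := congrArg (B y) h
      simp [hxy, hyx, hxx, hyy, (hmem.1 hw).1, (hmem.1 hw).2] at h1 h2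
      subst h1 h2
      simpa using h
    · intro v
      refine ⟨((-B y v, B x v), ⟨v + B y v • x - B x v • y, hmem.2 ?_⟩), ?_⟩
      · simp [hxy, hyx, hxx, hyy]
      · rw [hf]
        simp only
        module
  refine ⟨W, LinearEquiv.ofBijective f hbij, ?_, ?_⟩
  · rintro ⟨⟨a, b⟩, w, hw⟩ ⟨⟨a', b'⟩, w', hw'⟩
    simp [hf, hxy, hyx, hxx, hyy, (hmem.1 hw').1, (hmem.1 hw').2, (hmem' hw).1, (hmem' hw).2]
    ring
  · have hker : (LinearMap.ker (B.restrict W)).map W.subtype = LinearMap.ker B := by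
      ext v
      simp only [Submodule.mem_map, LinearMap.mem_ker, Submodule.subtype_apply]
      constructor
      · rintro ⟨⟨w, hw⟩, h, rfl⟩
        ext u
        obtain ⟨⟨⟨a, b⟩, u'⟩, rfl⟩ := hbij.2 u
        have := LinearMap.congr_fun h u'
        simp at this
        simp [hf, (hmem' hw).1, (hmem' hw).2, this]
      · intro h
        have hv : v ∈ W := hmem.2 ⟨by rw [← hB.neg_eq, h]; simp, by rw [← hB.neg_eq, h]; simp⟩
        refine ⟨⟨v, hv⟩, ?_, rfl⟩
        ext u
        simp [h]
    rw [← hker]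
    exact (Submodule.equivMapOfInjective _ W.injective_subtype _).finrank_eq

/-- Alternating forms on spaces of the same finite dimension are isometric as soon as their
radicals have the same dimension. -/
theorem LinearMap.BilinForm.IsAlt.exists_isometry {K : Type*} [Field K] {V V' : Type*}
    [AddCommGroup V] [Module K V] [FiniteDimensional K V]
    [AddCommGroup V'] [Module K V'] [FiniteDimensional K V']
    {B : LinearMap.BilinForm K V} {B' : LinearMap.BilinForm K V'} (hB : B.IsAlt) (hB' : B'.IsAlt)
    (hdim : Module.finrank K V = Module.finrank K V')
    (hker : Module.finrank K (LinearMap.ker B) = Module.finrank K (LinearMap.ker B')) :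
    ∃ e : V ≃ₗ[K] V', ∀ x y, B' (e x) (e y) = B x y := by
  induction hd : Module.finrank K V using Nat.strong_induction_on generalizing V V' with
  | _ d ih =>
  have hzero : B = 0 ↔ B' = 0 := by
    rw [← LinearMap.ker_eq_top, ← LinearMap.ker_eq_top]
    constructor <;> intro h <;> apply Submodule.eq_top_of_finrank_eq
    · rw [← hker, h, finrank_top, hdim]
    · rw [hker, h, finrank_top, hdim]
  by_cases h0 : B = 0
  · refine ⟨LinearEquiv.ofFinrankEq V V' hdim, fun x y => ?_⟩
    simp [h0, hzero.1 h0]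
  · obtain ⟨W, e, he, hW⟩ := hB.exists_hyperbolic_splitting h0
    obtain ⟨W', e', he', hW'⟩ := hB'.exists_hyperbolic_splitting (mt hzero.2 h0)
    have h1 := e.finrank_eq
    have h2 := e'.finrank_eq
    simp only [Module.finrank_prod, Module.finrank_self] at h1 h2
    obtain ⟨g, hg⟩ := ih (Module.finrank K W) (by omega) (B := B.restrict W)
      (B' := B'.restrict W') (fun w => hB w) (fun w => hB' w) (by omega)
      (by rw [hW, hW', hker]) rfl
    refine ⟨e.symm ≪≫ₗ ((LinearEquiv.refl K (K × K)).prodCongr g) ≪≫ₗ e', fun x y => ?_⟩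
    obtain ⟨p, rfl⟩ := e.surjective x
    obtain ⟨q, rfl⟩ := e.surjective y
    simp only [LinearEquiv.trans_apply, LinearEquiv.symm_apply_apply, he, he',
      LinearEquiv.prodCongr_apply, LinearEquiv.refl_apply, hg]

/-- The bilinear form of an alternating matrix is alternating. -/
theorem Matrix.isAlt_toBilin' {R ι : Type*} [CommRing R] [Fintype ι] [LinearOrder ι]
    {C : Matrix ι ι R} (hC : Cᵀ = -C) (hdiag : ∀ i, C i i = 0) : (Matrix.toBilin' C).IsAlt := by
  intro v
  rw [Matrix.toBilin'_apply, ← Finset.sum_product']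
  refine Finset.sum_involution (fun p _ => p.swap) ?_ ?_ (by simp) (by simp)
  · rintro ⟨i, j⟩ -
    have : C j i = -C i j := congrFun₂ hC i j
    simp only [Prod.swap, this]
    ring
  · rintro ⟨i, j⟩ - h hij
    obtain rfl : j = i := congrArg Prod.fst hij
    simp [hdiag] at h

/-- The radical of the bilinear form of a skew-symmetric matrix has complementary dimension
to the rank. -/
theorem Matrix.rank_add_finrank_ker_toBilin' {K ι : Type*} [Field K] [Fintype ι] [DecidableEq ι]
    {C : Matrix ι ι K} (hC : Cᵀ = -C) :
    C.rank + Module.finrank K (LinearMap.ker (Matrix.toBilin' C)) = Fintype.card ι := by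
  have hker : LinearMap.ker (Matrix.toBilin' C) = LinearMap.ker C.mulVecLin := by
    ext v
    have hv : C *ᵥ v = -(v ᵥ* C) := by
      rw [← Matrix.mulVec_transpose, hC, Matrix.neg_mulVec, neg_neg]
    rw [LinearMap.mem_ker, LinearMap.mem_ker, Matrix.mulVecLin_apply, hv, neg_eq_zero,
      ← dotProduct_eq_zero_iff, LinearMap.ext_iff]
    simp [Matrix.toBilin'_apply', Matrix.dotProduct_mulVec]
  rw [hker, Matrix.rank, LinearMap.finrank_range_add_finrank_ker, Module.finrank_pi]

/-- Alternating matrices of the same rank are congruent. -/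
theorem Matrix.exists_congruent_of_alternating {K ι : Type*} [Field K] [Fintype ι] [LinearOrder ι]
    {C C' : Matrix ι ι K} (hC : Cᵀ = -C) (hdiag : ∀ i, C i i = 0)
    (hC' : C'ᵀ = -C') (hdiag' : ∀ i, C' i i = 0) (hrank : C.rank = C'.rank) :
    ∃ P : Matrix ι ι K, IsUnit P.det ∧ Pᵀ * C * P = C' := by
  have h1 := Matrix.rank_add_finrank_ker_toBilin' hC
  have h2 := Matrix.rank_add_finrank_ker_toBilin' hC'
  obtain ⟨e, he⟩ := (Matrix.isAlt_toBilin' hC' hdiag').exists_isometry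
    (Matrix.isAlt_toBilin' hC hdiag) rfl (by omega)
  refine ⟨LinearMap.toMatrix' (e : (ι → K) →ₗ[K] (ι → K)), ?_, ?_⟩
  · rw [LinearMap.det_toMatrix']
    exact e.isUnit_det'
  · apply Matrix.toBilin'.injective
    rw [← Matrix.toBilin'_comp]
    refine LinearMap.ext₂ fun x y => ?_
    simpa using he x y

/-- **The rank distribution of a random `C`-symmetric matrix depends only on `rank C`.**
If `C` and `C'` are `n×n` alternating matrices over a finite field with the same rank, then
for every `s` the number of `C`-symmetric matrices of rank `s` equals the number of
`C'`-symmetric matrices of rank `s`. -/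
theorem cSymmetric_rank_count_depends_only_on_rank (F : Type) [Field F] [Fintype F]
    (n : ℕ) (hn : 1 ≤ n)
    (C C' : Matrix (Fin n) (Fin n) F)
    (hCalt : Cᵀ = -C) (hCdiag : ∀ i, C i i = 0)
    (hC'alt : C'ᵀ = -C') (hC'diag : ∀ i, C' i i = 0)
    (hrank : C.rank = C'.rank) (s : ℕ) :
    Nat.card {M : Matrix (Fin n) (Fin n) F // M - Mᵀ = C ∧ M.rank = s}
      = Nat.card {M : Matrix (Fin n) (Fin n) F // M - Mᵀ = C' ∧ M.rank = s} := by
  obtain ⟨P, hP, rfl⟩ :=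
    Matrix.exists_congruent_of_alternating hCalt hCdiag hC'alt hC'diag hrank
  have hPT : IsUnit Pᵀ.det := by rwa [Matrix.det_transpose]
  let e : Matrix (Fin n) (Fin n) F ≃ Matrix (Fin n) (Fin n) F :=
    { toFun := fun M => Pᵀ * M * P
      invFun := fun M => Pᵀ⁻¹ * M * P⁻¹
      left_inv := fun M => by
        beta_reduce
        rw [Matrix.mul_assoc Pᵀ, Matrix.nonsing_inv_mul_cancel_left _ _ hPT,
          Matrix.mul_nonsing_inv_cancel_right _ _ hP]
      right_inv := fun M => by
        beta_reduce
        rw [Matrix.mul_assoc Pᵀ⁻¹, Matrix.mul_nonsing_inv_cancel_left _ _ hPT,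
          Matrix.nonsing_inv_mul_cancel_right _ _ hP] }
  refine Nat.card_congr (e.subtypeEquiv fun M => and_congr ?_ ?_)
  · have : e M - (e M)ᵀ = e (M - Mᵀ) := by
      simp [e, Matrix.transpose_mul, Matrix.mul_sub, Matrix.sub_mul, Matrix.mul_assoc]
    rw [this]
    exact e.injective.eq_iff.symm
  · have : (e M).rank = M.rank := by
      simp only [e, Equiv.coe_fn_mk]
      rw [Matrix.rank_mul_eq_left_of_isUnit_det _ _ hP,
        Matrix.rank_mul_eq_right_of_isUnit_det _ _ hPT]
    rw [this]
end

section
/- In the f-symmetric setting: let P be a fixed f-symmetric function, let σ be chosen uniformly at random from G, and for an f-symmetric function M write P[P_{n1} = M^σ_{n1}] := (1/#G) · #{σ ∈ G : P(i,j) = M(σ^{-1}(i), σ^{-1}(j)) for all i ≠ j in {1,…,n1}}. Then ∑_M |P[P_{n1} = M^σ_{n1}] − ℓ^{−n1(n1−1)/2}| ≤ ℓ^{n(n−1)/2 − n1(n1−1)/2} · √(∑_{d ≥ 0} S(G, d, n1) · ℓ^{n1·d} − 1), where the sum on the left ranges over all f-symmetric functions M. -/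
open BigOperators

/-- Ordered pairs of distinct indices in `{1,…,n}`. -/
abbrev OffDiag (n : ℕ) : Type := {p : Fin n × Fin n // p.1 ≠ p.2}

/-- `M` is `f`-symmetric: `M(j,i) = f_{ij}(M(i,j))` for all `i ≠ j`. -/
def IsFSym {n : ℕ} {F : Type} (f : Fin n → Fin n → (F ≃ F)) (M : OffDiag n → F) : Prop :=
  ∀ (i j : Fin n) (h : i ≠ j), M ⟨(j, i), h.symm⟩ = f i j (M ⟨(i, j), h⟩)

/-- The permuted function `M^σ`, with `M^σ(i,j) = M(σ⁻¹ i, σ⁻¹ j)`. -/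
def permApply {n : ℕ} {F : Type} (σ : Equiv.Perm (Fin n)) (M : OffDiag n → F) :
    OffDiag n → F :=
  fun p => M ⟨(σ⁻¹ p.1.1, σ⁻¹ p.1.2), fun h => p.2 (σ⁻¹.injective h)⟩

/-- `P` and `M` have equal restrictions to pairs of indices `< n1`
(i.e. `P_{n1} = M_{n1}`). -/
def RestrictEq {n : ℕ} {F : Type} (n1 : ℕ) (P M : OffDiag n → F) : Prop :=
  ∀ p : OffDiag n, (p.1.1 : ℕ) < n1 → (p.1.2 : ℕ) < n1 → P p = M p

/-- The orbit `G[B]` of a finite set `B` of indices under a group `G` of permutations. -/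
def orbitOfBase {n : ℕ} (G : Subgroup (Equiv.Perm (Fin n))) (B : Finset (Fin n)) :
    Set (Finset (Fin n)) :=
  {S | ∃ σ ∈ G, S = B.image σ}

open Classical in
/-- `S(G, d, n1)`: the fraction of sets in the orbit of `B` under `G` meeting `B` in exactly
`d` elements. -/
noncomputable def mixingFraction {n : ℕ} (G : Subgroup (Equiv.Perm (Fin n)))
    (B : Finset (Fin n)) (d : ℕ) : ℝ :=
  (Nat.card {S : Finset (Fin n) | S ∈ orbitOfBase G B ∧ (S ∩ B).card = d} : ℝ) /
    (Nat.card (orbitOfBase G B) : ℝ)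

/-- Functions agreeing with `q` on `T` are free outside `T`. -/
theorem card_fun_eqOn {ι F : Type} [Fintype ι] [Fintype F] (T : Finset ι) (q : ι → F) :
    Nat.card {g : ι → F // ∀ i ∈ T, g i = q i} = Fintype.card F ^ (Fintype.card ι - T.card) := by
  classical
  have key : ∀ g : ι → F, (∀ i ∈ T, g i = q i) ↔
      g ∈ Fintype.piFinset (fun i => if i ∈ T then ({q i} : Finset F) else Finset.univ) := by
    intro g
    simp only [Fintype.mem_piFinset]
    refine forall_congr' fun i => ?_
    by_cases hi : i ∈ T <;> simp [hi]
  rw [Nat.card_congr (Equiv.subtypeEquivRight key), Nat.card_eq_fintype_card, Fintype.card_coe,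
    Fintype.card_piFinset]
  have h : ∀ i, (if i ∈ T then ({q i} : Finset F) else Finset.univ).card
      = if i ∈ T then 1 else Fintype.card F := by
    intro i
    split_ifs <;> simp
  simp only [h]
  rw [Finset.prod_ite]
  simp only [Finset.prod_const_one, one_mul, Finset.prod_const]
  congr 1
  rw [← Finset.card_compl]
  congr 1
  ext i
  simp

/-- Two simultaneous agreement conditions are either inconsistent or amount to a single one. -/
theorem card_fun_eqOn_both_le {ι F : Type} [Fintype ι] [DecidableEq ι] [Fintype F]
    (T T' : Finset ι) (q q' : ι → F) :
    Nat.card {g : ι → F // (∀ i ∈ T, g i = q i) ∧ ∀ i ∈ T', g i = q' i} ≤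
      Fintype.card F ^ (Fintype.card ι - (T ∪ T').card) := by
  classical
  by_cases hne : Nonempty {g : ι → F // (∀ i ∈ T, g i = q i) ∧ ∀ i ∈ T', g i = q' i}
  · obtain ⟨g₀, h, h'⟩ := hne
    rw [← card_fun_eqOn (T ∪ T') g₀]
    refine Nat.card_mono (Set.toFinite {g : ι → F | ∀ i ∈ T ∪ T', g i = g₀ i}) ?_
    rintro g ⟨hg, hg'⟩ i hi
    rcases Finset.mem_union.1 hi with hi | hi
    · rw [hg i hi, h i hi]
    · rw [hg' i hi, h' i hi]
  · rw [not_nonempty_iff] at hne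
    simp

/-- Increasing pairs of indices. -/
abbrev UpperPair (n : ℕ) : Type := {p : Fin n × Fin n // p.1 < p.2}

/-- Increasing pairs with both entries in `S`. -/
def upperPairs {n : ℕ} (S : Finset (Fin n)) : Finset (UpperPair n) :=
  Finset.univ.filter fun p => p.1.1 ∈ S ∧ p.1.2 ∈ S

theorem mem_upperPairs {n : ℕ} {S : Finset (Fin n)} {p : UpperPair n} :
    p ∈ upperPairs S ↔ p.1.1 ∈ S ∧ p.1.2 ∈ S := by
  simp [upperPairs]

theorem upperPairs_inter {n : ℕ} (S T : Finset (Fin n)) :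
    upperPairs S ∩ upperPairs T = upperPairs (S ∩ T) := by
  ext p
  simp only [Finset.mem_inter, mem_upperPairs]
  tauto

theorem card_upperPairs {n : ℕ} (S : Finset (Fin n)) :
    (upperPairs S).card = S.card * (S.card - 1) / 2 := by
  classical
  have h1 : (upperPairs S).card = (S.offDiag.filter fun p => p.1 < p.2).card := by
    refine Finset.card_bij (fun p _ => p.1) ?_ (fun _ _ _ _ h => Subtype.ext h) ?_
    · intro p hp
      rw [mem_upperPairs] at hp
      simp [hp.1, hp.2, p.2, p.2.ne]
    · intro p hp
      simp only [Finset.mem_filter, Finset.mem_offDiag] at hp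
      exact ⟨⟨p, hp.2⟩, mem_upperPairs.2 ⟨hp.1.1, hp.1.2.1⟩, rfl⟩
  have h2 : (S.offDiag.filter fun p => ¬ p.1 < p.2).card =
      (S.offDiag.filter fun p => p.1 < p.2).card := by
    refine Finset.card_bij (fun p _ => p.swap) ?_ (fun _ _ _ _ h => Prod.swap_injective h) ?_
    · intro p hp
      simp only [Finset.mem_filter, Finset.mem_offDiag, Prod.fst_swap, Prod.snd_swap] at hp ⊢
      exact ⟨⟨hp.1.2.1, hp.1.1, hp.1.2.2.symm⟩, lt_of_le_of_ne (not_lt.1 hp.2) hp.1.2.2.symm⟩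
    · intro p hp
      simp only [Finset.mem_filter, Finset.mem_offDiag] at hp
      refine ⟨p.swap, ?_, Prod.swap_swap p⟩
      simp only [Finset.mem_filter, Finset.mem_offDiag, Prod.fst_swap, Prod.snd_swap]
      exact ⟨⟨hp.1.2.1, hp.1.1, hp.1.2.2.symm⟩, not_lt.2 hp.2.le⟩
  have h3 := Finset.card_filter_add_card_filter_not (s := S.offDiag) (fun p => p.1 < p.2)
  rw [Finset.offDiag_card] at h3
  rw [Nat.mul_sub, mul_one]
  omega

theorem card_upperPair (n : ℕ) : Fintype.card (UpperPair n) = n * (n - 1) / 2 := by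
  have h := card_upperPairs (Finset.univ : Finset (Fin n))
  rw [Finset.card_fin] at h
  rw [← h, ← Finset.card_univ]
  congr 1
  ext p
  simp [mem_upperPairs]

/-- An `f`-symmetric function is determined by its values on increasing pairs,
which are arbitrary. -/
def fsymEquiv {n : ℕ} {F : Type} (f : Fin n → Fin n → (F ≃ F))
    (hf : ∀ i j : Fin n, i ≠ j → f j i = (f i j).symm) :
    {M : OffDiag n → F // IsFSym f M} ≃ (UpperPair n → F) where
  toFun M p := M.1 ⟨p.1, p.2.ne⟩
  invFun g :=
    ⟨fun p => if h : p.1.1 < p.1.2 then g ⟨p.1, h⟩ else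
      f p.1.2 p.1.1 (g ⟨(p.1.2, p.1.1), lt_of_le_of_ne (not_lt.1 h) p.2.symm⟩), by
      intro i j h
      rcases lt_or_gt_of_ne h with hlt | hlt
      · simp [hlt, hlt.not_gt]
      · simp [hlt, hlt.not_gt, hf j i hlt.ne]⟩
  left_inv M := by
    ext ⟨⟨i, j⟩, h⟩
    rcases lt_or_gt_of_ne h with hlt | hlt
    · have hlt' : i < j := hlt
      simp [hlt']
    · have hlt' : j < i := hlt
      simp [hlt'.not_gt, ← M.2 j i hlt'.ne]
  right_inv g := by
    ext ⟨p, h⟩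
    simp [h]

/-- `M^σ` agrees with `P` on the pairs of `B` exactly when `M` agrees with `P^(σ⁻¹)` on the
increasing pairs of `σ⁻¹ B`. -/
theorem restrictEq_permApply_iff {n n1 : ℕ} {F : Type} {f : Fin n → Fin n → (F ≃ F)}
    (hf : ∀ i j : Fin n, i ≠ j → f j i = (f i j).symm) {σ : Equiv.Perm (Fin n)}
    (hσ : ∀ i j : Fin n, i ≠ j → f (σ i) (σ j) = f i j)
    {P : OffDiag n → F} (hP : IsFSym f P) (M : {M : OffDiag n → F // IsFSym f M}) :
    RestrictEq n1 P (permApply σ M.1) ↔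
      ∀ p ∈ upperPairs ((Finset.univ.filter fun i : Fin n => (i : ℕ) < n1).image ⇑σ⁻¹),
        fsymEquiv f hf M p = P ⟨(σ p.1.1, σ p.1.2), fun h => p.2.ne (σ.injective h)⟩ := by
  have hmem : ∀ a : Fin n, a ∈ (Finset.univ.filter fun i : Fin n => (i : ℕ) < n1).image ⇑σ⁻¹ ↔
      (σ a : ℕ) < n1 := by
    intro a
    simp only [Finset.mem_image, Finset.mem_filter, Finset.mem_univ, true_and]
    constructor
    · rintro ⟨b, hb, rfl⟩
      simpa using hb
    · intro h
      exact ⟨σ a, h, by simp⟩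
  constructor
  · intro h p hp
    rw [mem_upperPairs, hmem, hmem] at hp
    have := h ⟨(σ p.1.1, σ p.1.2), fun h => p.2.ne (σ.injective h)⟩ hp.1 hp.2
    rw [this]
    simp [permApply, fsymEquiv]
  · intro h
    have key : ∀ a b : Fin n, ∀ hab : a < b, (σ a : ℕ) < n1 → (σ b : ℕ) < n1 →
        M.1 ⟨(a, b), hab.ne⟩ = P ⟨(σ a, σ b), fun h => hab.ne (σ.injective h)⟩ := by
      intro a b hab ha hb
      exact h ⟨(a, b), hab⟩ (mem_upperPairs.2 ⟨(hmem a).2 ha, (hmem b).2 hb⟩)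
    have key' : ∀ a b : Fin n, ∀ hab : a ≠ b, (σ a : ℕ) < n1 → (σ b : ℕ) < n1 →
        M.1 ⟨(a, b), hab⟩ = P ⟨(σ a, σ b), fun h => hab (σ.injective h)⟩ := by
      intro a b hab ha hb
      rcases lt_or_gt_of_ne hab with hlt | hlt
      · exact key a b hlt ha hb
      · rw [M.2 b a hlt.ne, key b a hlt hb ha,
          hP (σ b) (σ a) (fun h => hlt.ne (σ.injective h)), hσ b a hlt.ne]
    rintro ⟨⟨i, j⟩, hij⟩ hi hj
    have := key' (σ⁻¹ i) (σ⁻¹ j) (fun h => hij (σ⁻¹.injective h)) (by simpa using hi)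
      (by simpa using hj)
    simp only [permApply]
    rw [this]
    simp

/-- Second-moment bound for the deviation from a constant `c` of the probability that a random
`σ` is related to `x`. -/
theorem sum_abs_prob_sub_le {X H : Type} [Fintype X] [Fintype H] [Nonempty H]
    (R : H → X → Prop) (a c : ℝ) (w : H → H → ℝ)
    (h1 : ∀ σ, (Nat.card {x // R σ x} : ℝ) = a)
    (h2 : ∀ σ τ, (Nat.card {x // R σ x ∧ R τ x} : ℝ) ≤ w σ τ) :
    ∑ x, |(Nat.card {σ // R σ x} : ℝ) / Fintype.card H - c| ≤
      Real.sqrt (Fintype.card X *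
        ((∑ σ, ∑ τ, w σ τ) / (Fintype.card H : ℝ) ^ 2 - 2 * c * a + Fintype.card X * c ^ 2)) := by
  classical
  have hH : (0 : ℝ) < Fintype.card H := by exact_mod_cast Fintype.card_pos
  have hx : ∀ x, (Nat.card {σ // R σ x} : ℝ) = ∑ σ, if R σ x then (1 : ℝ) else 0 := by
    intro x
    rw [Nat.card_eq_fintype_card, Fintype.card_subtype, Finset.sum_boole]
  have h1' : ∀ σ, ∑ x, (if R σ x then (1 : ℝ) else 0) = a := by
    intro σ
    rw [← h1 σ, Nat.card_eq_fintype_card, Fintype.card_subtype, Finset.sum_boole]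
  have h2' : ∀ σ τ, ∑ x, (if R σ x then (1 : ℝ) else 0) * (if R τ x then (1 : ℝ) else 0)
      ≤ w σ τ := by
    intro σ τ
    refine le_trans (le_of_eq ?_) (h2 σ τ)
    rw [Nat.card_eq_fintype_card, Fintype.card_subtype, ← Finset.sum_boole]
    refine Finset.sum_congr rfl fun x _ => ?_
    by_cases h : R σ x <;> by_cases h' : R τ x <;> simp [h, h']
  set N : X → ℝ := fun x => Nat.card {σ // R σ x} with hN
  have s1 : ∑ x, N x = Fintype.card H * a := by
    simp only [hN, hx]
    rw [Finset.sum_comm]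
    simp [h1']
  have s2 : ∑ x, N x ^ 2 ≤ ∑ σ, ∑ τ, w σ τ := by
    simp only [hN, hx, sq, Finset.sum_mul_sum]
    rw [Finset.sum_comm]
    refine Finset.sum_le_sum fun σ _ => ?_
    rw [Finset.sum_comm]
    exact Finset.sum_le_sum fun τ _ => h2' σ τ
  apply Real.le_sqrt_of_sq_le
  have cs := sq_sum_le_card_mul_sum_sq (s := (Finset.univ : Finset X))
    (f := fun x => |N x / Fintype.card H - c|)
  refine cs.trans ?_
  rw [Finset.card_univ]
  refine mul_le_mul_of_nonneg_left ?_ (Nat.cast_nonneg _)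
  have e : ∑ x, |N x / Fintype.card H - c| ^ 2 =
      (∑ x, N x ^ 2) / (Fintype.card H : ℝ) ^ 2 - 2 * c * ((∑ x, N x) / Fintype.card H) +
        Fintype.card X * c ^ 2 := by
    simp only [sq_abs, sub_sq, Finset.sum_add_distrib, Finset.sum_sub_distrib, Finset.sum_div,
      Finset.mul_sum, Finset.sum_const, Finset.card_univ, nsmul_eq_mul, div_pow]
    congr 2
    refine Finset.sum_congr rfl fun x _ => ?_
    ring
  rw [e, s1, mul_div_cancel_left₀ _ hH.ne']
  gcongr

open Classical in
/-- Averaging a function of `σ B` over `σ ∈ G` is averaging over the orbit of `B`. -/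
theorem sum_image_div_card {n : ℕ} (G : Subgroup (Equiv.Perm (Fin n))) (B : Finset (Fin n))
    (φ : ℕ → ℝ) :
    (∑ ρ : G, φ (B.image ⇑ρ.1 ∩ B).card) / Fintype.card G =
      ∑' d : ℕ, mixingFraction G B d * φ d := by
  set O : Finset (Finset (Fin n)) := Finset.univ.filter (· ∈ orbitOfBase G B) with hO
  set s : ℕ := (Finset.univ.filter fun ρ : G => B.image ⇑ρ.1 = B).card with hs
  have hmem : ∀ ρ : G, B.image ⇑ρ.1 ∈ O := by
    intro ρ
    simp only [hO, Finset.mem_filter, Finset.mem_univ, true_and]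
    exact ⟨ρ.1, ρ.2, rfl⟩
  have hfib : ∀ S ∈ O, (Finset.univ.filter fun ρ : G => B.image ⇑ρ.1 = S).card = s := by
    intro S hS
    simp only [hO, Finset.mem_filter, Finset.mem_univ, true_and] at hS
    obtain ⟨σ, hσ, rfl⟩ := hS
    refine Finset.card_equiv (Equiv.mulLeft (⟨σ, hσ⟩ : G)⁻¹) fun ρ => ?_
    simp only [Finset.mem_filter, Finset.mem_univ, true_and, Equiv.coe_mulLeft,
      Subgroup.coe_mul, InvMemClass.coe_inv, Equiv.Perm.coe_mul]
    rw [← Finset.image_image]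
    constructor
    · intro h
      rw [h, Finset.image_image]
      simp
    · intro h
      conv_rhs => rw [← h]
      rw [Finset.image_image]
      simp
  have hs0 : 0 < s := by
    refine Finset.card_pos.2 ⟨1, ?_⟩
    simp
  have hcard : Fintype.card G = O.card * s := by
    rw [← Finset.card_univ, Finset.card_eq_sum_card_fiberwise (t := O) (fun ρ _ => hmem ρ),
      Finset.sum_congr rfl hfib, Finset.sum_const, smul_eq_mul]
  have hsum : ∑ ρ : G, φ (B.image ⇑ρ.1 ∩ B).card = s * ∑ S ∈ O, φ (S ∩ B).card := by
    rw [← Finset.sum_fiberwise_of_maps_to (t := O) (fun ρ _ => hmem ρ), Finset.mul_sum]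
    refine Finset.sum_congr rfl fun S hS => ?_
    rw [← hfib S hS, ← nsmul_eq_mul, ← Finset.sum_const]
    refine Finset.sum_congr rfl fun ρ hρ => ?_
    rw [(Finset.mem_filter.1 hρ).2]
  have hmix : ∀ d, mixingFraction G B d = ((O.filter fun S => (S ∩ B).card = d).card : ℝ) /
      O.card := by
    intro d
    have hnum : {S : Finset (Fin n) | S ∈ orbitOfBase G B ∧ (S ∩ B).card = d} =
        ↑(O.filter fun S => (S ∩ B).card = d) := by
      ext S
      simp [hO]
    have hden : orbitOfBase G B = ↑O := by
      ext S
      simp [hO]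
    rw [mixingFraction, Nat.card_coe_set_eq, Nat.card_coe_set_eq, hnum, hden,
      Set.ncard_coe_finset, Set.ncard_coe_finset]
  have hle : ∀ S : Finset (Fin n), (S ∩ B).card ∈ Finset.range (n + 1) := by
    intro S
    have := Finset.card_le_univ (S ∩ B)
    rw [Fintype.card_fin] at this
    exact Finset.mem_range.2 (by omega)
  rw [tsum_eq_sum (s := Finset.range (n + 1))]
  · simp only [hmix, div_mul_eq_mul_div]
    rw [← Finset.sum_div, hsum, hcard, Nat.cast_mul, mul_comm (O.card : ℝ),
      mul_div_mul_left _ _ (by exact_mod_cast hs0.ne')]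
    congr 1
    rw [← Finset.sum_fiberwise_of_maps_to (t := Finset.range (n + 1)) (fun S _ => hle S)]
    refine Finset.sum_congr rfl fun d _ => ?_
    rw [← nsmul_eq_mul, ← Finset.sum_const]
    refine Finset.sum_congr rfl fun S hS => ?_
    rw [(Finset.mem_filter.1 hS).2]
  · intro d hd
    rw [hmix, Finset.filter_false_of_mem]
    · simp
    · rintro S _ rfl
      exact hd (hle S)

theorem card_image_inv_inter {n : ℕ} (σ τ : Equiv.Perm (Fin n)) (B : Finset (Fin n)) :
    (B.image ⇑σ⁻¹ ∩ B.image ⇑τ⁻¹).card = (B.image ⇑(τ * σ⁻¹) ∩ B).card := by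
  rw [← Finset.card_image_of_injective _ τ.injective, Finset.image_inter _ _ τ.injective,
    Finset.image_image, Finset.image_image]
  simp

open Classical in
/-- **Averaging trick (Lemma on random row/column permutations).**  Let `P` be a fixed
`f`-symmetric function and let `σ` be uniform in `G`.  Then
`∑_M |P[P_{n1} = M^σ_{n1}] - ℓ^{-n1(n1-1)/2}| ≤ ℓ^{n(n-1)/2 - n1(n1-1)/2} ·
  √(∑_{d≥0} S(G,d,n1) ℓ^{n1·d} - 1)`,
the sum ranging over all `f`-symmetric functions `M`. -/
theorem averaging_trick (F : Type) [Fintype F] (ℓ : ℕ) (hℓ : Fintype.card F = ℓ)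
    (n n1 : ℕ) (hn1 : 1 ≤ n1) (hn1n : n1 ≤ n)
    (f : Fin n → Fin n → (F ≃ F)) (hf : ∀ i j : Fin n, i ≠ j → f j i = (f i j).symm)
    (G : Subgroup (Equiv.Perm (Fin n)))
    (hG : ∀ σ ∈ G, ∀ i j : Fin n, i ≠ j → f (σ i) (σ j) = f i j)
    (P : OffDiag n → F) (hP : IsFSym f P) :
    ∑ M : {M : OffDiag n → F // IsFSym f M},
        |(Nat.card {σ : Equiv.Perm (Fin n) //
              σ ∈ G ∧ RestrictEq n1 P (permApply σ M.1)} : ℝ) / (Nat.card G : ℝ) -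
          (ℓ : ℝ) ^ (-((n1 * (n1 - 1) / 2 : ℕ) : ℤ))|
      ≤ (ℓ : ℝ) ^ (n * (n - 1) / 2 - n1 * (n1 - 1) / 2) *
          Real.sqrt
            ((∑' d : ℕ,
                mixingFraction G (Finset.univ.filter fun i : Fin n => (i : ℕ) < n1) d *
                  (ℓ : ℝ) ^ (n1 * d)) - 1) := by
  classical
  set B : Finset (Fin n) := Finset.univ.filter fun i : Fin n => (i : ℕ) < n1 with hB
  have hBcard : B.card = n1 := by
    rw [hB, Fin.card_filter_val_lt, min_eq_right hn1n]
  set N := n * (n - 1) / 2 with hN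
  set k := n1 * (n1 - 1) / 2 with hk
  have hkN : k ≤ N := Nat.div_le_div_right (Nat.mul_le_mul hn1n (by omega))
  have hX : Fintype.card {M : OffDiag n → F // IsFSym f M} = ℓ ^ N := by
    rw [Fintype.card_congr (fsymEquiv f hf), Fintype.card_fun, card_upperPair, hℓ]
  rcases Nat.eq_zero_or_pos ℓ with h0 | hpos
  · have hn : n = 1 := by
      by_contra hne
      have : IsEmpty F := Fintype.card_eq_zero_iff.1 (hℓ.trans h0)
      have h01 : (⟨0, by omega⟩ : Fin n) ≠ ⟨1, by omega⟩ := by simp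
      exact this.elim (P ⟨(_, _), h01⟩)
    have hk0 : k = 0 := by
      have : n1 = 1 := by omega
      simp [hk, this]
    refine le_trans (le_of_eq (Finset.sum_eq_zero fun M _ => ?_)) (by positivity)
    have hall : ∀ σ : Equiv.Perm (Fin n), RestrictEq n1 P (permApply σ M.1) := by
      subst hn
      exact fun σ p => absurd (Subsingleton.elim _ _) p.2
    have hG0 : (Nat.card G : ℝ) ≠ 0 := by exact_mod_cast Nat.card_pos.ne'
    have hcard : Nat.card {σ : Equiv.Perm (Fin n) //
        σ ∈ G ∧ RestrictEq n1 P (permApply σ M.1)} = Nat.card G :=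
      Nat.card_congr (Equiv.subtypeEquivRight fun σ => by simp [hall])
    rw [hcard, hk0, div_self hG0]
    simp
  have hℓ0 : (0 : ℝ) < ℓ := by exact_mod_cast hpos
  set w : ℕ → ℝ := fun d => (ℓ : ℝ) ^ N / (ℓ : ℝ) ^ k / (ℓ : ℝ) ^ k * (ℓ : ℝ) ^ (n1 * d) with hw
  have himg : ∀ σ : Equiv.Perm (Fin n), (B.image ⇑σ⁻¹).card = n1 := fun σ => by
    rw [Finset.card_image_of_injective _ (σ⁻¹).injective, hBcard]
  set Q : G → UpperPair n → F :=
    fun σ p => P ⟨(σ.1 p.1.1, σ.1 p.1.2), fun h => p.2.ne (σ.1.injective h)⟩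
  have hR : ∀ (σ : G) (M : {M : OffDiag n → F // IsFSym f M}),
      RestrictEq n1 P (permApply σ.1 M.1) ↔
        ∀ p ∈ upperPairs (B.image ⇑(σ.1)⁻¹), fsymEquiv f hf M p = Q σ p :=
    fun σ M => restrictEq_permApply_iff hf (hG σ.1 σ.2) hP M
  have h1 : ∀ σ : G, (Nat.card {M : {M : OffDiag n → F // IsFSym f M} //
      RestrictEq n1 P (permApply σ.1 M.1)} : ℝ) = (ℓ : ℝ) ^ N / (ℓ : ℝ) ^ k := by
    intro σ
    rw [Nat.card_congr ((fsymEquiv f hf).subtypeEquiv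
      (q := fun g => ∀ p ∈ upperPairs (B.image ⇑(σ.1)⁻¹), g p = Q σ p) (hR σ)),
      card_fun_eqOn, card_upperPairs, card_upperPair, himg, hℓ, Nat.cast_pow,
      pow_sub₀ _ hℓ0.ne' hkN, div_eq_mul_inv]
  have h2 : ∀ σ τ : G, (Nat.card {M : {M : OffDiag n → F // IsFSym f M} //
      RestrictEq n1 P (permApply σ.1 M.1) ∧ RestrictEq n1 P (permApply τ.1 M.1)} : ℝ) ≤
      w (B.image ⇑(τ * σ⁻¹).1 ∩ B).card := by
    intro σ τ
    have hd : (B.image ⇑(σ.1)⁻¹ ∩ B.image ⇑(τ.1)⁻¹).card = (B.image ⇑(τ * σ⁻¹).1 ∩ B).card :=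
      card_image_inv_inter σ.1 τ.1 B
    have hunion := Finset.card_union_add_card_inter (upperPairs (B.image ⇑(σ.1)⁻¹))
      (upperPairs (B.image ⇑(τ.1)⁻¹))
    have hUle := Finset.card_le_univ
      (upperPairs (B.image ⇑(σ.1)⁻¹) ∪ upperPairs (B.image ⇑(τ.1)⁻¹))
    rw [Nat.card_congr ((fsymEquiv f hf).subtypeEquiv
      (q := fun g => (∀ p ∈ upperPairs (B.image ⇑(σ.1)⁻¹), g p = Q σ p) ∧
        ∀ p ∈ upperPairs (B.image ⇑(τ.1)⁻¹), g p = Q τ p)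
      fun M => and_congr (hR σ M) (hR τ M))]
    refine (Nat.cast_le.2 (card_fun_eqOn_both_le _ _ _ _)).trans ?_
    rw [upperPairs_inter, card_upperPairs, card_upperPairs, card_upperPairs, himg, himg, hd]
      at hunion
    rw [card_upperPair] at hUle ⊢
    have hdle : (B.image ⇑(τ * σ⁻¹).1 ∩ B).card ≤ n1 :=
      (Finset.card_le_card Finset.inter_subset_right).trans hBcard.le
    generalize (B.image ⇑(τ * σ⁻¹).1 ∩ B).card = d at *
    have hdd : d * (d - 1) / 2 ≤ n1 * d := by
      refine (Nat.div_le_self _ _).trans ?_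
      rw [mul_comm]
      exact Nat.mul_le_mul_right _ (by omega)
    rw [hℓ, Nat.cast_pow, hw]
    simp only
    rw [div_div, ← pow_add, div_mul_eq_mul_div, le_div_iff₀ (by positivity), ← pow_add, ← pow_add]
    refine pow_le_pow_right₀ (by exact_mod_cast hpos) ?_
    omega
  have main := sum_abs_prob_sub_le
    (fun (σ : G) (M : {M : OffDiag n → F // IsFSym f M}) => RestrictEq n1 P (permApply σ.1 M.1))
    _ ((ℓ : ℝ) ^ (-(k : ℤ))) _ h1 h2
  have hww : (∑ σ : G, ∑ τ : G, w (B.image ⇑(τ * σ⁻¹).1 ∩ B).card) / (Fintype.card G : ℝ) ^ 2 =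
      (ℓ : ℝ) ^ N / (ℓ : ℝ) ^ k / (ℓ : ℝ) ^ k *
        ∑' d : ℕ, mixingFraction G B d * (ℓ : ℝ) ^ (n1 * d) := by
    have hσ : ∀ σ : G, ∑ τ : G, w (B.image ⇑(τ * σ⁻¹).1 ∩ B).card =
        ∑ ρ : G, w (B.image ⇑ρ.1 ∩ B).card := fun σ =>
      Equiv.sum_comp (Equiv.mulRight σ⁻¹) fun ρ : G => w (B.image ⇑ρ.1 ∩ B).card
    have hc : (Fintype.card G : ℝ) ≠ 0 := by exact_mod_cast Fintype.card_ne_zero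
    rw [← sum_image_div_card G B fun d => (ℓ : ℝ) ^ (n1 * d)]
    simp only [hσ, Finset.sum_const, Finset.card_univ, nsmul_eq_mul]
    simp only [hw, ← Finset.mul_sum]
    field_simp
  rw [hww, hX] at main
  have hnum : (((ℓ ^ N : ℕ) : ℝ) * ((ℓ : ℝ) ^ N / (ℓ : ℝ) ^ k / (ℓ : ℝ) ^ k *
        (∑' d : ℕ, mixingFraction G B d * (ℓ : ℝ) ^ (n1 * d)) -
        2 * (ℓ : ℝ) ^ (-(k : ℤ)) * ((ℓ : ℝ) ^ N / (ℓ : ℝ) ^ k) +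
        ((ℓ ^ N : ℕ) : ℝ) * ((ℓ : ℝ) ^ (-(k : ℤ))) ^ 2)) =
      ((ℓ : ℝ) ^ (N - k)) ^ 2 *
        ((∑' d : ℕ, mixingFraction G B d * (ℓ : ℝ) ^ (n1 * d)) - 1) := by
    rw [pow_sub₀ _ hℓ0.ne' hkN, zpow_neg, zpow_natCast, Nat.cast_pow]
    field_simp
    ring
  rw [hnum, Real.sqrt_mul (by positivity), Real.sqrt_sq (by positivity)] at main
  refine le_trans (le_of_eq ?_) main
  refine Finset.sum_congr rfl fun M _ => ?_
  rw [Nat.card_eq_fintype_card (α := G)]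
  congr 4
  exact Nat.card_congr (Equiv.subtypeSubtypeEquivSubtypeInter (· ∈ G)
    fun σ => RestrictEq n1 P (permApply σ M.1)).symm
end
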